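/- Let M > 0, γ₀ > 0, ρ > 0, and for each n ∈ ℤ² let μ_n be a Borel probability measure on ℝ with μ_n([0,M]) = 1 and μ_n({s : |s − t| > γ₀/2}) ≥ ρ for every t ∈ [0,M]. There exists a constant C > 0 (depending on M, γ₀, ρ) such that for every integer K ≥ 1 there are a smallness threshold and constants C_{η,ε,δ,K} for which the following holds. Fix Ē ∈ ℝ and suppose: (1) η > ε > δ > 0 are below the threshold; (2) L₀ ≥ L₁ ≥ L₂ ≥ L₃ ≥ L₄ ≥ L₅ ≥ C_{η,ε,δ,K} are powers of 2 with L_k^{1−2δ} ≥ L_{k+1} ≥ L_k^{1−ε} for 0 ≤ k ≤ 4; (3) Λ ⊆ ℤ² is a square of side length L₀; (4) Λ'₁,…,Λ'_K ⊆ Λ are squares of side length L₃; (5) G ⊆ Λ'₁ ∪ … ∪ Λ'_K with 0 < |G| ≤ L₀^δ; (6) F ⊆ ℤ² is η-regular in every square Λ' ⊆ Λ\(Λ'₁ ∪ … ∪ Λ'_K) of side length L₃; (7) v : F → [0,M] is such that for every V : Λ → [0,M] with V = v on F ∩ Λ, every E with |E − Ē| ≤ e^{−L₅}, and every ψ : Λ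 → ℝ with H_Λψ = Eψ, one has e^{L₄}·‖ψ‖_{ℓ²(Λ\(Λ'₁∪…∪Λ'_K))} ≤ ‖ψ‖_{ℓ²(Λ)} ≤ (1 + L₀^{−δ})·‖ψ‖_{ℓ²(G)}. Then the product measure ⊗_{n∈Λ\F} μ_n of the set of configurations ω : Λ\F → ℝ such that, with V = v on F ∩ Λ and V = ω on Λ\F, the matrix H_Λ − Ē·I is invertible with operator norm ‖(H_Λ − Ē·I)⁻¹‖ ≤ e^{L₁}, is at least 1 − L₀^{Cε−1/2}. -/

import Mathlib

open MeasureTheory ProbabilityTheory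
open scoped Classical

noncomputable section

/-- Euclidean distance between two points of `ℤ²`. -/
def eudist (x y : ℤ × ℤ) : ℝ :=
  Real.sqrt ((((x.1 - y.1 : ℤ) : ℝ)) ^ 2 + (((x.2 - y.2 : ℤ) : ℝ)) ^ 2)

/-- The square `([a, a+L−1] × [b, b+L−1]) ∩ ℤ²` of side length `L`. -/
def sqZ (a b : ℤ) (L : ℕ) : Finset (ℤ × ℤ) :=
  Finset.Icc a (a + L - 1) ×ˢ Finset.Icc b (b + L - 1)

/-- The truncated Hamiltonian `H_Λ`: the `Λ×Λ` matrix with diagonal entries `4 + V x`,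
entries `−1` between nearest neighbours (`‖x−y‖₁ = 1`) and `0` otherwise. -/
def Ham (V : ℤ × ℤ → ℝ) (Λ : Finset (ℤ × ℤ)) : Matrix Λ Λ ℝ :=
  fun x y =>
    if (x : ℤ × ℤ) = (y : ℤ × ℤ) then 4 + V x
    else if ((x : ℤ × ℤ).1 - (y : ℤ × ℤ).1).natAbs + ((x : ℤ × ℤ).2 - (y : ℤ × ℤ).2).natAbs = 1
      then -1 else 0

/-- Entries of a `Λ×Λ` matrix, extended by `0` outside `Λ`. -/
def entry {Λ : Finset (ℤ × ℤ)} (A : Matrix Λ Λ ℝ) (x y : ℤ × ℤ) : ℝ :=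
  if hx : x ∈ Λ then (if hy : y ∈ Λ then A ⟨x, hx⟩ ⟨y, hy⟩ else 0) else 0

/-- Extension by zero of a potential defined on `Λ`. -/
def extV (Λ : Finset (ℤ × ℤ)) (V : Λ → ℝ) : ℤ × ℤ → ℝ :=
  fun n => if h : n ∈ Λ then V ⟨n, h⟩ else 0

/-- `ψ` satisfies `Hψ = Eψ` (with potential `V`) at every site of `S`. -/
def EigOn (V : ℤ × ℤ → ℝ) (E : ℝ) (ψ : ℤ × ℤ → ℝ) (S : Set (ℤ × ℤ)) : Prop :=
  ∀ n ∈ S, (4 + V n) * ψ n - ψ (n.1 + 1, n.2) - ψ (n.1 - 1, n.2)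
      - ψ (n.1, n.2 + 1) - ψ (n.1, n.2 - 1) = E * ψ n

/-- The tilted rectangle `{n : a₁ ≤ s(n) ≤ a₂, b₁ ≤ t(n) ≤ b₂}` in the tilted
coordinates `s = x + y`, `t = x − y`. -/
def tRect (a₁ a₂ b₁ b₂ : ℤ) : Set (ℤ × ℤ) :=
  {n | a₁ ≤ n.1 + n.2 ∧ n.1 + n.2 ≤ a₂ ∧ b₁ ≤ n.1 - n.2 ∧ n.1 - n.2 ≤ b₂}

/-- The tilted rectangle as a finite set. -/
def tRectF (a₁ a₂ b₁ b₂ : ℤ) : Finset (ℤ × ℤ) :=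
  ((Finset.Icc (-(|a₁| + |a₂| + |b₁| + |b₂|)) (|a₁| + |a₂| + |b₁| + |b₂|)) ×ˢ
    (Finset.Icc (-(|a₁| + |a₂| + |b₁| + |b₂|)) (|a₁| + |a₂| + |b₁| + |b₂|))).filter
    (fun n => a₁ ≤ n.1 + n.2 ∧ n.1 + n.2 ≤ a₂ ∧ b₁ ≤ n.1 - n.2 ∧ n.1 - n.2 ≤ b₂)

/-- `F` is `ε`-sparse in `R`: along every diagonal (in either tilted direction),
`F` occupies at most an `ε` fraction of `R`. -/
def SparseIn (ε : ℝ) (F R : Set (ℤ × ℤ)) : Prop :=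
  ∀ k : ℤ,
    ((F ∩ R ∩ {n | n.1 + n.2 = k}).ncard : ℝ) ≤ ε * ((R ∩ {n | n.1 + n.2 = k}).ncard : ℝ) ∧
    ((F ∩ R ∩ {n | n.1 - n.2 = k}).ncard : ℝ) ≤ ε * ((R ∩ {n | n.1 - n.2 = k}).ncard : ℝ)

/-- A tilted square: a tilted rectangle with equal side lengths. -/
def IsTiltedSquare (Q : Set (ℤ × ℤ)) : Prop :=
  ∃ (c d : ℤ) (a : ℕ), 0 < a ∧ Q = tRect c (c + a - 1) d (d + a - 1)

/-- `F` is `ε`-regular in `Λ`: any finite disjoint collection of tilted squares inside `Λ`,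
in none of which `F` is `ε`-sparse, covers at most an `ε` fraction of `Λ`. -/
def RegularIn (ε : ℝ) (F : Set (ℤ × ℤ)) (Λ : Set (ℤ × ℤ)) : Prop :=
  ∀ (m : ℕ) (Q : Fin m → Set (ℤ × ℤ)),
    (∀ i, IsTiltedSquare (Q i)) → (∀ i, Q i ⊆ Λ) →
    Pairwise (Function.onFun Disjoint Q) →
    (∀ i, ¬ SparseIn ε F (Q i)) →
    ((⋃ i, Q i).ncard : ℝ) ≤ ε * (Λ.ncard : ℝ)

/-- The lattice points of the axis-parallel square concentric with the square
`sqZ a b L` whose area is `c` times that of `sqZ a b L`. -/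
def scaledSq (a b : ℤ) (L : ℕ) (c : ℝ) : Set (ℤ × ℤ) :=
  {n | |(n.1 : ℝ) - ((a : ℝ) + ((L : ℝ) - 1) / 2)| ≤ Real.sqrt c * L / 2 ∧
       |(n.2 : ℝ) - ((b : ℝ) + ((L : ℝ) - 1) / 2)| ≤ Real.sqrt c * L / 2}

/-- The lattice points of the tilted square concentric with the tilted square
`tRect c (c+a−1) d (d+a−1)` whose area is `r` times as large. -/
def scaledTSq (c d : ℤ) (a : ℕ) (r : ℝ) : Set (ℤ × ℤ) :=
  {n | |((n.1 + n.2 : ℤ) : ℝ) - ((c : ℝ) + ((a : ℝ) - 1) / 2)| ≤ Real.sqrt r * a / 2 ∧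
       |((n.1 - n.2 : ℤ) : ℝ) - ((d : ℝ) + ((a : ℝ) - 1) / 2)| ≤ Real.sqrt r * a / 2}

/-- The scaled tilted square as a finite set. -/
def scaledTSqF (c d : ℤ) (a : ℕ) (r : ℝ) : Finset (ℤ × ℤ) :=
  (tRectF (c - ⌈Real.sqrt r * a⌉ - a) (c + a + ⌈Real.sqrt r * a⌉)
      (d - ⌈Real.sqrt r * a⌉ - a) (d + a + ⌈Real.sqrt r * a⌉)).filter
    (fun n => n ∈ scaledTSq c d a r)

/-- The boundary of `Λ'` inside `Λ`: pairs `(u,v)` with `u ∈ Λ'`, `v ∈ Λ \ Λ'`,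
`‖u − v‖₁ = 1`. -/
def bdry (Λ Λ' : Finset (ℤ × ℤ)) : Finset ((ℤ × ℤ) × (ℤ × ℤ)) :=
  (Λ' ×ˢ (Λ \ Λ')).filter
    (fun uv => (uv.1.1 - uv.2.1).natAbs + (uv.1.2 - uv.2.2).natAbs = 1)

/-- `w` satisfies the four-corner recurrence with coefficients `c` and error `κ` on the
rectangle `[0,a] × [0,Q]`. -/
def CornerRec (w c : ℕ → ℕ → ℝ) (κ : ℝ) (a Q : ℕ) : Prop :=
  ∀ p q, p + 2 ≤ a → q + 2 ≤ Q →
    |w (p + 2) (q + 2) + w p (q + 2) + w (p + 2) q + w p q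
      - c (p + 1) (q + 1) * w (p + 1) (q + 1)| ≤ κ

/-- `w` is supported on sites with even coordinate sum. -/
def ParityZero (w : ℕ → ℕ → ℝ) : Prop := ∀ p q, p % 2 ≠ q % 2 → w p q = 0

lemma corner_alternate {w c : ℕ → ℕ → ℝ} {κ A X : ℝ} {a Q q : ℕ}
    (hrec : CornerRec w c κ a Q) (hq : q + 2 ≤ Q)
    (hA : ∀ p q, p ≤ a → q ≤ Q → |c p q| ≤ A)
    (h0 : ∀ p ≤ a, |w p q| ≤ X) (h1 : ∀ p ≤ a, |w p (q + 1)| ≤ X)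
    (p k : ℕ) (hk : p + 2 * k ≤ a) :
    |w (p + 2 * k) (q + 2) - (-1) ^ k * w p (q + 2)| ≤ k * ((A + 2) * X + κ) := by
  induction k with
  | zero => simp
  | succ k ih =>
    have ih := ih (by omega)
    have h := hrec (p + 2 * k) q (by omega) hq
    have e1 := h0 (p + 2 * k) (by omega)
    have e2 := h0 (p + 2 * k + 2) (by omega)
    have e3 := h1 (p + 2 * k + 1) (by omega)
    have e4 := hA (p + 2 * k + 1) (q + 1) (by omega) (by omega)
    have e5 : |c (p + 2 * k + 1) (q + 1) * w (p + 2 * k + 1) (q + 1)| ≤ A * X := by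
      rw [abs_mul]; gcongr
      exact (abs_nonneg _).trans e4
    have : p + 2 * (k + 1) = p + 2 * k + 2 := by ring
    rw [this, pow_succ]
    push_cast
    rw [abs_le] at *
    constructor <;> linarith [h.1, h.2, e1.1, e1.2, e2.1, e2.2, e5.1, e5.2, ih.1, ih.2]

lemma corner_row_compare {w c : ℕ → ℕ → ℝ} {κ A X : ℝ} {a Q q : ℕ}
    (hrec : CornerRec w c κ a Q) (hq : q + 2 ≤ Q)
    (hA : ∀ p q, p ≤ a → q ≤ Q → |c p q| ≤ A)
    (h0 : ∀ p ≤ a, |w p q| ≤ X) (h1 : ∀ p ≤ a, |w p (q + 1)| ≤ X) (hκ : 0 ≤ κ)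
    (p p' : ℕ) (hp : p ≤ a) (hp' : p' ≤ a) (hpar : p % 2 = p' % 2) :
    |w p (q + 2)| ≤ |w p' (q + 2)| + a * ((A + 2) * X + κ) := by
  have hX : 0 ≤ X := (abs_nonneg _).trans (h0 0 (by omega))
  have hA0 : 0 ≤ A := (abs_nonneg _).trans (hA 0 0 (by omega) (by omega))
  have key : ∀ p k : ℕ, p + 2 * k ≤ a →
      |(|w (p + 2 * k) (q + 2)| - |w p (q + 2)|)| ≤ a * ((A + 2) * X + κ) := by
    intro p k hk
    have h := corner_alternate hrec hq hA h0 h1 p k hk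
    have e : |(-1 : ℝ) ^ k * w p (q + 2)| = |w p (q + 2)| := by simp [abs_mul]
    have h2 := abs_abs_sub_abs_le_abs_sub (w (p + 2 * k) (q + 2)) ((-1) ^ k * w p (q + 2))
    rw [e] at h2
    refine h2.trans (h.trans ?_)
    gcongr
    omega
  rcases le_total p p' with h | h
  · obtain ⟨k, hk⟩ : ∃ k, p' = p + 2 * k := ⟨(p' - p) / 2, by omega⟩
    have := key p k (by omega)
    rw [← hk] at this
    linarith [(abs_le.1 this).1]
  · obtain ⟨k, hk⟩ : ∃ k, p = p' + 2 * k := ⟨(p - p') / 2, by omega⟩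
    have := key p' k (by omega)
    rw [← hk] at this
    linarith [(abs_le.1 this).2]

/-- Growth of a solution of the corner recurrence whose initial rows and whose values in the
column `p ∈ {0, 1}` are controlled. -/
lemma corner_growth {w c : ℕ → ℕ → ℝ} {κ A Θ m : ℝ} {a Q : ℕ}
    (hpar : ParityZero w) (ha : 1 ≤ a)
    (hrec : CornerRec w c κ a Q) (hA : ∀ p q, p ≤ a → q ≤ Q → |c p q| ≤ A)
    (hA0 : 0 ≤ A) (hκ : 0 ≤ κ) (hm : 0 ≤ m)
    (hΘ : 16 * a * (A + 2) ≤ Θ) (haκ : a * κ ≤ m)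
    (h0 : ∀ p ≤ a, |w p 0| ≤ 2 * m) (h1 : ∀ p ≤ a, |w p 1| ≤ 2 * m)
    (hcol : ∀ q, 2 ≤ q → q ≤ Q → |w (q % 2) q| ≤ m * Θ ^ q) :
    ∀ q ≤ Q, ∀ p ≤ a, |w p q| ≤ 2 * m * Θ ^ q := by
  have ha' : (1 : ℝ) ≤ a := by exact_mod_cast ha
  have hΘ1 : 1 ≤ Θ := by nlinarith
  intro q
  induction q using Nat.strong_induction_on with
  | _ q ih =>
    match q with
    | 0 => intro _ p hp; simpa using h0 p hp
    | 1 =>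
      intro _ p hp
      have := h1 p hp
      have h2 : 2 * m * 1 ≤ 2 * m * Θ := by gcongr
      simpa using this.trans (by simpa using h2)
    | q + 2 =>
      intro hq p hp
      by_cases hpq : p % 2 = (q + 2) % 2
      · have e0 : ∀ p ≤ a, |w p q| ≤ 2 * m * Θ ^ (q + 1) := fun p hp =>
          (ih q (by omega) (by omega) p hp).trans (by gcongr; all_goals simp)
        have e1 := ih (q + 1) (by omega) (by omega)
        have h := corner_row_compare hrec hq hA e0 e1 hκ p ((q + 2) % 2) hp (by omega) (by omega)
        have h2 := hcol (q + 2) (by omega) hq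
        have hΘp : 0 ≤ m * Θ ^ (q + 1) := by positivity
        have h3 : 16 * a * (A + 2) * (m * Θ ^ (q + 1)) ≤ m * Θ ^ (q + 2) := by
          calc _ ≤ Θ * (m * Θ ^ (q + 1)) := by gcongr
            _ = _ := by ring
        have h4 : m ≤ m * Θ ^ (q + 1) := by
          have := one_le_pow₀ (n := q + 1) hΘ1; nlinarith
        have h5 : 16 * (m * Θ ^ (q + 1)) ≤ 16 * a * (A + 2) * (m * Θ ^ (q + 1)) := by
          have : (1 : ℝ) ≤ a * (A + 2) := by nlinarith
          nlinarith
        nlinarith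
      · rw [hpar _ _ hpq]; simp; positivity

lemma corner_row_lower {w c : ℕ → ℕ → ℝ} {A Θ m : ℝ} {a Q q : ℕ}
    (ha : 1 ≤ a)
    (hrec : CornerRec w c 0 a Q) (hA : ∀ p q, p ≤ a → q ≤ Q → |c p q| ≤ A)
    (hA0 : 0 ≤ A) (hm : 0 ≤ m)
    (hΘ : 16 * a * (A + 2) ≤ Θ) (hq : q + 2 ≤ Q)
    (hup : ∀ q ≤ Q, ∀ p ≤ a, |w p q| ≤ 4 * m * Θ ^ q)
    (p p' : ℕ) (hp : p ≤ a) (hp' : p' ≤ a) (hpp : p % 2 = p' % 2)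
    (hlow : 3 / 4 * m * Θ ^ (q + 2) ≤ |w p' (q + 2)|) :
    1 / 2 * m * Θ ^ (q + 2) ≤ |w p (q + 2)| := by
  have ha' : (1 : ℝ) ≤ a := by exact_mod_cast ha
  have hΘ1 : 1 ≤ Θ := by nlinarith
  have e0 : ∀ p ≤ a, |w p q| ≤ 4 * m * Θ ^ (q + 1) := fun p hp =>
    (hup q (by omega) p hp).trans (by gcongr; all_goals simp)
  have e1 := hup (q + 1) (by omega)
  have h := corner_row_compare hrec hq hA e0 e1 le_rfl p' p hp' hp (by omega)
  have hΘp : 0 ≤ m * Θ ^ (q + 1) := by positivity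
  have h3 : 16 * a * (A + 2) * (m * Θ ^ (q + 1)) ≤ m * Θ ^ (q + 2) := by
    calc _ ≤ Θ * (m * Θ ^ (q + 1)) := by gcongr
      _ = _ := by ring
  nlinarith

/-- The solution of the corner recurrence vanishing on the rows `0, 1` with prescribed values
`β` in the column `p ∈ {0, 1}`. -/
def cornerSol (c : ℕ → ℕ → ℝ) (β : ℕ → ℝ) : ℕ → ℕ → ℝ
  | _, 0 => 0
  | _, 1 => 0
  | 0, q + 2 => if q % 2 = 0 then β (q + 2) else 0
  | 1, q + 2 => if q % 2 = 1 then β (q + 2) else 0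
  | p + 2, q + 2 =>
      c (p + 1) (q + 1) * cornerSol c β (p + 1) (q + 1) - cornerSol c β p (q + 2)
        - cornerSol c β (p + 2) q - cornerSol c β p q
termination_by p q => (q, p)

lemma cornerSol_step (c : ℕ → ℕ → ℝ) (β : ℕ → ℝ) (p q : ℕ) :
    cornerSol c β (p + 2) (q + 2) =
      c (p + 1) (q + 1) * cornerSol c β (p + 1) (q + 1) - cornerSol c β p (q + 2)
        - cornerSol c β (p + 2) q - cornerSol c β p q := by
  rw [cornerSol]

lemma cornerSol_rec (c : ℕ → ℕ → ℝ) (β : ℕ → ℝ) (a Q : ℕ) :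
    CornerRec (cornerSol c β) c 0 a Q := by
  intro p q _ _
  rw [cornerSol_step, abs_le]
  constructor <;> linarith

lemma cornerSol_row0 (c : ℕ → ℕ → ℝ) (β : ℕ → ℝ) (p : ℕ) : cornerSol c β p 0 = 0 := by
  rw [cornerSol]

lemma cornerSol_row1 (c : ℕ → ℕ → ℝ) (β : ℕ → ℝ) (p : ℕ) : cornerSol c β p 1 = 0 := by
  rw [cornerSol]

lemma cornerSol_col (c : ℕ → ℕ → ℝ) (β : ℕ → ℝ) (q : ℕ) (hq : 2 ≤ q) :
    cornerSol c β (q % 2) q = β q := by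
  obtain ⟨q, rfl⟩ : ∃ k, q = k + 2 := ⟨q - 2, by omega⟩
  rcases Nat.mod_two_eq_zero_or_one q with h | h
  · rw [Nat.add_mod_right, h, cornerSol, if_pos h]
  · rw [Nat.add_mod_right, h, cornerSol, if_pos h]

lemma cornerSol_parity (c : ℕ → ℕ → ℝ) (β : ℕ → ℝ) : ParityZero (cornerSol c β) := by
  intro p q
  induction p, q using cornerSol.induct with
  | case1 => intro _; rw [cornerSol]
  | case2 => intro _; rw [cornerSol]
  | case3 q hq => intro h; omega
  | case4 q hq => intro h; rw [cornerSol, if_neg (by omega)]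
  | case5 q hq => intro h; omega
  | case6 q hq => intro h; rw [cornerSol, if_neg (by omega)]
  | case7 p q ih1 ih2 ih3 ih4 =>
    intro h
    rw [cornerSol, ih1 (by omega), ih2 (by omega), ih3 (by omega), ih4 (by omega)]
    simp

/-- The value at `(p, q)` only depends on coefficients in strictly smaller columns and rows. -/
lemma cornerSol_congr {c c' : ℕ → ℕ → ℝ} (β : ℕ → ℝ) (p q : ℕ)
    (h : ∀ p' < p, ∀ q' < q, c p' q' = c' p' q') : cornerSol c β p q = cornerSol c' β p q := by
  induction p, q using cornerSol.induct with
  | case1 => simp only [cornerSol]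
  | case2 => simp only [cornerSol]
  | case3 q hq => simp only [cornerSol]
  | case4 q hq => simp only [cornerSol]
  | case5 q hq => simp only [cornerSol]
  | case6 q hq => simp only [cornerSol]
  | case7 p q ih1 ih2 ih3 ih4 =>
    rw [cornerSol_step, cornerSol_step,
      ih1 (fun p' hp q' hq => h p' (by omega) q' (by omega)),
      ih2 (fun p' hp q' hq => h p' (by omega) q' (by omega)),
      ih3 (fun p' hp q' hq => h p' (by omega) q' (by omega)),
      ih4 (fun p' hp q' hq => h p' (by omega) q' (by omega)),
      h (p + 1) (by omega) (q + 1) (by omega)]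

/-- Changing a single coefficient at `(p₁, q₀)` changes the value at `(p₁ + 1, q₀ + 1 + 2 j)` by
`±` the change of coefficient times the value at `(p₁, q₀)`. -/
lemma cornerSol_perturb {c c' : ℕ → ℕ → ℝ} (β : ℕ → ℝ) (p₁ q₀ : ℕ) (hq₀ : 1 ≤ q₀)
    (h : ∀ p q, (p, q) ≠ (p₁, q₀) → c p q = c' p q) (j : ℕ) (hp₁ : 1 ≤ p₁) :
    cornerSol c' β (p₁ + 1) (q₀ + 1 + 2 * j) - cornerSol c β (p₁ + 1) (q₀ + 1 + 2 * j)
      = (-1) ^ j * ((c' p₁ q₀ - c p₁ q₀) * cornerSol c β p₁ q₀) := by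
  obtain ⟨p, rfl⟩ : ∃ k, p₁ = k + 1 := ⟨p₁ - 1, by omega⟩
  obtain ⟨q, rfl⟩ : ∃ k, q₀ = k + 1 := ⟨q₀ - 1, by omega⟩
  have hlow : ∀ p' q', p' ≤ p + 1 → cornerSol c' β p' q' = cornerSol c β p' q' := by
    intro p' q' hp'
    refine cornerSol_congr β p' q' fun p'' hp'' q'' _ => (h _ _ ?_).symm
    simp; omega
  have hrow : ∀ p' q', q' ≤ q + 1 → cornerSol c' β p' q' = cornerSol c β p' q' := by
    intro p' q' hq'
    refine cornerSol_congr β p' q' fun p'' _ q'' hq'' => (h _ _ ?_).symm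
    simp; omega
  induction j with
  | zero =>
    show cornerSol c' β (p + 2) (q + 2) - cornerSol c β (p + 2) (q + 2) = _
    rw [cornerSol_step, cornerSol_step, hlow (p + 1) (q + 1) le_rfl, hlow p (q + 2) (by omega), hlow p q (by omega),
      hrow (p + 2) q (by omega)]
    ring
  | succ j ih =>
    have r1 : q + 1 + 1 + 2 * (j + 1) = (q + 2 * j + 2) + 2 := by ring
    have r2 : q + 1 + 1 + 2 * j = q + 2 * j + 2 := by ring
    rw [r2] at ih
    rw [r1]
    show cornerSol c' β (p + 2) _ - cornerSol c β (p + 2) _ = _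
    rw [cornerSol_step c' β p (q + 2 * j + 2), cornerSol_step c β p (q + 2 * j + 2),
      hlow (p + 1) (q + 2 * j + 2 + 1) le_rfl, hlow p (q + 2 * j + 2 + 2) (by omega),
      hlow p (q + 2 * j + 2) (by omega), h (p + 1) (q + 2 * j + 2 + 1) (by simp; omega)]
    rw [pow_succ]
    linear_combination -ih

/-- Mesh of the net of column parameters. -/
def hopMesh (b : ℕ) (Θ γ : ℝ) : ℝ := γ / (64 * Θ ^ (b + 1))

/-- Number of mesh points on either side of the origin. -/
def hopCount (b : ℕ) (Θ γ : ℝ) : ℕ := ⌈Θ ^ (b + 1) / hopMesh b Θ γ⌉₊ + 1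

/-- Column parameters coming from an integer vector. -/
def hopParam (b : ℕ) (Θ γ : ℝ) (k : Fin (b + 2) → ℤ) (q : ℕ) : ℝ :=
  if h : q < b + 2 then k ⟨q, h⟩ * hopMesh b Θ γ else 0

/-- The net of integer vectors. -/
def hopNet (b : ℕ) (Θ γ : ℝ) : Finset (Fin (b + 2) → ℤ) :=
  Fintype.piFinset fun _ => Finset.Icc (-(hopCount b Θ γ : ℤ)) (hopCount b Θ γ)

/-- The row among `b, b + 1` at odd distance from `q₀`. -/
def hopTarget (b q₀ : ℕ) : ℕ := if (b + q₀) % 2 = 1 then b else b + 1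

/-- The sites of row `q₀` whose potential is free. -/
def hopSites (F : Set (ℕ × ℕ)) (a q₀ : ℕ) : Finset ℕ :=
  (Finset.Ico 1 a).filter fun p => p % 2 = q₀ % 2 ∧ (p, q₀) ∉ F

/-- For every admissible element of the net, the associated solution is non-negligible at more
than `e` sites of the target row. -/
def HopGood (c : ℕ → ℕ → ℝ) (F : Set (ℕ × ℕ)) (a b e : ℕ) (Θ γ : ℝ) : Prop :=
  ∀ q₀ ∈ Finset.Ico 2 b, ∀ k ∈ hopNet b Θ γ,
    (∀ q ∈ Finset.Icc 2 (b + 1), |hopParam b Θ γ k q| ≤ 2 * Θ ^ q) →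
    3 / 4 * Θ ^ q₀ ≤ |hopParam b Θ γ k q₀| →
    a ≤ 4 * (hopSites F a q₀).card →
    e < ((hopSites F a q₀).filter fun p =>
      γ / 16 < |cornerSol c (hopParam b Θ γ k) (p + 1) (hopTarget b q₀)|).card

lemma hop_exists_net {b : ℕ} {Θ γ : ℝ} (hΘ : 1 ≤ Θ) (hγ : 0 < γ)
    (β : ℕ → ℝ) (hβ : ∀ q ∈ Finset.Icc 2 (b + 1), |β q| ≤ Θ ^ q) :
    ∃ k ∈ hopNet b Θ γ, ∀ q ∈ Finset.Icc 2 (b + 1), |β q - hopParam b Θ γ k q| ≤ hopMesh b Θ γ := by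
  have hν : 0 < hopMesh b Θ γ := by unfold hopMesh; positivity
  refine ⟨fun i => if 2 ≤ (i : ℕ) then ⌊β i / hopMesh b Θ γ⌋ else 0, ?_, ?_⟩
  · rw [hopNet, Fintype.mem_piFinset]
    intro i
    split_ifs with h
    · have h1 := hβ i (by simp; omega)
      have h2 : |β i / hopMesh b Θ γ| ≤ Θ ^ (b + 1) / hopMesh b Θ γ := by
        rw [abs_div, abs_of_pos hν]
        gcongr
        exact h1.trans (pow_le_pow_right₀ hΘ (by omega))
      have h3 := Nat.le_ceil (Θ ^ (b + 1) / hopMesh b Θ γ)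
      have h4 := Int.floor_le (β i / hopMesh b Θ γ)
      have h5 := Int.lt_floor_add_one (β i / hopMesh b Θ γ)
      have h6 := abs_le.1 h2
      rw [Finset.mem_Icc, hopCount]
      constructor
      · have : -((⌈Θ ^ (b + 1) / hopMesh b Θ γ⌉₊ + 1 : ℕ) : ℝ) ≤ (⌊β i / hopMesh b Θ γ⌋ : ℝ) := by
          push_cast; linarith
        exact_mod_cast this
      · have : (⌊β i / hopMesh b Θ γ⌋ : ℝ) ≤ ((⌈Θ ^ (b + 1) / hopMesh b Θ γ⌉₊ + 1 : ℕ) : ℝ) := by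
          push_cast; linarith
        exact_mod_cast this
    · simp
  · intro q hq
    rw [Finset.mem_Icc] at hq
    simp only [hopParam, dif_pos (show q < b + 2 by omega), if_pos hq.1]
    have h4 := Int.floor_le (β q / hopMesh b Θ γ)
    have h5 := Int.lt_floor_add_one (β q / hopMesh b Θ γ)
    rw [le_div_iff₀ hν] at h4
    rw [div_lt_iff₀ hν] at h5
    rw [abs_le]
    constructor <;> nlinarith

lemma card_odd_even (a q : ℕ) : a ≤ 2 * ((Finset.range (a + 1)).filter fun p => p % 2 = q % 2).card
    + 1 := by
  have h : (Finset.range (a / 2 + a % 2)).card ≤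
      ((Finset.range (a + 1)).filter fun p => p % 2 = q % 2).card := by
    refine Finset.card_le_card_of_injOn (fun k => 2 * k + q % 2) ?_ ?_
    · intro k hk
      simp at hk ⊢
      omega
    · intro x _ y _ h
      simp at h
      exact h
  rw [Finset.card_range] at h
  omega

/-- If a solution is bounded by `X` on two initial rows and on all but few sites of two later
consecutive rows, it is bounded in between, provided `HopGood` holds. -/
theorem hop_bound {w c c' : ℕ → ℕ → ℝ} {F : Set (ℕ × ℕ)} {a b e : ℕ} {A Θ γ κ X : ℝ}
    (ha : 1 ≤ a) (hb : 1 ≤ b) (hA0 : 0 ≤ A) (hγ : 0 < γ) (hγ1 : γ ≤ 1) (hX : 0 < X)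
    (hΘ : 16 * a * (A + 2) ≤ Θ)
    (hpar : ParityZero w) (hrec : CornerRec w c' 0 a (b + 1))
    (hc : ∀ p q, p ≤ a → q ≤ b + 1 → |c p q| ≤ A)
    (hc' : ∀ p q, p ≤ a → q ≤ b + 1 → |c' p q| ≤ A)
    (hcc : ∀ p q, p ≤ a → q ≤ b + 1 → |c' p q - c p q| ≤ κ)
    (hκ : a * (κ * (2 * Θ ^ (b + 1))) ≤ hopMesh b Θ γ)
    (hgood : HopGood c F a b e Θ γ)
    (hF : ∀ q ∈ Finset.Ico 2 b, a ≤ 4 * (hopSites F a q).card)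
    (he : 2 * e + 1 < a)
    (h0 : ∀ p ≤ a, |w p 0| ≤ X) (h1 : ∀ p ≤ a, |w p 1| ≤ X)
    (hb0 : ((Finset.range (a + 1)).filter fun p => X < |w p b|).card ≤ e)
    (hb1 : ((Finset.range (a + 1)).filter fun p => X < |w p (b + 1)|).card ≤ e) :
    ∀ q ≤ b + 1, ∀ p ≤ a, |w p q| ≤ 128 / γ * Θ ^ (2 * (b + 1)) * X := by
  have ha' : (1 : ℝ) ≤ a := by exact_mod_cast ha
  have hΘ16 : 32 ≤ Θ := by nlinarith
  have hΘ1 : 1 ≤ Θ := by linarith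
  set ν := hopMesh b Θ γ with hνdef
  have hν : 0 < ν := by rw [hνdef]; unfold hopMesh; positivity
  have hνΘ : ν * Θ ^ (b + 1) = γ / 64 := by
    rw [hνdef]; unfold hopMesh; field_simp
  have hpowb : 32 ≤ Θ ^ (b + 1) := by
    calc (32:ℝ) ≤ Θ := hΘ16
      _ = Θ ^ 1 := by simp
      _ ≤ Θ ^ (b + 1) := pow_le_pow_right₀ hΘ1 (by omega)
  have hν1 : ν ≤ γ / 2048 := by nlinarith
  have hκ0 : 0 ≤ κ := (abs_nonneg _).trans (hcc 0 0 (by omega) (by omega))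
  obtain ⟨q₀, hq₀, hmax⟩ := Finset.exists_max_image (Finset.Icc 2 (b + 1))
    (fun q => |w (q % 2) q| / Θ ^ q) ⟨2, by simp; omega⟩
  rw [Finset.mem_Icc] at hq₀
  set m := |w (q₀ % 2) q₀| / Θ ^ q₀ with hm
  have hm0 : 0 ≤ m := by positivity
  have hcol : ∀ q, 2 ≤ q → q ≤ b + 1 → |w (q % 2) q| ≤ m * Θ ^ q := by
    intro q h2 hq
    have := hmax q (by simp; omega)
    rwa [div_le_iff₀ (by positivity)] at this
  by_cases hcase : m ≤ X / ν
  · have hXν : X ≤ X / ν := by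
      rw [le_div_iff₀ hν]; nlinarith
    have := corner_growth (m := X / ν) hpar ha hrec hc' hA0 le_rfl (by positivity) hΘ
      (by simp; positivity) (fun p hp => (h0 p hp).trans (by linarith))
      (fun p hp => (h1 p hp).trans (by linarith))
      (fun q h2 hq => (hcol q h2 hq).trans (by gcongr))
    intro q hq p hp
    refine (this q hq p hp).trans ?_
    calc 2 * (X / ν) * Θ ^ q ≤ 2 * (X / ν) * Θ ^ (b + 1) := by gcongr
      _ = 128 / γ * Θ ^ (2 * (b + 1)) * X := by
        rw [hνdef]; unfold hopMesh; field_simp; ring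
  exfalso
  push Not at hcase
  have hmpos : 0 < m := lt_trans (by positivity) hcase
  have hXm : X < ν * m := by rwa [div_lt_iff₀ hν, mul_comm] at hcase
  -- normalise
  set w' : ℕ → ℕ → ℝ := fun p q => w p q / m with hw'
  have hpar' : ParityZero w' := fun p q h => by simp [hw', hpar p q h]
  have hrec' : CornerRec w' c' 0 a (b + 1) := by
    intro p q hp hq
    have h := hrec p q hp hq
    have : w' (p + 2) (q + 2) + w' p (q + 2) + w' (p + 2) q + w' p q
        - c' (p + 1) (q + 1) * w' (p + 1) (q + 1) = (w (p + 2) (q + 2) + w p (q + 2) + w (p + 2) q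
          + w p q - c' (p + 1) (q + 1) * w (p + 1) (q + 1)) / m := by
      simp only [hw']; field_simp
    rw [this, abs_div, abs_of_pos hmpos]
    rw [abs_nonpos_iff.1 h]; simp
  have hsm : ∀ x, |x| ≤ X → |x / m| ≤ ν := by
    intro x hx
    rw [abs_div, abs_of_pos hmpos, div_le_iff₀ hmpos]; linarith
  have h0' : ∀ p ≤ a, |w' p 0| ≤ ν := fun p hp => hsm _ (h0 p hp)
  have h1' : ∀ p ≤ a, |w' p 1| ≤ ν := fun p hp => hsm _ (h1 p hp)
  have hcol' : ∀ q, 2 ≤ q → q ≤ b + 1 → |w' (q % 2) q| ≤ 1 * Θ ^ q := by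
    intro q h2 hq
    have := hcol q h2 hq
    simp only [hw']
    rw [abs_div, abs_of_pos hmpos, div_le_iff₀ hmpos]; linarith
  have hq0' : |w' (q₀ % 2) q₀| = Θ ^ q₀ := by
    have e1 : |w (q₀ % 2) q₀| = m * Θ ^ q₀ := by rw [hm]; field_simp
    simp only [hw']
    rw [abs_div, abs_of_pos hmpos, e1]; field_simp
  have hup' := corner_growth (m := 1) hpar' ha hrec' hc' hA0 le_rfl zero_le_one hΘ
      (by simp) (fun p hp => (h0' p hp).trans (by linarith))
      (fun p hp => (h1' p hp).trans (by linarith)) hcol'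
  obtain ⟨k, hk, hkβ⟩ := hop_exists_net (b := b) (γ := γ) hΘ1 hγ (fun q => w' (q % 2) q)
    (fun q hq => by
      rw [Finset.mem_Icc] at hq
      simpa using hcol' q hq.1 hq.2)
  rw [← hνdef] at hkβ
  set β := hopParam b Θ γ k with hβ
  have hΘq : ∀ q, 1 ≤ Θ ^ q := fun q => one_le_pow₀ hΘ1
  have hβup : ∀ q ∈ Finset.Icc 2 (b + 1), |β q| ≤ 2 * Θ ^ q := by
    intro q hq
    have h := hkβ q hq
    rw [Finset.mem_Icc] at hq
    have h2 := hcol' q hq.1 hq.2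
    have h3 := abs_sub_abs_le_abs_sub (β q) (w' (q % 2) q)
    rw [abs_sub_comm] at h3
    have := hΘq q
    linarith
  have hΘq0 := hΘq q₀
  have hβlow : 3 / 4 * Θ ^ q₀ ≤ |β q₀| := by
    have h := hkβ q₀ (by simp; omega)
    have h3 := abs_sub_abs_le_abs_sub (w' (q₀ % 2) q₀) (β q₀)
    rw [hq0'] at h3
    linarith
  -- difference with the net solution
  set d : ℕ → ℕ → ℝ := fun p q => w' p q - cornerSol c β p q with hd
  have hdpar : ParityZero d := fun p q h => by
    simp [hd, hpar' p q h, cornerSol_parity c β p q h]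
  have hdrec : CornerRec d c (κ * (2 * Θ ^ (b + 1))) a (b + 1) := by
    intro p q hp hq
    have e1 := abs_nonpos_iff.1 (hrec' p q hp hq)
    have e2 := abs_nonpos_iff.1 (cornerSol_rec c β a (b + 1) p q hp hq)
    have e3 : d (p + 2) (q + 2) + d p (q + 2) + d (p + 2) q + d p q
        - c (p + 1) (q + 1) * d (p + 1) (q + 1)
        = (c' (p + 1) (q + 1) - c (p + 1) (q + 1)) * w' (p + 1) (q + 1) := by
      simp only [hd]; linear_combination e1 - e2
    rw [e3, abs_mul]
    gcongr
    · exact hcc _ _ (by omega) (by omega)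
    · refine (hup' (q + 1) (by omega) (p + 1) (by omega)).trans ?_
      rw [mul_one]
      exact mul_le_mul_of_nonneg_left (pow_le_pow_right₀ hΘ1 (by omega)) (by norm_num)
  have hdup := corner_growth (m := ν) hdpar ha hdrec hc hA0 (by positivity) hν.le hΘ hκ
    (fun p hp => by
      simp only [hd, cornerSol_row0, sub_zero]; exact (h0' p hp).trans (by linarith))
    (fun p hp => by
      simp only [hd, cornerSol_row1, sub_zero]; exact (h1' p hp).trans (by linarith))
    (fun q h2 hq => by
      simp only [hd]
      rw [cornerSol_col c β q h2]
      have := hΘq q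
      exact (hkβ q (by simp; omega)).trans (by nlinarith))
  have hdsmall : ∀ q ≤ b + 1, ∀ p ≤ a, |d p q| ≤ γ / 32 := by
    intro q hq p hp
    refine (hdup q hq p hp).trans ?_
    calc 2 * ν * Θ ^ q ≤ 2 * ν * Θ ^ (b + 1) := by gcongr
      _ = γ / 32 := by rw [mul_assoc, hνΘ]; ring
  -- a site where the net solution is large is exceptional
  have hexc : ∀ q ≤ b + 1, ∀ p ≤ a, γ / 16 < |cornerSol c β p q| → X < |w p q| := by
    intro q hq p hp h
    have h2 := hdsmall q hq p hp
    have h3 := abs_sub_abs_le_abs_sub (cornerSol c β p q) (w' p q)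
    rw [abs_sub_comm] at h3
    have h4 : ν < |w' p q| := by
      simp only [hd] at h2; linarith
    simp only [hw'] at h4
    rw [abs_div, abs_of_pos hmpos, lt_div_iff₀ hmpos] at h4
    linarith
  have hbrow : ∀ r, r = b ∨ r = b + 1 →
      ((Finset.range (a + 1)).filter fun p => X < |w p r|).card ≤ e := by
    rintro r (rfl | rfl)
    · exact hb0
    · exact hb1
  by_cases hqb : q₀ < b
  · have hlt := hgood q₀ (by simp; omega) k hk hβup hβlow (hF q₀ (by simp; omega))
    have htar : hopTarget b q₀ = b ∨ hopTarget b q₀ = b + 1 := by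
      unfold hopTarget; split_ifs <;> simp
    have hle : ((hopSites F a q₀).filter fun p =>
        γ / 16 < |cornerSol c (hopParam b Θ γ k) (p + 1) (hopTarget b q₀)|).card ≤
        ((Finset.range (a + 1)).filter fun p => X < |w p (hopTarget b q₀)|).card := by
      refine Finset.card_le_card_of_injOn (fun p => p + 1) ?_ ?_
      · intro p hp
        simp only [hopSites, Finset.coe_filter, Finset.mem_filter, Finset.mem_Ico,
          Set.mem_ofPred_eq, Finset.mem_range] at hp ⊢
        refine ⟨by omega, hexc _ ?_ _ (by omega) hp.2⟩
        rcases htar with h | h <;> omega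
      · intro x _ y _ h
        simpa using h
    have := hbrow _ htar
    omega
  · have hr := hbrow q₀ (by omega)
    have hsolup := corner_growth (m := 2) (cornerSol_parity c β) ha (cornerSol_rec c β a (b + 1))
      hc hA0 le_rfl (by norm_num) hΘ (by simp) (by simp [cornerSol_row0])
      (by simp [cornerSol_row1])
      (fun q h2 hq => by rw [cornerSol_col c β q h2]; exact hβup q (by simp; omega))
    obtain ⟨q, rfl⟩ : ∃ q, q₀ = q + 2 := ⟨q₀ - 2, by omega⟩
    have hle : ((Finset.range (a + 1)).filter fun p => p % 2 = (q + 2) % 2).card ≤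
        ((Finset.range (a + 1)).filter fun p => X < |w p (q + 2)|).card := by
      apply Finset.card_le_card
      intro p hp
      simp only [Finset.mem_filter, Finset.mem_range] at hp ⊢
      refine ⟨hp.1, hexc _ (by omega) _ (by omega) ?_⟩
      have hl := corner_row_lower (m := 1) (Q := b + 1) (q := q) ha (cornerSol_rec c β a (b + 1)) hc hA0
        zero_le_one hΘ (by omega) (fun q hq p hp => (hsolup q hq p hp).trans (by linarith)) p
        ((q + 2) % 2) (by omega) (by omega) (by omega)
        (by rw [cornerSol_col c β (q + 2) (by omega), mul_one]; exact hβlow)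
      have := hΘq (q + 2)
      linarith
    have := card_odd_even a (q + 2)
    omega

/-- Resampling one coordinate does not change an integral. -/
lemma lintegral_pi_update {ι : Type*} [Fintype ι] (ν : ι → Measure ℝ)
    [∀ i, IsProbabilityMeasure (ν i)] (i : ι) {f : (ι → ℝ) → ENNReal} (hf : Measurable f) :
    ∫⁻ x, ∫⁻ t, f (Function.update x i t) ∂ν i ∂Measure.pi ν = ∫⁻ x, f x ∂Measure.pi ν := by
  have h1 : ∀ x, ∫⁻ t, f (Function.update x i t) ∂ν i = (∫⋯∫⁻_{i}, f ∂ν) x := by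
    intro x; rw [lmarginal_singleton]
  simp_rw [h1]
  have hne : Nonempty (ι → ℝ) := ⟨fun _ => 0⟩
  obtain ⟨x₀⟩ := hne
  rw [lintegral_eq_lmarginal_univ x₀, lintegral_eq_lmarginal_univ x₀]
  have hu : (Finset.univ : Finset ι) = {i} ∪ (Finset.univ \ {i}) := by
    ext j; simp
  have hd : Disjoint ({i} : Finset ι) (Finset.univ \ {i}) := Finset.disjoint_sdiff
  rw [hu, lmarginal_union _ _ (hf.lmarginal ν) hd, Finset.union_comm,
    lmarginal_union _ _ hf hd.symm]
  have h2 : ∀ g : (ι → ℝ) → ENNReal, (∫⋯∫⁻_{i}, (∫⋯∫⁻_{i}, g ∂ν) ∂ν) = ∫⋯∫⁻_{i}, g ∂ν := by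
    intro g
    ext x
    simp [lmarginal_singleton]
  have h3 : (∫⋯∫⁻_{i}, (∫⋯∫⁻_(Finset.univ \ {i}), (∫⋯∫⁻_{i}, f ∂ν) ∂ν) ∂ν)
     = ∫⋯∫⁻_{i}, (∫⋯∫⁻_({i}), (∫⋯∫⁻_(Finset.univ \ {i}), f ∂ν) ∂ν) ∂ν := by
    rw [← lmarginal_union _ _ hf hd, Finset.union_comm, lmarginal_union _ _ hf hd.symm]
  rw [h3, h2, ← lmarginal_union _ _ hf hd, Finset.union_comm, lmarginal_union _ _ hf hd.symm]

lemma lintegral_prod_le_of_update {ι : Type*} [Fintype ι] (ν : ι → Measure ℝ)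
    [∀ i, IsProbabilityMeasure (ν i)] (i : ℕ → ι) (S : ℕ → Set (ι → ℝ)) (r : ENNReal)
    (hS : ∀ k, MeasurableSet (S k)) (T : Finset ℕ)
    (hind : ∀ j ∈ T, ∀ k ∈ T, j < k → ∀ x t, (Function.update x (i k) t ∈ S j ↔ x ∈ S j))
    (hr : ∀ k ∈ T, ∀ x, ν (i k) {t | Function.update x (i k) t ∈ S k} ≤ r) :
    ∫⁻ x, ∏ k ∈ T, (1 + (S k).indicator 1 x) ∂Measure.pi ν ≤ (1 + r) ^ T.card := by
  induction T using Finset.induction_on_max with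
  | empty => simp
  | insert m T hm ih =>
    have hmT : m ∉ T := fun h => lt_irrefl _ (hm m h)
    have ih' := ih (fun j hj k hk => hind j (Finset.mem_insert_of_mem hj) k
      (Finset.mem_insert_of_mem hk)) (fun k hk => hr k (Finset.mem_insert_of_mem hk))
    have hmeas : ∀ T : Finset ℕ, Measurable fun x : ι → ℝ =>
        ∏ k ∈ T, (1 + (S k).indicator (1 : (ι → ℝ) → ENNReal) x) := fun T =>
      Finset.measurable_prod _ fun k _ =>
        Measurable.add (measurable_const (a := (1 : ENNReal))) (measurable_one.indicator (hS k))
    rw [← lintegral_pi_update ν (i m) (hmeas _), Finset.card_insert_of_notMem hmT, pow_succ]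
    calc _ ≤ ∫⁻ x, (∏ k ∈ T, (1 + (S k).indicator (1 : (ι → ℝ) → ENNReal) x)) * (1 + r)
          ∂Measure.pi ν := by
          apply lintegral_mono
          intro x
          simp only
          have e1 : ∀ t, ∏ k ∈ insert m T,
              (1 + (S k).indicator (1 : (ι → ℝ) → ENNReal) (Function.update x (i m) t))
              = (∏ k ∈ T, (1 + (S k).indicator (1 : (ι → ℝ) → ENNReal) x)) *
                (1 + (S m).indicator (1 : (ι → ℝ) → ENNReal) (Function.update x (i m) t)) := by
            intro t
            rw [Finset.prod_insert hmT, mul_comm]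
            congr 1
            refine Finset.prod_congr rfl fun k hk => ?_
            have := hind k (Finset.mem_insert_of_mem hk) m (Finset.mem_insert_self _ _) (hm k hk) x t
            simp only [Set.indicator_apply, this, Pi.one_apply]
          simp_rw [e1]
          have hm2 : Measurable fun t => (S m).indicator (1 : (ι → ℝ) → ENNReal)
              (Function.update x (i m) t) :=
            (measurable_one.indicator (hS m)).comp (measurable_update x)
          rw [lintegral_const_mul _ (by fun_prop),
            lintegral_add_left (measurable_const (a := (1 : ENNReal)))]
          gcongr
          · simp
          · have h := hr m (Finset.mem_insert_self _ _) x
            refine le_trans (le_of_eq ?_) h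
            exact lintegral_indicator_one (measurable_update x (a := i m) (hS m))
      _ = (∫⁻ x, ∏ k ∈ T, (1 + (S k).indicator (1 : (ι → ℝ) → ENNReal) x) ∂Measure.pi ν)
          * (1 + r) := lintegral_mul_const _ (hmeas _)
      _ ≤ _ := by gcongr

/-- Chernoff-type bound for sequentially revealed events. -/
lemma measure_few_le {ι : Type*} [Fintype ι] (ν : ι → Measure ℝ)
    [∀ i, IsProbabilityMeasure (ν i)] (i : ℕ → ι) (S : ℕ → Set (ι → ℝ)) (ρ : ℝ)
    (hρ0 : 0 ≤ ρ) (hρ1 : ρ ≤ 1)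
    (hS : ∀ k, MeasurableSet (S k)) (T : Finset ℕ)
    (hind : ∀ j ∈ T, ∀ k ∈ T, j < k → ∀ x t, (Function.update x (i k) t ∈ S j ↔ x ∈ S j))
    (hr : ∀ k ∈ T, ∀ x, ν (i k) {t | Function.update x (i k) t ∈ S k} ≤ ENNReal.ofReal (1 - ρ))
    (a e : ℕ) (ha : a ≤ 4 * T.card) (he : (e : ℝ) ≤ ρ * a / 16) :
    Measure.pi ν {x | (T.filter fun k => x ∉ S k).card ≤ e} ≤
      ENNReal.ofReal (Real.exp (-(ρ * a / 16))) := by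
  set n := T.card with hn
  have h1 := lintegral_prod_le_of_update ν i S _ hS T hind hr
  have hmeas : Measurable fun x : ι → ℝ =>
        ∏ k ∈ T, (1 + (S k).indicator (1 : (ι → ℝ) → ENNReal) x) :=
      Finset.measurable_prod _ fun k _ =>
        Measurable.add (measurable_const (a := (1 : ENNReal))) (measurable_one.indicator (hS k))
  have h2 := mul_meas_ge_le_lintegral (μ := Measure.pi ν) hmeas
    (ENNReal.ofReal (2 ^ ((n : ℝ) - e)))
  have hsub : {x | (T.filter fun k => x ∉ S k).card ≤ e} ⊆
      {x | ENNReal.ofReal (2 ^ ((n : ℝ) - e)) ≤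
        ∏ k ∈ T, (1 + (S k).indicator (1 : (ι → ℝ) → ENNReal) x)} := by
    intro x hx
    have hx : (T.filter fun k => x ∉ S k).card ≤ e := hx
    rw [Set.mem_ofPred_eq]
    have e1 : ∏ k ∈ T, (1 + (S k).indicator (1 : (ι → ℝ) → ENNReal) x)
        = 2 ^ (T.filter fun k => x ∈ S k).card := by
      rw [← Finset.prod_const, Finset.prod_filter]
      refine Finset.prod_congr rfl fun k _ => ?_
      by_cases h : x ∈ S k
      · simp [h]; norm_num
      · simp [h]
    have e2 := Finset.card_filter_add_card_filter_not (s := T) (fun k => x ∈ S k)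
    have e3 : (n : ℝ) - e ≤ ((T.filter fun k => x ∈ S k).card : ℝ) := by
      have : n ≤ (T.filter fun k => x ∈ S k).card + e := by omega
      have : (n : ℝ) ≤ (T.filter fun k => x ∈ S k).card + e := by exact_mod_cast this
      linarith
    rw [e1]
    calc _ ≤ ENNReal.ofReal (2 ^ ((T.filter fun k => x ∈ S k).card : ℝ)) := by
            apply ENNReal.ofReal_le_ofReal
            exact Real.rpow_le_rpow_of_exponent_le (by norm_num) e3
      _ = _ := by
            rw [Real.rpow_natCast, ENNReal.ofReal_pow (by norm_num)]; norm_num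
  have h3 : ENNReal.ofReal (2 ^ ((n : ℝ) - e)) *
      Measure.pi ν {x | (T.filter fun k => x ∉ S k).card ≤ e} ≤
      ENNReal.ofReal ((2 - ρ) ^ n) := by
    refine (mul_le_mul_right (measure_mono hsub) _).trans (h2.trans (h1.trans (le_of_eq ?_)))
    rw [ENNReal.ofReal_pow (by linarith), ← ENNReal.ofReal_one, ← ENNReal.ofReal_add (by norm_num)
      (by linarith)]
    congr 2; ring
  have hpos : (0 : ℝ) < 2 ^ ((n : ℝ) - e) := by positivity
  have h4 : Measure.pi ν {x | (T.filter fun k => x ∉ S k).card ≤ e} ≤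
      ENNReal.ofReal ((2 - ρ) ^ n / 2 ^ ((n : ℝ) - e)) := by
    rw [ENNReal.ofReal_div_of_pos hpos, ENNReal.le_div_iff_mul_le (by simp [hpos]) (by simp),
      mul_comm]
    exact h3
  refine h4.trans (ENNReal.ofReal_le_ofReal ?_)
  rw [div_le_iff₀ hpos]
  have ha' : (a : ℝ) ≤ 4 * n := by exact_mod_cast ha
  have e5 : (2 - ρ) ≤ 2 * Real.exp (-ρ / 2) := by
    have := Real.add_one_le_exp (-ρ / 2)
    linarith
  have e6 : (2 : ℝ) ^ (e : ℝ) ≤ Real.exp e := by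
    rw [← Real.exp_one_rpow]
    exact Real.rpow_le_rpow (by norm_num) (by have := Real.add_one_le_exp (1:ℝ); linarith)
      (by positivity)
  calc (2 - ρ) ^ n ≤ (2 * Real.exp (-ρ / 2)) ^ n := pow_le_pow_left₀ (by linarith) e5 n
    _ = 2 ^ (n : ℝ) * Real.exp (-ρ / 2 * n) := by
        rw [mul_pow, ← Real.exp_nat_mul, Real.rpow_natCast]; ring_nf
    _ = 2 ^ (e : ℝ) * Real.exp (-ρ / 2 * n) * 2 ^ ((n : ℝ) - e) := by
        have : (n : ℝ) = e + ((n : ℝ) - e) := by ring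
        conv_lhs => rw [this, Real.rpow_add (by norm_num), ← this]
        ring
    _ ≤ Real.exp e * Real.exp (-ρ / 2 * n) * 2 ^ ((n : ℝ) - e) := by gcongr
    _ ≤ _ := by
        rw [← Real.exp_add]
        gcongr
        nlinarith

/-- Clamping a real number to `[0, M]`. -/
def clamp (M x : ℝ) : ℝ := max 0 (min M x)

lemma clamp_mem {M : ℝ} (hM : 0 ≤ M) (x : ℝ) : clamp M x ∈ Set.Icc 0 M :=
  ⟨le_max_left _ _, max_le hM (min_le_left _ _)⟩

lemma clamp_eq {M x : ℝ} (hx : x ∈ Set.Icc 0 M) : clamp M x = x := by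
  rw [clamp, min_eq_right hx.2, max_eq_right hx.1]

lemma measurable_clamp (M : ℝ) : Measurable (clamp M) :=
  measurable_const.max (measurable_const.min measurable_id)

lemma measure_affine_small_le {M γ₀ γ ρ : ℝ} (μ : Measure ℝ) [IsProbabilityMeasure μ]
    (hγ : γ ≤ γ₀) (hγ0 : 0 < γ) (hρ0 : 0 ≤ ρ)
    (hsupp : μ (Set.Icc 0 M) = 1)
    (hac : ∀ t ∈ Set.Icc (0:ℝ) M, ENNReal.ofReal ρ ≤ μ {s | γ₀ / 2 < |s - t|})
    (g S : ℝ) (hS : 1 / 2 ≤ |S|) :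
    μ {x | |g + clamp M x * S| ≤ γ / 16} ≤ ENNReal.ofReal (1 - ρ) := by
  have hzero : μ (Set.Icc 0 M)ᶜ = 0 := by
    rw [prob_compl_eq_zero_iff measurableSet_Icc]; exact hsupp
  by_cases hne : ∃ t ∈ Set.Icc (0:ℝ) M, |g + clamp M t * S| ≤ γ / 16
  · obtain ⟨t, ht, htS⟩ := hne
    have hmeas : MeasurableSet {s : ℝ | γ₀ / 2 < |s - t|} :=
      measurableSet_lt measurable_const (by fun_prop)
    have hsub : {x | |g + clamp M x * S| ≤ γ / 16} ⊆
        {s : ℝ | γ₀ / 2 < |s - t|}ᶜ ∪ (Set.Icc 0 M)ᶜ := by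
      intro x hx
      by_contra hcon
      simp only [Set.mem_union, Set.mem_compl_iff, not_or, not_not] at hcon
      have h1 : γ₀ / 2 < |x - t| := hcon.1
      have hx : |g + clamp M x * S| ≤ γ / 16 := hx
      rw [clamp_eq hcon.2] at hx
      rw [clamp_eq ht] at htS
      have h2 : |(x - t) * S| ≤ γ / 8 := by
        have : (x - t) * S = (g + x * S) - (g + t * S) := by ring
        rw [this]
        exact (abs_sub _ _).trans (by linarith)
      rw [abs_mul] at h2
      nlinarith [abs_nonneg (x - t)]
    calc _ ≤ μ {s : ℝ | γ₀ / 2 < |s - t|}ᶜ + μ (Set.Icc 0 M)ᶜ :=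
          (measure_mono hsub).trans (measure_union_le _ _)
      _ = 1 - μ {s : ℝ | γ₀ / 2 < |s - t|} := by
          rw [hzero, add_zero, prob_compl_eq_one_sub hmeas]
      _ ≤ 1 - ENNReal.ofReal ρ := tsub_le_tsub_left (hac t ht) _
      _ = _ := by rw [ENNReal.ofReal_sub _ hρ0, ENNReal.ofReal_one]
  · push Not at hne
    have hsub : {x | |g + clamp M x * S| ≤ γ / 16} ⊆ (Set.Icc 0 M)ᶜ := by
      intro x hx hx2
      exact absurd hx (not_le.2 (hne x hx2))
    exact ((measure_mono hsub).trans hzero.le).trans (by simp)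

lemma measurable_cornerSol {Ω : Type*} [MeasurableSpace Ω] (c : Ω → ℕ → ℕ → ℝ)
    (hc : ∀ p q, Measurable fun V => c V p q) (β : ℕ → ℝ) (p q : ℕ) :
    Measurable fun V => cornerSol (c V) β p q := by
  induction p, q using cornerSol.induct with
  | case1 => simp only [cornerSol]; exact measurable_const
  | case2 => simp only [cornerSol]; exact measurable_const
  | case3 q hq => simp only [cornerSol]; exact measurable_const
  | case4 q hq => simp only [cornerSol]; exact measurable_const
  | case5 q hq => simp only [cornerSol]; exact measurable_const
  | case6 q hq => simp only [cornerSol]; exact measurable_const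
  | case7 p q ih1 ih2 ih3 ih4 =>
    simp only [cornerSol_step]
    exact ((((hc _ _).mul ih1).sub ih2).sub ih3).sub ih4

/-- Failure probability of `HopGood` when the coefficients are independent clamped potentials. -/
theorem measure_hop_fail_le {ι : Type*} [Fintype ι] {M γ₀ γ ρ A Θ : ℝ} (ν : ι → Measure ℝ)
    [∀ i, IsProbabilityMeasure (ν i)] (hρ0 : 0 ≤ ρ) (hρ1 : ρ ≤ 1) (hγ : γ ≤ γ₀) (hγ0 : 0 < γ)
    (hsupp : ∀ i, ν i (Set.Icc 0 M) = 1)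
    (hac : ∀ i, ∀ t ∈ Set.Icc (0:ℝ) M, ENNReal.ofReal ρ ≤ ν i {s | γ₀ / 2 < |s - t|})
    (c : (ι → ℝ) → ℕ → ℕ → ℝ) (F : Set (ℕ × ℕ)) (a b e : ℕ) (i : ℕ → ℕ → ι)
    (hcm : ∀ p q, Measurable fun V => c V p q)
    (ha : 1 ≤ a) (hA0 : 0 ≤ A) (hA : ∀ V p q, p ≤ a → q ≤ b + 1 → |c V p q| ≤ A)
    (hΘ : 16 * a * (A + 2) ≤ Θ) (he : (e : ℝ) ≤ ρ * a / 16)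
    (hupd : ∀ p q, 1 ≤ p → p < a → 2 ≤ q → q < b → (p, q) ∉ F → p % 2 = q % 2 → ∀ V t,
      (∀ p' q', (p', q') ≠ (p, q) → c (Function.update V (i p q) t) p' q' = c V p' q') ∧
      ∃ g : ℝ, ∀ t, c (Function.update V (i p q) t) p q = g + clamp M t) :
    Measure.pi ν {V | ¬ HopGood (c V) F a b e Θ γ} ≤
      b * (2 * hopCount b Θ γ + 1 : ℕ) ^ (b + 2) * ENNReal.ofReal (Real.exp (-(ρ * a / 16))) := by
  have hsub : {V | ¬ HopGood (c V) F a b e Θ γ} ⊆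
      ⋃ x ∈ (Finset.Ico 2 b ×ˢ hopNet b Θ γ).filter fun x : ℕ × (Fin (b + 2) → ℤ) =>
        (∀ q ∈ Finset.Icc 2 (b + 1), |hopParam b Θ γ x.2 q| ≤ 2 * Θ ^ q) ∧
        3 / 4 * Θ ^ x.1 ≤ |hopParam b Θ γ x.2 x.1| ∧ a ≤ 4 * (hopSites F a x.1).card,
      {V | ((hopSites F a x.1).filter fun p => ¬
        |cornerSol (c V) (hopParam b Θ γ x.2) (p + 1) (hopTarget b x.1)| ≤ γ / 16).card ≤ e} := by
    intro V hV
    have hV : ¬ HopGood (c V) F a b e Θ γ := hV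
    unfold HopGood at hV
    push Not at hV
    obtain ⟨q₀, hq₀, k, hk, h1, h2, h3, h4⟩ := hV
    simp only [Set.mem_iUnion]
    refine ⟨(q₀, k), by simp only [Finset.mem_filter, Finset.mem_product]; exact ⟨⟨hq₀, hk⟩, h1, h2, h3⟩, ?_⟩
    show Finset.card _ ≤ e
    simpa only [not_le] using h4
  refine (measure_mono hsub).trans ((measure_biUnion_finset_le _ _).trans ?_)
  have hbound : ∀ x ∈ (Finset.Ico 2 b ×ˢ hopNet b Θ γ).filter fun x : ℕ × (Fin (b + 2) → ℤ) =>
        (∀ q ∈ Finset.Icc 2 (b + 1), |hopParam b Θ γ x.2 q| ≤ 2 * Θ ^ q) ∧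
        3 / 4 * Θ ^ x.1 ≤ |hopParam b Θ γ x.2 x.1| ∧ a ≤ 4 * (hopSites F a x.1).card,
      Measure.pi ν {V | ((hopSites F a x.1).filter fun p => ¬
        |cornerSol (c V) (hopParam b Θ γ x.2) (p + 1) (hopTarget b x.1)| ≤ γ / 16).card ≤ e}
        ≤ ENNReal.ofReal (Real.exp (-(ρ * a / 16))) := by
    rintro ⟨q₀, k⟩ hx
    simp only [Finset.mem_filter, Finset.mem_product, Finset.mem_Ico] at hx
    obtain ⟨⟨⟨hq2, hqb⟩, hk⟩, h1, h2, h3⟩ := hx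
    dsimp only at h1 h2 h3 ⊢
    set β := hopParam b Θ γ k with hβ
    have hmem : ∀ p ∈ hopSites F a q₀, 1 ≤ p ∧ p < a ∧ p % 2 = q₀ % 2 ∧ (p, q₀) ∉ F := by
      intro p hp
      simp only [hopSites, Finset.mem_filter, Finset.mem_Ico] at hp
      tauto
    obtain ⟨j, hj⟩ : ∃ j, hopTarget b q₀ = q₀ + 1 + 2 * j := by
      unfold hopTarget
      split_ifs
      · exact ⟨(b - q₀ - 1) / 2, by omega⟩
      · exact ⟨(b - q₀) / 2, by omega⟩
    refine measure_few_le ν (fun p => i p q₀)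
      (fun p => {V | |cornerSol (c V) β (p + 1) (hopTarget b q₀)| ≤ γ / 16}) ρ hρ0 hρ1
      (fun p => measurableSet_le (measurable_cornerSol c hcm β _ _).abs measurable_const)
      (hopSites F a q₀) ?_ ?_ a e h3 he
    · intro p hp p' hp' hlt V t
      obtain ⟨h4, h5, h6, h7⟩ := hmem p' hp'
      have h8 := (hupd p' q₀ h4 h5 hq2 hqb h7 h6 V t).1
      simp only [Set.mem_ofPred_eq]
      rw [cornerSol_congr β (p + 1) (hopTarget b q₀) (c' := c V)]
      intro p'' hp'' q'' _
      exact h8 _ _ (by simp; omega)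
    · intro p hp V
      obtain ⟨h4, h5, h6, h7⟩ := hmem p hp
      obtain ⟨g, hg⟩ := (hupd p q₀ h4 h5 hq2 hqb h7 h6 V 0).2
      set S := cornerSol (c V) β p q₀ with hSdef
      have hS : 1 / 2 ≤ |S| := by
        have hAV := hA V
        have hup := corner_growth (m := 2) (cornerSol_parity (c V) β) ha
          (cornerSol_rec (c V) β a (b + 1)) hAV hA0 le_rfl (by norm_num) hΘ (by simp)
          (by simp [cornerSol_row0]) (by simp [cornerSol_row1])
          (fun q h2 hq => by rw [cornerSol_col (c V) β q h2]; exact h1 q (by simp; omega))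
        obtain ⟨q, rfl⟩ : ∃ q, q₀ = q + 2 := ⟨q₀ - 2, by omega⟩
        have hl := corner_row_lower (m := 1) (Q := b + 1) (q := q) ha
          (cornerSol_rec (c V) β a (b + 1)) hAV hA0
          zero_le_one hΘ (by omega) (fun q hq p hp => (hup q hq p hp).trans (by linarith)) p
          ((q + 2) % 2) (by omega) (by omega) (by omega)
          (by rw [cornerSol_col (c V) β (q + 2) (by omega), mul_one]; exact h2)
        have ha' : (1 : ℝ) ≤ a := by exact_mod_cast ha
        have : 1 ≤ Θ ^ (q + 2) := one_le_pow₀ (by nlinarith)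
        linarith
      have heq : ∀ t, cornerSol (c (Function.update V (i p q₀) t)) β (p + 1) (hopTarget b q₀)
          = (cornerSol (c V) β (p + 1) (hopTarget b q₀) + (-1) ^ j * ((g - c V p q₀) * S))
            + clamp M t * ((-1) ^ j * S) := by
        intro t
        have h8 := (hupd p q₀ h4 h5 hq2 hqb h7 h6 V t).1
        have h9 := cornerSol_perturb β p q₀ (by omega) (fun p' q' h => (h8 p' q' h).symm) j h4
        rw [hg t, ← hj] at h9
        linear_combination h9
      simp only [Set.mem_ofPred_eq, heq]
      exact measure_affine_small_le (ν (i p q₀)) hγ hγ0 hρ0 (hsupp _) (hac _) _ _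
        (by simpa [abs_mul] using hS)
  refine (Finset.sum_le_sum hbound).trans ?_
  rw [Finset.sum_const, nsmul_eq_mul]
  gcongr
  have hcard : ((Finset.Ico 2 b ×ˢ hopNet b Θ γ).filter fun x : ℕ × (Fin (b + 2) → ℤ) =>
        (∀ q ∈ Finset.Icc 2 (b + 1), |hopParam b Θ γ x.2 q| ≤ 2 * Θ ^ q) ∧
        3 / 4 * Θ ^ x.1 ≤ |hopParam b Θ γ x.2 x.1| ∧ a ≤ 4 * (hopSites F a x.1).card).card
      ≤ b * (2 * hopCount b Θ γ + 1) ^ (b + 2) := by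
    refine (Finset.card_le_card (t := Finset.Ico 2 b ×ˢ hopNet b Θ γ) fun x hx => ?_).trans ?_
    · simp only [Finset.mem_filter] at hx
      exact hx.1
    rw [Finset.card_product, hopNet, Fintype.card_piFinset]
    gcongr
    · simp
    · simp
      gcongr
      omega
  exact_mod_cast hcard

/-- Coordinates of a rectangle with corner `x`: `p` runs along the rows and `q` is the direction
of growth, one of the four axis directions. -/
def frame (σ τ : Bool) (x : ℤ × ℤ) (p q : ℕ) : ℤ × ℤ :=
  match σ, τ with
  | false, true => (x.1 + p, x.2 + q)
  | false, false => (x.1 + p, x.2 - q)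
  | true, true => (x.1 + q, x.2 + p)
  | true, false => (x.1 - q, x.2 + p)

/-- The corner of the rectangle moved by `k` rows. -/
def frameShift (σ τ : Bool) (x : ℤ × ℤ) (k : ℕ) : ℤ × ℤ := frame σ τ x 0 k

lemma frame_shift (σ τ : Bool) (x : ℤ × ℤ) (k p q : ℕ) :
    frame σ τ (frameShift σ τ x k) p q = frame σ τ x p (k + q) := by
  cases σ <;> cases τ <;> simp [frame, frameShift] <;> ring

lemma frame_parity (σ τ : Bool) (x : ℤ × ℤ) (hx : (x.1 + x.2) % 2 = 0) (p q : ℕ) :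
    ((frame σ τ x p q).1 + (frame σ τ x p q).2) % 2 = 0 ↔ p % 2 = q % 2 := by
  cases σ <;> cases τ <;> simp only [frame] <;> omega

lemma frame_inj (σ τ : Bool) (x : ℤ × ℤ) {p q p' q' : ℕ}
    (h : frame σ τ x p q = frame σ τ x p' q') : p = p' ∧ q = q' := by
  cases σ <;> cases τ <;> simp only [frame, Prod.mk.injEq] at h <;> omega

/-- The box of half-width `r` around `z`. -/
def InBox (z : ℤ × ℤ) (r : ℕ) (x : ℤ × ℤ) : Prop := |x.1 - z.1| ≤ r ∧ |x.2 - z.2| ≤ r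

lemma InBox.iff {z : ℤ × ℤ} {r : ℕ} {x : ℤ × ℤ} : InBox z r x ↔
    (z.1 - r ≤ x.1 ∧ x.1 ≤ z.1 + r) ∧ (z.2 - r ≤ x.2 ∧ x.2 ≤ z.2 + r) := by
  unfold InBox
  rw [abs_le, abs_le]
  constructor <;> rintro ⟨⟨_, _⟩, _, _⟩ <;> refine ⟨⟨?_, ?_⟩, ?_, ?_⟩ <;> omega

lemma rows_of_advance {w : ℕ → ℕ → ℝ} {a Q bm : ℕ} {X Θ : ℝ} (hX : 1 ≤ X) (hΘ : 1 ≤ Θ)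
    (h0 : ∀ p ≤ a, |w p 0| ≤ X) (h1 : ∀ p ≤ a, |w p 1| ≤ X)
    (hadv : ∀ q₀, q₀ % 2 = 0 → q₀ < Q → ∀ Y, 1 ≤ Y → (∀ p ≤ a, |w p q₀| ≤ Y) →
      (∀ p ≤ a, |w p (q₀ + 1)| ≤ Y) → ∃ j, 1 ≤ j ∧ 2 * j ≤ bm ∧
        ∀ q ≤ 2 * j + 1, ∀ p ≤ a, |w p (q₀ + q)| ≤ Y * Θ ^ (8 * j)) :
    ∀ q ≤ Q + 1, ∀ p ≤ a, |w p q| ≤ X * Θ ^ (4 * (Q + bm)) := by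
  have key : ∀ n, ∃ q₀, q₀ % 2 = 0 ∧ min n Q ≤ q₀ ∧ q₀ ≤ Q + bm ∧
      ∀ q ≤ q₀ + 1, ∀ p ≤ a, |w p q| ≤ X * Θ ^ (4 * q₀) := by
    intro n
    induction n with
    | zero =>
      refine ⟨0, rfl, by simp, by simp, fun q hq p hp => ?_⟩
      interval_cases q
      · simpa using h0 p hp
      · simpa using h1 p hp
    | succ n ih =>
      obtain ⟨q₀, hpar, hmin, hmax, hb⟩ := ih
      by_cases hq : q₀ < Q
      · obtain ⟨j, hj1, hj2, hj⟩ := hadv q₀ hpar hq (X * Θ ^ (4 * q₀))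
          (by have := one_le_pow₀ (n := 4 * q₀) hΘ; nlinarith)
          (hb q₀ (by omega)) (hb (q₀ + 1) (by omega))
        refine ⟨q₀ + 2 * j, by omega, by omega, by omega, fun q hq' p hp => ?_⟩
        by_cases hle : q ≤ q₀ + 1
        · refine (hb q hle p hp).trans ?_
          gcongr
          omega
        · obtain ⟨k, rfl⟩ : ∃ k, q = q₀ + k := ⟨q - q₀, by omega⟩
          refine (hj k (by omega) p hp).trans (le_of_eq ?_)
          rw [mul_assoc, ← pow_add]; congr 2; ring
      · exact ⟨q₀, hpar, by omega, hmax, hb⟩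
  obtain ⟨q₀, -, hmin, hmax, hb⟩ := key Q
  intro q hq p hp
  refine (hb q (by omega) p hp).trans ?_
  gcongr

/-- The advance property: from two bounded rows one can move on by an even number of rows. -/
def Advance (U : ℤ × ℤ → ℝ) (Θ : ℝ) (bm : ℕ) (σ τ : Bool) (x : ℤ × ℤ) (a : ℕ) : Prop :=
  ∀ Y, 1 ≤ Y → (∀ p ≤ a, |U (frame σ τ x p 0)| ≤ Y) → (∀ p ≤ a, |U (frame σ τ x p 1)| ≤ Y) →
    ∃ j, 1 ≤ j ∧ 2 * j ≤ bm ∧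
      ∀ q ≤ 2 * j + 1, ∀ p ≤ a, |U (frame σ τ x p q)| ≤ Y * Θ ^ (8 * j)

theorem box_doubling {U : ℤ × ℤ → ℝ} {z : ℤ × ℤ} {h bm : ℕ} {Θ B : ℝ} (hh : 2 ≤ h)
    (heven : h % 2 = 0) (hbm : bm ≤ h) (hB : 1 ≤ B) (hΘ : 1 ≤ Θ)
    (hz : (z.1 + z.2) % 2 = 0)
    (hadv : ∀ σ τ x a, (a = 2 * h ∨ a = 4 * h) → (x.1 + x.2) % 2 = 0 →
      (∀ p ≤ a, ∀ q ≤ bm + 1, InBox z (4 * h) (frame σ τ x p q)) → Advance U Θ bm σ τ x a)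
    (h0 : ∀ x, InBox z h x → |U x| ≤ B) :
    ∀ x, InBox z (2 * h) x → |U x| ≤ B * Θ ^ (24 * h) := by
  have rows : ∀ σ τ x a X, (a = 2 * h ∨ a = 4 * h) → (x.1 + x.2) % 2 = 0 → 1 ≤ X →
      (∀ p ≤ a, ∀ q ≤ 3 * h, InBox z (4 * h) (frame σ τ x p q)) →
      (∀ p ≤ a, |U (frame σ τ x p 0)| ≤ X) → (∀ p ≤ a, |U (frame σ τ x p 1)| ≤ X) →
      ∀ q ≤ h + 2, ∀ p ≤ a, |U (frame σ τ x p q)| ≤ X * Θ ^ (12 * h) := by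
    intro σ τ x a X ha hx hX hbox hr0 hr1 q hq p hp
    have := rows_of_advance (w := fun p q => U (frame σ τ x p q)) (a := a) (Q := h + 2) (bm := bm)
      hX hΘ hr0 hr1 ?_ q (by omega) p hp
    · refine this.trans ?_
      exact mul_le_mul_of_nonneg_left (pow_le_pow_right₀ hΘ (by omega)) (by linarith)
    · intro q₀ hpar hq₀ Y hY hY0 hY1
      have hA := hadv σ τ (frameShift σ τ x q₀) a ha
        ((frame_parity σ τ x hx 0 q₀).2 (by omega)) (by
          intro p hp q hq
          rw [frame_shift]
          exact hbox p hp _ (by omega)) Y hY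
        (by intro p hp; rw [frame_shift]; exact hY0 p hp)
        (by intro p hp; rw [frame_shift]; exact hY1 p hp)
      obtain ⟨j, hj1, hj2, hj⟩ := hA
      refine ⟨j, hj1, hj2, fun q hq p hp => ?_⟩
      have := hj q hq p hp
      rwa [frame_shift] at this
  -- first extend in the second coordinate
  have hcol : ∀ x : ℤ × ℤ, |x.1 - z.1| ≤ h → |x.2 - z.2| ≤ 2 * h → |U x| ≤ B * Θ ^ (12 * h) := by
    intro x hx1 hx2
    by_cases hin : |x.2 - z.2| ≤ h
    · refine (h0 x ⟨hx1, hin⟩).trans ?_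
      have := one_le_pow₀ (n := 12 * h) hΘ
      nlinarith
    rw [abs_le] at hx1 hx2
    rw [abs_le] at hin
    rcases le_total z.2 x.2 with hs | hs
    · have := rows false true (z.1 - h, z.2 + h - 2) (2 * h) B (Or.inl rfl) (by simp only; omega) hB
        (by intro p hp q hq; rw [InBox.iff]; simp only [frame]; push_cast; omega)
        (by intro p hp; apply h0; rw [InBox.iff]; simp only [frame]; push_cast; omega)
        (by intro p hp; apply h0; rw [InBox.iff]; simp only [frame]; push_cast; omega)
        (x.2 - (z.2 + h - 2)).toNat (by omega) (x.1 - (z.1 - h)).toNat (by omega)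
      have e : frame false true (z.1 - h, z.2 + h - 2) (x.1 - (z.1 - h)).toNat
          (x.2 - (z.2 + h - 2)).toNat = x := by
        apply Prod.ext <;> simp only [frame] <;> omega
      rwa [e] at this
    · have := rows false false (z.1 - h, z.2 - h + 2) (2 * h) B (Or.inl rfl)
        (by simp only; omega) hB
        (by intro p hp q hq; rw [InBox.iff]; simp only [frame]; push_cast; omega)
        (by intro p hp; apply h0; rw [InBox.iff]; simp only [frame]; push_cast; omega)
        (by intro p hp; apply h0; rw [InBox.iff]; simp only [frame]; push_cast; omega)
        ((z.2 - h + 2) - x.2).toNat (by omega) (x.1 - (z.1 - h)).toNat (by omega)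
      have e : frame false false (z.1 - h, z.2 - h + 2) (x.1 - (z.1 - h)).toNat
          ((z.2 - h + 2) - x.2).toNat = x := by
        apply Prod.ext <;> simp only [frame] <;> omega
      rwa [e] at this
  have hB1 : 1 ≤ B * Θ ^ (12 * h) := by
    have := one_le_pow₀ (n := 12 * h) hΘ
    nlinarith
  have hfin : B * Θ ^ (12 * h) * Θ ^ (12 * h) = B * Θ ^ (24 * h) := by
    rw [mul_assoc, ← pow_add]; congr 2; ring
  intro x hx
  obtain ⟨hx1, hx2⟩ := hx
  push_cast at hx1 hx2
  by_cases hin : |x.1 - z.1| ≤ h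
  · refine (hcol x hin hx2).trans ?_
    rw [← hfin]
    have := one_le_pow₀ (n := 12 * h) hΘ
    nlinarith
  rw [abs_le] at hx1 hx2
  rw [abs_le] at hin
  rw [← hfin]
  rcases le_total z.1 x.1 with hs | hs
  · have := rows true true (z.1 + h - 2, z.2 - 2 * h) (4 * h) _ (Or.inr rfl)
      (by simp only; omega) hB1
      (by intro p hp q hq; rw [InBox.iff]; simp only [frame]; push_cast; omega)
      (by intro p hp; apply hcol <;> rw [abs_le] <;> simp only [frame] <;> push_cast <;> omega)
      (by intro p hp; apply hcol <;> rw [abs_le] <;> simp only [frame] <;> push_cast <;> omega)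
      (x.1 - (z.1 + h - 2)).toNat (by omega) (x.2 - (z.2 - 2 * h)).toNat (by omega)
    have e : frame true true (z.1 + h - 2, z.2 - 2 * h) (x.2 - (z.2 - 2 * h)).toNat
        (x.1 - (z.1 + h - 2)).toNat = x := by
      apply Prod.ext <;> simp only [frame] <;> omega
    rwa [e] at this
  · have := rows true false (z.1 - h + 2, z.2 - 2 * h) (4 * h) _ (Or.inr rfl)
      (by simp only; omega) hB1
      (by intro p hp q hq; rw [InBox.iff]; simp only [frame]; push_cast; omega)
      (by intro p hp; apply hcol <;> rw [abs_le] <;> simp only [frame] <;> push_cast <;> omega)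
      (by intro p hp; apply hcol <;> rw [abs_le] <;> simp only [frame] <;> push_cast <;> omega)
      ((z.1 - h + 2) - x.1).toNat (by omega) (x.2 - (z.2 - 2 * h)).toNat (by omega)
    have e : frame true false (z.1 - h + 2, z.2 - 2 * h) (x.2 - (z.2 - 2 * h)).toNat
        ((z.1 - h + 2) - x.1).toNat = x := by
      apply Prod.ext <;> simp only [frame] <;> omega
    rwa [e] at this

/-- The eigenvalue equation at `x` in tilted coordinates. -/
def TiltRec (U c : ℤ × ℤ → ℝ) (x : ℤ × ℤ) : Prop :=
  U (x.1 + 1, x.2 + 1) + U (x.1 - 1, x.2 + 1) + U (x.1 + 1, x.2 - 1) + U (x.1 - 1, x.2 - 1)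
    = c x * U x

lemma cornerRec_frame {U c : ℤ × ℤ → ℝ} {σ τ : Bool} {x : ℤ × ℤ} {a Q : ℕ}
    (h : ∀ p q, p ≤ a → q ≤ Q → 1 ≤ p → 1 ≤ q → p + 1 ≤ a → q + 1 ≤ Q →
      TiltRec U c (frame σ τ x p q)) :
    CornerRec (fun p q => U (frame σ τ x p q)) (fun p q => c (frame σ τ x p q)) 0 a Q := by
  intro p q hp hq
  have := h (p + 1) (q + 1) (by omega) (by omega) (by omega) (by omega) (by omega) (by omega)
  unfold TiltRec at this
  rw [abs_nonpos_iff, sub_eq_zero, ← this]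
  cases σ <;> cases τ <;> simp only [frame] <;> push_cast <;> ring_nf

lemma parityZero_frame {U : ℤ × ℤ → ℝ} (hU : ∀ x : ℤ × ℤ, (x.1 + x.2) % 2 ≠ 0 → U x = 0)
    {σ τ : Bool} {x : ℤ × ℤ} (hx : (x.1 + x.2) % 2 = 0) :
    ParityZero fun p q => U (frame σ τ x p q) := fun p q h =>
  hU _ fun h' => h ((frame_parity σ τ x hx p q).1 h')

/-- The sites of `F` in the coordinates of a frame. -/
def frameSet (F : Set (ℤ × ℤ)) (σ τ : Bool) (x : ℤ × ℤ) : Set (ℕ × ℕ) :=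
  {y | frame σ τ x y.1 y.2 ∈ F}

lemma hopSites_large {F : Set (ℕ × ℕ)} {a f q : ℕ} (hf : 4 * f + 12 ≤ a)
    (hF : ((Finset.range (a + 1)).filter fun p => p % 2 = q % 2 ∧ (p, q) ∈ F).card ≤ f) :
    a ≤ 4 * (hopSites F a q).card := by
  have h1 := card_odd_even a q
  have h2 : ((Finset.range (a + 1)).filter fun p => p % 2 = q % 2) ⊆
      hopSites F a q ∪ (((Finset.range (a + 1)).filter fun p => p % 2 = q % 2 ∧ (p, q) ∈ F)
        ∪ {0, a}) := by
    intro p hp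
    simp only [Finset.mem_filter, Finset.mem_range, hopSites, Finset.mem_union, Finset.mem_insert,
      Finset.mem_singleton, Finset.mem_Ico] at hp ⊢
    by_cases h : (p, q) ∈ F
    · exact Or.inr (Or.inl ⟨hp.1, hp.2, h⟩)
    · by_cases h0 : p = 0
      · exact Or.inr (Or.inr (Or.inl h0))
      · by_cases h3 : p = a
        · exact Or.inr (Or.inr (Or.inr h3))
        · exact Or.inl ⟨⟨by omega, by omega⟩, hp.2, h⟩
  have h3 := (Finset.card_le_card h2).trans (Finset.card_union_le _ _)
  have h4 := Finset.card_union_le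
    ((Finset.range (a + 1)).filter fun p => p % 2 = q % 2 ∧ (p, q) ∈ F) {0, a}
  have h5 : ({0, a} : Finset ℕ).card ≤ 2 := Finset.card_le_two
  omega

theorem advance_small {U c : ℤ × ℤ → ℝ} {F : Set (ℤ × ℤ)} {σ τ : Bool} {x : ℤ × ℤ} {a f : ℕ}
    {A Θ : ℝ} (hU : ∀ x : ℤ × ℤ, (x.1 + x.2) % 2 ≠ 0 → U x = 0) (hx : (x.1 + x.2) % 2 = 0)
    (ha : 1 ≤ a) (hA : 0 ≤ A) (hΘ : 16 * a * (A + 2) ≤ Θ)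
    (hrec : ∀ p ≤ a, ∀ q ≤ 3, 1 ≤ p → 1 ≤ q → p + 1 ≤ a → q + 1 ≤ 3 →
      TiltRec U c (frame σ τ x p q))
    (hc : ∀ p ≤ a, ∀ q ≤ 3, |c (frame σ τ x p q)| ≤ A)
    (hF : ∀ q ≤ 3, ((Finset.range (a + 1)).filter
      fun p => p % 2 = q % 2 ∧ frame σ τ x p q ∈ F).card ≤ f)
    (hf : 2 * f + 1 < a)
    (hbad : ∀ p ≤ a, ∀ q ≤ 3, frame σ τ x p q ∉ F → |U (frame σ τ x p q)| ≤ 1) :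
    Advance U Θ 2 σ τ x a := by
  intro Y hY h0 h1
  refine ⟨1, le_rfl, le_rfl, ?_⟩
  have ha' : (1 : ℝ) ≤ a := by exact_mod_cast ha
  have hΘ1 : 32 ≤ Θ := by nlinarith
  have hsite : ∀ q ≤ 3, ∃ p ≤ a, p % 2 = q % 2 ∧ |U (frame σ τ x p q)| ≤ 1 := by
    intro q hq
    by_contra! hcon
    have hsub : ((Finset.range (a + 1)).filter fun p => p % 2 = q % 2) ⊆
        (Finset.range (a + 1)).filter fun p => p % 2 = q % 2 ∧ frame σ τ x p q ∈ F := by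
      intro p hp
      simp only [Finset.mem_filter, Finset.mem_range] at hp ⊢
      refine ⟨hp.1, hp.2, ?_⟩
      by_contra hn
      exact absurd (hbad p (by omega) q hq hn) (not_le.2 (hcon p (by omega) hp.2))
    have := Finset.card_le_card hsub
    have h2 := card_odd_even a q
    have h3 := hF q hq
    omega
  have hR := cornerRec_frame (U := U) (c := c) (σ := σ) (τ := τ) (x := x) (a := a) (Q := 3)
    (fun p q hp hq => hrec p hp q hq)
  have hP := parityZero_frame hU (σ := σ) (τ := τ) hx
  have step : ∀ q, q + 2 ≤ 3 → ∀ X, 1 ≤ X → (∀ p ≤ a, |U (frame σ τ x p q)| ≤ X) →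
      (∀ p ≤ a, |U (frame σ τ x p (q + 1))| ≤ X) →
      ∀ p ≤ a, |U (frame σ τ x p (q + 2))| ≤ X * Θ := by
    intro q hq X hX hq0 hq1 p hp
    by_cases hpar : p % 2 = (q + 2) % 2
    · obtain ⟨p', hp', hpar', hs⟩ := hsite (q + 2) hq
      have := corner_row_compare hR hq (fun p q hp hq => hc p hp q hq) hq0 hq1 le_rfl p p' hp hp'
        (by omega)
      refine this.trans ?_
      have h5 : a * (A + 2) * X ≤ Θ / 16 * X :=
        mul_le_mul_of_nonneg_right (by linarith) (by linarith)
      nlinarith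
    · have h3 := hP p (q + 2) hpar
      simp only at h3
      rw [h3, abs_zero]
      positivity
  have h2 := step 0 (by omega) Y hY h0 h1
  have hY2 : Y ≤ Y * Θ := by nlinarith
  have h3 := step 1 (by omega) (Y * Θ) (by linarith) (fun p hp => (h1 p hp).trans hY2) h2
  have e8 : Y * Θ * Θ ≤ Y * Θ ^ (8 * 1) := by
    rw [mul_assoc]
    refine mul_le_mul_of_nonneg_left ?_ (by linarith)
    rw [← sq]; exact pow_le_pow_right₀ (by linarith) (by omega)
  have hY3 : Y * Θ ≤ Y * Θ * Θ := by nlinarith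
  intro q hq p hp
  interval_cases q
  · exact (h0 p hp).trans (by linarith)
  · exact (h1 p hp).trans (by linarith)
  · exact (h2 p hp).trans (by linarith)
  · exact (h3 p hp).trans (by linarith)

theorem advance_large {U c c' : ℤ × ℤ → ℝ} {F : Set (ℤ × ℤ)} {Bd : Finset (ℤ × ℤ)} {σ τ : Bool}
    {x : ℤ × ℤ} {a f e bm : ℕ} {A Θ γ κ : ℝ}
    (hU : ∀ x : ℤ × ℤ, (x.1 + x.2) % 2 ≠ 0 → U x = 0) (hx : (x.1 + x.2) % 2 = 0)
    (ha : 1 ≤ a) (hA : 0 ≤ A) (hγ : 0 < γ) (hγ1 : γ ≤ 1) (hΘ : 16 * a * (A + 2) ≤ Θ)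
    (hΘγ : 128 / γ ≤ Θ)
    (hrec : ∀ p ≤ a, ∀ q ≤ bm + 1, 1 ≤ p → 1 ≤ q → p + 1 ≤ a → q + 1 ≤ bm + 1 →
      TiltRec U c' (frame σ τ x p q))
    (hc : ∀ p ≤ a, ∀ q ≤ bm + 1, |c (frame σ τ x p q)| ≤ A)
    (hc' : ∀ p ≤ a, ∀ q ≤ bm + 1, |c' (frame σ τ x p q)| ≤ A)
    (hcc : ∀ p ≤ a, ∀ q ≤ bm + 1, |c' (frame σ τ x p q) - c (frame σ τ x p q)| ≤ κ)
    (hκ : ∀ b ≤ bm, a * (κ * (2 * Θ ^ (b + 1))) ≤ hopMesh b Θ γ)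
    (hF : ∀ q ≤ bm + 1, ((Finset.range (a + 1)).filter
      fun p => p % 2 = q % 2 ∧ frame σ τ x p q ∈ F).card ≤ f)
    (hf : 4 * f + 12 ≤ a) (he : 2 * (e + f) + 1 < a)
    (hgood : ∀ b, 1 ≤ b → b ≤ bm → HopGood (fun p q => c (frame σ τ x p q)) (frameSet F σ τ x)
      a b (e + f) Θ γ)
    (hbad : ∀ p ≤ a, ∀ q ≤ bm + 1, frame σ τ x p q ∉ F → 1 < |U (frame σ τ x p q)| →
      frame σ τ x p q ∈ Bd)
    (hBd : Bd.card < (bm / 2) * (e + 1)) :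
    Advance U Θ bm σ τ x a := by
  intro Y hY h0 h1
  have ha' : (1 : ℝ) ≤ a := by exact_mod_cast ha
  have hΘ1 : 32 ≤ Θ := by nlinarith
  have hP := parityZero_frame hU (σ := σ) (τ := τ) hx
  -- bad sites in a row
  set R : ℕ → Finset ℕ := fun q => (Finset.range (a + 1)).filter
    fun p => frame σ τ x p q ∉ F ∧ 1 < |U (frame σ τ x p q)| with hR
  have hpick : ∃ j, 1 ≤ j ∧ j ≤ bm / 2 ∧ (R (2 * j)).card ≤ e ∧ (R (2 * j + 1)).card ≤ e := by
    by_contra! hcon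
    have hch : ∀ j ∈ Finset.Icc 1 (bm / 2), ∃ i, i ≤ 1 ∧ e + 1 ≤ (R (2 * j + i)).card := by
      intro j hj
      rw [Finset.mem_Icc] at hj
      by_cases h : (R (2 * j)).card ≤ e
      · exact ⟨1, le_rfl, hcon j hj.1 hj.2 h⟩
      · exact ⟨0, by omega, by rw [add_zero]; omega⟩
    choose! i hi1 hi using hch
    have hsum : (Finset.Icc 1 (bm / 2)).card * (e + 1) ≤
        ((Finset.Icc 1 (bm / 2)).sigma fun j => R (2 * j + i j)).card := by
      rw [Finset.card_sigma, ← smul_eq_mul]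
      exact Finset.card_nsmul_le_sum _ _ _ hi
    have hinj : ((Finset.Icc 1 (bm / 2)).sigma fun j => R (2 * j + i j)).card ≤ Bd.card := by
      refine Finset.card_le_card_of_injOn (fun y => frame σ τ x y.2 (2 * y.1 + i y.1)) ?_ ?_
      · rintro ⟨j, p⟩ hy
        simp only [Finset.coe_sigma, Set.mem_sigma_iff, Finset.mem_coe, Finset.mem_Icc, hR,
          Finset.mem_filter, Finset.mem_range] at hy
        have := hi1 j (Finset.mem_Icc.2 hy.1)
        have hq : 2 * j + i j ≤ bm + 1 := by omega
        exact hbad p (by omega) _ hq hy.2.2.1 hy.2.2.2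
      · rintro ⟨j, p⟩ hy ⟨j', p'⟩ hy' hEq
        simp only [Finset.coe_sigma, Set.mem_sigma_iff, Finset.mem_coe] at hy hy'
        have h1 := hi1 j hy.1
        have h2 := hi1 j' hy'.1
        obtain ⟨h3, h4⟩ := frame_inj σ τ x hEq
        simp only at h3 h4
        obtain rfl : j = j' := by omega
        rw [h3]
    rw [Nat.card_Icc, Nat.add_sub_cancel] at hsum
    omega
  obtain ⟨j, hj1, hj2, hja, hjb⟩ := hpick
  refine ⟨j, hj1, by omega, ?_⟩
  have hexc : ∀ q ≤ bm + 1, (R q).card ≤ e →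
      ((Finset.range (a + 1)).filter fun p => Y < |U (frame σ τ x p q)|).card ≤ e + f := by
    intro q hq hRq
    have hsub : ((Finset.range (a + 1)).filter fun p => Y < |U (frame σ τ x p q)|) ⊆
        R q ∪ (Finset.range (a + 1)).filter fun p => p % 2 = q % 2 ∧ frame σ τ x p q ∈ F := by
      intro p hp
      simp only [Finset.mem_filter, Finset.mem_range, Finset.mem_union, hR] at hp ⊢
      by_cases hFm : frame σ τ x p q ∈ F
      · refine Or.inr ⟨hp.1, ?_, hFm⟩
        by_contra hpar
        have h3 := hP p q hpar
        simp only at h3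
        rw [h3, abs_zero] at hp
        linarith [hp.2]
      · exact Or.inl ⟨hp.1, hFm, by linarith [hp.2]⟩
    refine (Finset.card_le_card hsub).trans ((Finset.card_union_le _ _).trans ?_)
    exact Nat.add_le_add hRq (hF q hq)
  have key := hop_bound (w := fun p q => U (frame σ τ x p q)) (c := fun p q => c (frame σ τ x p q))
    (c' := fun p q => c' (frame σ τ x p q)) (F := frameSet F σ τ x) (a := a) (b := 2 * j)
    (e := e + f) (A := A) (Θ := Θ) (γ := γ) (κ := κ) (X := Y) ha (by omega) hA hγ hγ1
    (by linarith) hΘ hP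
    (cornerRec_frame fun p q hp hq h3 h4 h5 h6 =>
      hrec p hp q (by omega) h3 h4 h5 (by omega))
    (fun p q hp hq => hc p hp q (by omega)) (fun p q hp hq => hc' p hp q (by omega))
    (fun p q hp hq => hcc p hp q (by omega)) (hκ _ (by omega)) (hgood _ (by omega) (by omega))
    (fun q hq => by
      rw [Finset.mem_Ico] at hq
      exact hopSites_large hf (hF q (by omega)))
    he h0 h1 (hexc _ (by omega) hja) (hexc _ (by omega) hjb)
  intro q hq p hp
  refine (key q hq p hp).trans ?_
  rw [mul_comm _ Y]
  refine mul_le_mul_of_nonneg_left ?_ (by linarith)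
  calc 128 / γ * Θ ^ (2 * (2 * j + 1)) ≤ Θ * Θ ^ (2 * (2 * j + 1)) := by gcongr
    _ = Θ ^ (2 * (2 * j + 1) + 1) := by ring
    _ ≤ Θ ^ (8 * j) := pow_le_pow_right₀ (by linarith) (by omega)

/-- The lattice site with tilted coordinates `y` (for `y` of even coordinate sum). -/
def untilt (y : ℤ × ℤ) : ℤ × ℤ := ((y.1 + y.2) / 2, (y.1 - y.2) / 2)

def tilt (n : ℤ × ℤ) : ℤ × ℤ := (n.1 + n.2, n.1 - n.2)

@[simp] lemma untilt_tilt (n : ℤ × ℤ) : untilt (tilt n) = n := by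
  apply Prod.ext <;> simp only [untilt, tilt] <;> omega

lemma tilt_untilt {y : ℤ × ℤ} (h : (y.1 + y.2) % 2 = 0) : tilt (untilt y) = y := by
  apply Prod.ext <;> simp only [untilt, tilt] <;> omega

lemma tilt_even (n : ℤ × ℤ) : ((tilt n).1 + (tilt n).2) % 2 = 0 := by
  simp only [tilt]; omega

/-- A function on the lattice read in tilted coordinates. -/
def tiltU (ψ : ℤ × ℤ → ℝ) (y : ℤ × ℤ) : ℝ := if (y.1 + y.2) % 2 = 0 then ψ (untilt y) else 0

def tiltC (V : ℤ × ℤ → ℝ) (lam : ℝ) : ℤ × ℤ → ℝ := tiltU fun n => 4 + V n - lam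

def tiltF (F : Set (ℤ × ℤ)) : Set (ℤ × ℤ) := {y | (y.1 + y.2) % 2 = 0 ∧ untilt y ∈ F}

lemma tiltU_odd (ψ : ℤ × ℤ → ℝ) (y : ℤ × ℤ) (h : (y.1 + y.2) % 2 ≠ 0) : tiltU ψ y = 0 :=
  if_neg h

lemma tiltU_even (ψ : ℤ × ℤ → ℝ) {y : ℤ × ℤ} (h : (y.1 + y.2) % 2 = 0) :
    tiltU ψ y = ψ (untilt y) := if_pos h

@[simp] lemma tiltU_tilt (ψ : ℤ × ℤ → ℝ) (n : ℤ × ℤ) : tiltU ψ (tilt n) = ψ n := by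
  rw [tiltU_even _ (tilt_even n), untilt_tilt]

lemma tiltRec_of_eigOn {V ψ : ℤ × ℤ → ℝ} {lam : ℝ} {S : Set (ℤ × ℤ)} (hE : EigOn V lam ψ S)
    {y : ℤ × ℤ} (hy : (y.1 + y.2) % 2 = 0 → untilt y ∈ S) :
    TiltRec (tiltU ψ) (tiltC V lam) y := by
  unfold TiltRec
  by_cases h : (y.1 + y.2) % 2 = 0
  · obtain ⟨n, rfl⟩ : ∃ n, y = tilt n := ⟨untilt y, (tilt_untilt h).symm⟩
    have hn := hE n (by simpa using hy h)
    have e1 : ((tilt n).1 + 1, (tilt n).2 + 1) = tilt (n.1 + 1, n.2) := by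
      apply Prod.ext <;> simp only [tilt] <;> ring
    have e2 : ((tilt n).1 - 1, (tilt n).2 + 1) = tilt (n.1, n.2 - 1) := by
      apply Prod.ext <;> simp only [tilt] <;> ring
    have e3 : ((tilt n).1 + 1, (tilt n).2 - 1) = tilt (n.1, n.2 + 1) := by
      apply Prod.ext <;> simp only [tilt] <;> ring
    have e4 : ((tilt n).1 - 1, (tilt n).2 - 1) = tilt (n.1 - 1, n.2) := by
      apply Prod.ext <;> simp only [tilt] <;> ring
    rw [e1, e2, e3, e4, tiltC]
    simp only [tiltU_tilt]
    linarith
  · rw [tiltU_odd _ y h, tiltU_odd, tiltU_odd, tiltU_odd, tiltU_odd] <;> simp <;> omega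

/-- The tilted square of half-width `r` around the point with tilted coordinates `z`. -/
def tBox (z : ℤ × ℤ) (r : ℕ) : Set (ℤ × ℤ) := tRect (z.1 - r) (z.1 + r) (z.2 - r) (z.2 + r)

lemma mem_tBox {z n : ℤ × ℤ} {r : ℕ} : n ∈ tBox z r ↔ InBox z r (tilt n) := by
  rw [InBox.iff]
  simp only [tBox, tRect, tilt, Set.mem_ofPred_eq]
  tauto

lemma isTiltedSquare_tBox (z : ℤ × ℤ) (r : ℕ) : IsTiltedSquare (tBox z r) := by
  refine ⟨z.1 - r, z.2 - r, 2 * r + 1, by omega, ?_⟩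
  rw [tBox]
  congr 1 <;> push_cast <;> ring

lemma finite_tBox (z : ℤ × ℤ) (r : ℕ) : (tBox z r).Finite := by
  refine ((Set.finite_Icc (z.1 - r) (z.1 + r)).prod
    (Set.finite_Icc (z.2 - r) (z.2 + r))).preimage (f := tilt) ?_ |>.subset ?_
  · intro a _ b _ h
    rw [← untilt_tilt a, h, untilt_tilt]
  · intro n hn
    rw [mem_tBox, InBox.iff] at hn
    exact ⟨⟨hn.1.1, hn.1.2⟩, hn.2.1, hn.2.2⟩

lemma SparseIn.mono {η c : ℝ} {F R : Set (ℤ × ℤ)} (h : SparseIn η F R) (hc : η ≤ c) :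
    SparseIn c F R := fun k =>
  ⟨(h k).1.trans (mul_le_mul_of_nonneg_right hc (Nat.cast_nonneg _)),
    (h k).2.trans (mul_le_mul_of_nonneg_right hc (Nat.cast_nonneg _))⟩

lemma ncard_tBox_line (z : ℤ × ℤ) (r : ℕ) (k : ℤ) :
    (tBox z r ∩ {n | n.1 + n.2 = k}).ncard ≤ r + 1 ∧
    (tBox z r ∩ {n | n.1 - n.2 = k}).ncard ≤ r + 1 := by
  constructor
  · have := Set.ncard_le_ncard_of_injOn (s := tBox z r ∩ {n | n.1 + n.2 = k})
      (t := (Finset.range (r + 1) : Set ℕ)) (fun n => ((n.1 - n.2 - (z.2 - r)) / 2).toNat) ?_ ?_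
      (Finset.finite_toSet _)
    · rwa [Set.ncard_coe_finset, Finset.card_range] at this
    · rintro n ⟨hn, hk⟩
      rw [mem_tBox, InBox.iff] at hn
      simp only [tilt, Set.mem_ofPred_eq] at hn hk
      simp only [Finset.coe_range, Set.mem_Iio]
      omega
    · rintro n ⟨hn, hk⟩ n' ⟨hn', hk'⟩ h
      rw [mem_tBox, InBox.iff] at hn hn'
      simp only [tilt, Set.mem_ofPred_eq] at hn hk hn' hk' h
      apply Prod.ext <;> omega
  · have := Set.ncard_le_ncard_of_injOn (s := tBox z r ∩ {n | n.1 - n.2 = k})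
      (t := (Finset.range (r + 1) : Set ℕ)) (fun n => ((n.1 + n.2 - (z.1 - r)) / 2).toNat) ?_ ?_
      (Finset.finite_toSet _)
    · rwa [Set.ncard_coe_finset, Finset.card_range] at this
    · rintro n ⟨hn, hk⟩
      rw [mem_tBox, InBox.iff] at hn
      simp only [tilt, Set.mem_ofPred_eq] at hn hk
      simp only [Finset.coe_range, Set.mem_Iio]
      omega
    · rintro n ⟨hn, hk⟩ n' ⟨hn', hk'⟩ h
      rw [mem_tBox, InBox.iff] at hn hn'
      simp only [tilt, Set.mem_ofPred_eq] at hn hk hn' hk' h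
      apply Prod.ext <;> omega

lemma sparse_row {c₀ : ℝ} {F : Set (ℤ × ℤ)} {z : ℤ × ℤ} {r : ℕ} (hc₀ : 0 ≤ c₀)
    (h : SparseIn c₀ F (tBox z r)) {σ τ : Bool} {x : ℤ × ℤ} {a q : ℕ}
    (hbox : ∀ p ≤ a, InBox z r (frame σ τ x p q)) :
    (((Finset.range (a + 1)).filter
      fun p => p % 2 = q % 2 ∧ frame σ τ x p q ∈ tiltF F).card : ℝ) ≤ c₀ * (r + 1) := by
  set T := (Finset.range (a + 1)).filter
      fun p => p % 2 = q % 2 ∧ frame σ τ x p q ∈ tiltF F with hT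
  have hmem : ∀ p ∈ T, p ≤ a ∧ untilt (frame σ τ x p q) ∈ F ∧
      tilt (untilt (frame σ τ x p q)) = frame σ τ x p q := by
    intro p hp
    simp only [hT, Finset.mem_filter, Finset.mem_range] at hp
    exact ⟨by omega, hp.2.2.2, tilt_untilt hp.2.2.1⟩
  have main : ∃ k : ℤ, (T.card ≤ (F ∩ tBox z r ∩ {n | n.1 + n.2 = k}).ncard) ∨
      (T.card ≤ (F ∩ tBox z r ∩ {n | n.1 - n.2 = k}).ncard) := by
    have hfin := finite_tBox z r
    have hinj : Set.InjOn (fun p => untilt (frame σ τ x p q)) (T : Set ℕ) := by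
      intro p hp p' hp' hEq
      have h1 := (hmem p hp).2.2
      have h2 := (hmem p' hp').2.2
      simp only at hEq
      rw [hEq, h2] at h1
      exact (frame_inj σ τ x h1).1.symm
    cases σ
    · refine ⟨(frame false τ x 0 q).2, Or.inr ?_⟩
      rw [← Set.ncard_coe_finset]
      refine Set.ncard_le_ncard_of_injOn _ ?_ hinj
        ((hfin.inter_of_right F).inter_of_left _)
      intro p hp
      obtain ⟨h1, h2, h3⟩ := hmem p hp
      refine ⟨⟨h2, ?_⟩, ?_⟩
      · rw [mem_tBox, h3]; exact hbox p h1
      · have := congrArg Prod.snd h3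
        simp only [tilt] at this
        rw [Set.mem_ofPred_eq, this]
        cases τ <;> simp [frame]
    · refine ⟨(frame true τ x 0 q).1, Or.inl ?_⟩
      rw [← Set.ncard_coe_finset]
      refine Set.ncard_le_ncard_of_injOn _ ?_ hinj
        ((hfin.inter_of_right F).inter_of_left _)
      intro p hp
      obtain ⟨h1, h2, h3⟩ := hmem p hp
      refine ⟨⟨h2, ?_⟩, ?_⟩
      · rw [mem_tBox, h3]; exact hbox p h1
      · have := congrArg Prod.fst h3
        simp only [tilt] at this
        rw [Set.mem_ofPred_eq, this]
        cases τ <;> simp [frame]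
  obtain ⟨k, hk⟩ := main
  have hl := ncard_tBox_line z r k
  rcases hk with hk | hk
  · calc (T.card : ℝ) ≤ _ := by exact_mod_cast hk
      _ ≤ _ := (h k).1
      _ ≤ c₀ * (r + 1) := mul_le_mul_of_nonneg_left (by exact_mod_cast hl.1) hc₀
  · calc (T.card : ℝ) ≤ _ := by exact_mod_cast hk
      _ ≤ _ := (h k).2
      _ ≤ c₀ * (r + 1) := mul_le_mul_of_nonneg_left (by exact_mod_cast hl.2) hc₀

/-- All hop events for rectangles of rows of length at most `amax` contained in `S`. -/
def HopAll (c : ℤ × ℤ → ℝ) (F S : Set (ℤ × ℤ)) (D amax : ℕ) (ρ Θ γ : ℝ) : Prop :=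
  ∀ σ τ x a b, (x.1 + x.2) % 2 = 0 → 32 * D ^ 2 ≤ a → a ≤ amax → 1 ≤ b → b ^ 2 * D ^ 2 ≤ a →
    (∀ p ≤ a, ∀ q ≤ b + 1, p % 2 = q % 2 → untilt (frame σ τ x p q) ∈ S) →
    HopGood (fun p q => c (frame σ τ x p q)) (frameSet (tiltF F) σ τ x) a b ⌊ρ * a / 16⌋₊ Θ γ

/-- The number of exceptional sites tolerated at scale `h`. -/
def badLim (ρ : ℝ) (D h : ℕ) : ℝ :=
  if h < 16 * D ^ 2 then 1 else ((Nat.sqrt h / (2 * D) : ℕ) : ℝ) * (ρ * h / 16)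

theorem box_step {ψ V : ℤ × ℤ → ℝ} {lam Ebar A Θ γ κ ρ c₀ B : ℝ} {F S : Set (ℤ × ℤ)}
    {z : ℤ × ℤ} {h D amax : ℕ} {Bn : Finset (ℤ × ℤ)}
    (hz : (z.1 + z.2) % 2 = 0) (hh : 2 ≤ h) (heven : h % 2 = 0) (hD : 1 ≤ D)
    (hE : EigOn V lam ψ S) (hS : ∀ n ∈ tBox z (4 * h), n ∈ S)
    (hV : ∀ n ∈ S, |4 + V n - lam| ≤ A) (hV' : ∀ n ∈ S, |4 + V n - Ebar| ≤ A)
    (hA : 0 ≤ A) (hγ : 0 < γ) (hγ1 : γ ≤ 1) (hlam : |lam - Ebar| ≤ κ)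
    (hΘ : 64 * h * (A + 2) ≤ Θ) (hΘγ : 128 / γ ≤ Θ)
    (hκ : ∀ b, b ≤ Nat.sqrt h → 4 * h * (κ * (2 * Θ ^ (b + 1))) ≤ hopMesh b Θ γ)
    (hρ : 0 < ρ) (hρ1 : ρ ≤ 1) (hc₀ : 0 ≤ c₀) (hc₀ρ : c₀ ≤ ρ / 100)
    (hgood : HopAll (tiltC V Ebar) F S D amax ρ Θ γ) (hamax : 4 * h ≤ amax)
    (hsp : SparseIn c₀ F (tBox z (4 * h)))
    (hBn : ∀ n ∈ tBox z (4 * h), n ∉ F → 1 < |ψ n| → n ∈ Bn)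
    (hcard : (Bn.card : ℝ) < badLim ρ D h) (hB : 1 ≤ B)
    (h0 : ∀ x, InBox z h x → |tiltU ψ x| ≤ B) :
    ∀ x, InBox z (2 * h) x → |tiltU ψ x| ≤ B * Θ ^ (24 * h) := by
  have hhR : (2 : ℝ) ≤ h := by exact_mod_cast hh
  have hΘ1 : 1 ≤ Θ := by nlinarith
  have hκ0 : 0 ≤ κ := (abs_nonneg _).trans hlam
  have hmemS : ∀ y, InBox z (4 * h) y → (y.1 + y.2) % 2 = 0 → untilt y ∈ S := by
    intro y hy hpar
    apply hS
    rw [mem_tBox, tilt_untilt hpar]; exact hy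
  have hcb : ∀ l, (∀ n ∈ S, |4 + V n - l| ≤ A) → ∀ y, InBox z (4 * h) y → |tiltC V l y| ≤ A := by
    intro l hl y hy
    by_cases hpar : (y.1 + y.2) % 2 = 0
    · rw [tiltC, tiltU_even _ hpar]; exact hl _ (hmemS y hy hpar)
    · rw [tiltC, tiltU_odd _ _ hpar, abs_zero]; exact hA
  have hcc : ∀ y, |tiltC V lam y - tiltC V Ebar y| ≤ κ := by
    intro y
    by_cases hpar : (y.1 + y.2) % 2 = 0
    · rw [tiltC, tiltC, tiltU_even _ hpar, tiltU_even _ hpar]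
      rw [show 4 + V (untilt y) - lam - (4 + V (untilt y) - Ebar) = -(lam - Ebar) by ring, abs_neg]
      exact hlam
    · rw [tiltC, tiltC, tiltU_odd _ _ hpar, tiltU_odd _ _ hpar, sub_zero, abs_zero]; exact hκ0
  have hrow : ∀ σ τ x a q, (a = 2 * h ∨ a = 4 * h) →
      (∀ p ≤ a, InBox z (4 * h) (frame σ τ x p q)) →
      ((Finset.range (a + 1)).filter
        fun p => p % 2 = q % 2 ∧ frame σ τ x p q ∈ tiltF F).card ≤ ⌊ρ * a / 32⌋₊ := by
    intro σ τ x a q ha hbox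
    apply Nat.le_floor
    refine (sparse_row hc₀ hsp hbox).trans ?_
    have haR : 2 * (h : ℝ) ≤ a := by rcases ha with rfl | rfl <;> push_cast <;> linarith
    push_cast
    nlinarith
  have hfl : ∀ a : ℕ, 32 * ⌊ρ * a / 32⌋₊ ≤ a ∧ 16 * ⌊ρ * a / 16⌋₊ ≤ a := by
    intro a
    have ha0 : (0 : ℝ) ≤ a := Nat.cast_nonneg a
    have h1 := Nat.floor_le (show 0 ≤ ρ * a / 32 by positivity)
    have h2 := Nat.floor_le (show 0 ≤ ρ * a / 16 by positivity)
    constructor <;> rify <;> nlinarith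
  by_cases hsm : h < 16 * D ^ 2
  · rw [badLim, if_pos hsm] at hcard
    have hB0 : Bn = ∅ := Finset.card_eq_zero.1 (by exact_mod_cast (Nat.lt_one_iff.1 (by exact_mod_cast hcard)))
    refine box_doubling (bm := 2) hh heven (by omega) hB hΘ1 hz ?_ h0
    intro σ τ x a ha hx hbox
    have haR : (a : ℝ) ≤ 4 * h := by rcases ha with rfl | rfl <;> push_cast <;> linarith
    have h32 := (hfl a).1
    refine advance_small (c := tiltC V lam) (F := tiltF F) (f := ⌊ρ * a / 32⌋₊) (A := A)
      (tiltU_odd ψ) hx (by omega) hA (by nlinarith) ?_ ?_ ?_ (by omega) ?_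
    · intro p hp q hq _ _ _ _
      exact tiltRec_of_eigOn hE (hmemS _ (hbox p hp q hq))
    · intro p hp q hq
      exact hcb lam hV _ (hbox p hp q hq)
    · intro q hq
      exact hrow σ τ x a q ha fun p hp => hbox p hp q hq
    · intro p hp q hq hnF
      by_contra hcon
      by_cases hpar : ((frame σ τ x p q).1 + (frame σ τ x p q).2) % 2 = 0
      · rw [tiltU_even _ hpar, not_le] at hcon
        have := hBn (untilt (frame σ τ x p q))
          (by rw [mem_tBox, tilt_untilt hpar]; exact hbox p hp q hq)
          (fun hF => hnF ⟨hpar, hF⟩) hcon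
        rw [hB0] at this
        simp at this
      · rw [tiltU_odd _ _ hpar, abs_zero] at hcon
        linarith
  · rw [badLim, if_neg hsm] at hcard
    set J := Nat.sqrt h / (2 * D) with hJ
    rw [not_lt] at hsm
    have hsq : Nat.sqrt h * Nat.sqrt h ≤ h := Nat.sqrt_le h
    have hJs : J * (2 * D) ≤ Nat.sqrt h := Nat.div_mul_le_self _ _
    have hJ1 : 2 * J ≤ Nat.sqrt h := by nlinarith
    have hJh : (2 * J) ^ 2 * D ^ 2 ≤ h := by
      calc (2 * J) ^ 2 * D ^ 2 = J * (2 * D) * (J * (2 * D)) := by ring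
        _ ≤ Nat.sqrt h * Nat.sqrt h := Nat.mul_le_mul hJs hJs
        _ ≤ h := hsq
    have hDD : 1 ≤ D ^ 2 := Nat.one_le_pow _ _ hD
    refine box_doubling (bm := 2 * J) hh heven
      (hJ1.trans (Nat.sqrt_le_self h)) hB hΘ1 hz ?_ h0
    intro σ τ x a ha hx hbox
    have haR : (a : ℝ) ≤ 4 * h := by rcases ha with rfl | rfl <;> push_cast <;> linarith
    have haR2 : 2 * (h : ℝ) ≤ a := by rcases ha with rfl | rfl <;> push_cast <;> linarith
    have h32 := hfl a
    have hle : ⌊ρ * a / 32⌋₊ ≤ ⌊ρ * a / 16⌋₊ := by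
      apply Nat.floor_le_floor
      have : 0 ≤ ρ * a := by positivity
      linarith
    have hsum : ⌊ρ * a / 16⌋₊ - ⌊ρ * a / 32⌋₊ + ⌊ρ * a / 32⌋₊ = ⌊ρ * a / 16⌋₊ := by omega
    refine advance_large (c := tiltC V Ebar) (c' := tiltC V lam) (F := tiltF F)
      (Bd := Bn.image tilt) (f := ⌊ρ * a / 32⌋₊) (A := A) (γ := γ) (κ := κ)
      (e := ⌊ρ * a / 16⌋₊ - ⌊ρ * a / 32⌋₊)
      (tiltU_odd ψ) hx (by omega) hA hγ hγ1 (by nlinarith) hΘγ ?_ ?_ ?_ ?_ ?_ ?_ (by omega)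
      (by omega) ?_ ?_ ?_
    · intro p hp q hq _ _ _ _
      exact tiltRec_of_eigOn hE (hmemS _ (hbox p hp q hq))
    · intro p hp q hq
      exact hcb Ebar hV' _ (hbox p hp q hq)
    · intro p hp q hq
      exact hcb lam hV _ (hbox p hp q hq)
    · intro p _ q _
      exact hcc _
    · intro b hb
      refine le_trans (mul_le_mul_of_nonneg_right haR (by positivity)) (hκ b (by omega))
    · intro q hq
      exact hrow σ τ x a q ha fun p hp => hbox p hp q hq
    · intro b hb1 hb
      rw [hsum]
      refine hgood σ τ x a b hx (by omega) (by omega) hb1 ?_ ?_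
      · have : b ^ 2 ≤ (2 * J) ^ 2 := Nat.pow_le_pow_left hb 2
        have : b ^ 2 * D ^ 2 ≤ (2 * J) ^ 2 * D ^ 2 := Nat.mul_le_mul_right _ this
        omega
      · intro p hp q hq hpar
        exact hmemS _ (hbox p hp q (by omega)) ((frame_parity σ τ x hx p q).2 hpar)
    · intro p hp q hq hnF hgt
      by_cases hpar : ((frame σ τ x p q).1 + (frame σ τ x p q).2) % 2 = 0
      · rw [tiltU_even _ hpar] at hgt
        refine Finset.mem_image.2 ⟨untilt (frame σ τ x p q), hBn _ ?_ ?_ hgt, tilt_untilt hpar⟩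
        · rw [mem_tBox, tilt_untilt hpar]; exact hbox p hp q hq
        · exact fun hF => hnF ⟨hpar, hF⟩
      · rw [tiltU_odd _ _ hpar, abs_zero] at hgt
        linarith
    · refine lt_of_le_of_lt Finset.card_image_le ?_
      rw [Nat.mul_div_cancel_left _ (by norm_num : 0 < 2)]
      have h1 := Nat.lt_floor_add_one (ρ * a / 16)
      have h2 := Nat.floor_le (show 0 ≤ ρ * a / 32 by positivity)
      have h3 : ρ * h / 16 ≤ ((⌊ρ * a / 16⌋₊ - ⌊ρ * a / 32⌋₊ + 1 : ℕ) : ℝ) := by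
        rw [Nat.cast_add, Nat.cast_sub hle, Nat.cast_one]
        nlinarith
      have h4 := hcard.trans_le (mul_le_mul_of_nonneg_left h3 (Nat.cast_nonneg J))
      exact_mod_cast h4

lemma tilt_injective : Function.Injective tilt :=
  Function.LeftInverse.injective untilt_tilt

lemma ncard_tBox_le (z : ℤ × ℤ) (r : ℕ) : (tBox z r).ncard ≤ (2 * r + 1) ^ 2 := by
  have := Set.ncard_le_ncard_of_injOn (s := tBox z r)
    (t := (Finset.Icc (z.1 - r) (z.1 + r) ×ˢ Finset.Icc (z.2 - r) (z.2 + r) : Finset (ℤ × ℤ)))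
    tilt ?_ tilt_injective.injOn (Finset.finite_toSet _)
  · rw [Set.ncard_coe_finset, Finset.card_product, Int.card_Icc, Int.card_Icc] at this
    refine this.trans (le_of_eq ?_)
    rw [sq]; congr 1 <;> omega
  · intro n hn
    rw [mem_tBox, InBox.iff] at hn
    simp only [Finset.coe_product, Finset.coe_Icc, Set.mem_prod, Set.mem_Icc]
    exact hn

lemma le_ncard_tBox (n : ℤ × ℤ) (r : ℕ) : r ^ 2 ≤ (tBox (tilt n) r).ncard := by
  have := Set.ncard_le_ncard (t := tBox (tilt n) r)
    (s := (Finset.Icc (n.1 - (r / 2 : ℕ)) (n.1 + (r / 2 : ℕ)) ×ˢ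
      Finset.Icc (n.2 - (r / 2 : ℕ)) (n.2 + (r / 2 : ℕ)) : Finset (ℤ × ℤ))) ?_ (finite_tBox _ _)
  · rw [Set.ncard_coe_finset, Finset.card_product, Int.card_Icc, Int.card_Icc] at this
    refine le_trans ?_ this
    rw [sq]
    exact Nat.mul_le_mul (by omega) (by omega)
  · intro y hy
    simp only [Finset.coe_product, Finset.coe_Icc, Set.mem_prod, Set.mem_Icc] at hy
    rw [mem_tBox, InBox.iff]
    simp only [tilt]
    omega

/-- A family of tilted squares in which `F` is not sparse has few centres. -/
lemma card_centres_le {η : ℝ} {F Q : Set (ℤ × ℤ)} (hreg : RegularIn η F Q)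
    (Z : Finset (ℤ × ℤ)) (R : ℤ × ℤ → ℕ) (hR : ∀ n ∈ Z, 1 ≤ R n)
    (hQ : ∀ n ∈ Z, tBox (tilt n) (R n) ⊆ Q)
    (hns : ∀ n ∈ Z, ¬ SparseIn η F (tBox (tilt n) (R n))) :
    (Z.card : ℝ) ≤ 49 * (η * Q.ncard) := by
  obtain ⟨u, huZ, hdisj, hcov⟩ := Vitali.exists_disjoint_subfamily_covering_enlargement
    (fun n => tBox (tilt n) (R n)) (Z : Set (ℤ × ℤ)) (fun n => (R n : ℝ)) 2 (by norm_num)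
    (fun n _ => Nat.cast_nonneg _) (∑ n ∈ Z, (R n : ℝ))
    (fun n hn => Finset.single_le_sum (f := fun n => (R n : ℝ)) (fun _ _ => Nat.cast_nonneg _) hn)
    (fun n _ => ⟨n, by rw [mem_tBox]; simp [InBox]⟩)
  lift u to Finset (ℤ × ℤ) using Z.finite_toSet.subset huZ
  have hsub : Z ⊆ u.biUnion fun b => (finite_tBox (tilt b) (3 * R b)).toFinset := by
    intro n hn
    obtain ⟨b, hb, ⟨y, hy1, hy2⟩, hle⟩ := hcov n hn
    have hle' : R n ≤ 2 * R b := by exact_mod_cast hle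
    refine Finset.mem_biUnion.2 ⟨b, hb, ?_⟩
    rw [Set.Finite.mem_toFinset, mem_tBox, InBox.iff]
    rw [mem_tBox, InBox.iff] at hy1 hy2
    push_cast
    omega
  have h1 : Z.card ≤ ∑ b ∈ u, 49 * (tBox (tilt b) (R b)).ncard := by
    refine (Finset.card_le_card hsub).trans (Finset.card_biUnion_le.trans ?_)
    refine Finset.sum_le_sum fun b hb => ?_
    rw [← Set.ncard_eq_toFinset_card _ (finite_tBox _ _)]
    refine (ncard_tBox_le _ _).trans ?_
    have := hR b (huZ hb)
    refine le_trans ?_ (Nat.mul_le_mul_left 49 (le_ncard_tBox b (R b)))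
    nlinarith
  have h2 := hreg u.card (fun i => tBox (tilt (u.equivFin.symm i)) (R (u.equivFin.symm i)))
    (fun i => isTiltedSquare_tBox _ _) (fun i => hQ _ (huZ (u.equivFin.symm i).2))
    (fun i j hij => hdisj (u.equivFin.symm i).2 (u.equivFin.symm j).2
      fun h => hij (u.equivFin.symm.injective (Subtype.ext h)))
    (fun i => hns _ (huZ (u.equivFin.symm i).2))
  have h3 : (⋃ i : Fin u.card, tBox (tilt (u.equivFin.symm i)) (R (u.equivFin.symm i)))
      = ((u.biUnion fun b => (finite_tBox (tilt b) (R b)).toFinset : Finset (ℤ × ℤ)) :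
        Set (ℤ × ℤ)) := by
    ext y
    simp only [Set.mem_iUnion, Finset.coe_biUnion, Set.Finite.coe_toFinset, Finset.mem_coe]
    constructor
    · rintro ⟨i, hi⟩
      exact ⟨_, (u.equivFin.symm i).2, hi⟩
    · rintro ⟨b, hb, hy⟩
      exact ⟨u.equivFin ⟨b, hb⟩, by simpa using hy⟩
  rw [h3, Set.ncard_coe_finset, Finset.card_biUnion] at h2
  · have h4 : ∑ b ∈ u, (finite_tBox (tilt b) (R b)).toFinset.card
        = ∑ b ∈ u, (tBox (tilt b) (R b)).ncard :=
      Finset.sum_congr rfl fun b _ => (Set.ncard_eq_toFinset_card _ (finite_tBox _ _)).symm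
    rw [h4] at h2
    rw [← Finset.mul_sum] at h1
    have h1' : (Z.card : ℝ) ≤ 49 * (∑ b ∈ u, (tBox (tilt b) (R b)).ncard : ℕ) := by
      exact_mod_cast h1
    linarith
  · intro i hi j hj hij
    have := hdisj hi hj hij
    simp only [Function.onFun] at this ⊢
    rw [← Finset.disjoint_coe]
    simpa using this

/-- Few centres see many exceptional sites. -/
lemma card_heavy_le (Z Bn : Finset (ℤ × ℤ)) (r : ℕ) (T : ℝ) (hT : 0 < T) :
    ((Z.filter fun n => T ≤ ((Bn.filter fun y => y ∈ tBox (tilt n) r).card : ℝ)).card : ℝ) ≤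
      Bn.card * (2 * r + 1) ^ 2 / T := by
  rw [le_div_iff₀ hT]
  set Z' := Z.filter fun n => T ≤ ((Bn.filter fun y => y ∈ tBox (tilt n) r).card : ℝ)
  have h1 : (Z'.card : ℝ) * T ≤ ∑ n ∈ Z', ((Bn.filter fun y => y ∈ tBox (tilt n) r).card : ℝ) := by
    rw [← nsmul_eq_mul]
    exact Finset.card_nsmul_le_sum _ _ _ fun n hn => (Finset.mem_filter.1 hn).2
  have h2 := Finset.sum_card_bipartiteAbove_eq_sum_card_bipartiteBelow (s := Z') (t := Bn)
    fun n y => y ∈ tBox (tilt n) r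
  have h3 : ∑ y ∈ Bn, (Finset.bipartiteBelow (fun n y => y ∈ tBox (tilt n) r) Z' y).card ≤
      ∑ _y ∈ Bn, (2 * r + 1) ^ 2 := by
    refine Finset.sum_le_sum fun y _ => ?_
    refine le_trans ?_ (ncard_tBox_le (tilt y) r)
    rw [← Set.ncard_coe_finset]
    refine Set.ncard_le_ncard ?_ (finite_tBox _ _)
    intro n hn
    simp only [Finset.bipartiteBelow, Finset.coe_filter, Set.mem_ofPred_eq, mem_tBox,
      InBox.iff] at hn ⊢
    omega
  rw [Finset.sum_const, smul_eq_mul] at h3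
  refine h1.trans ?_
  rw [← h2] at h3
  have h4 : ((∑ n ∈ Z', (Finset.bipartiteAbove (fun n y => y ∈ tBox (tilt n) r) Bn n).card : ℕ) : ℝ)
      ≤ ((Bn.card * (2 * r + 1) ^ 2 : ℕ) : ℝ) := by exact_mod_cast h3
  push_cast at h4
  refine le_trans (le_of_eq ?_) h4
  refine Finset.sum_congr rfl fun n _ => ?_
  congr 2

lemma badLim_pos {ρ : ℝ} (hρ : 0 < ρ) {D h : ℕ} (hD : 1 ≤ D) : 0 < badLim ρ D h := by
  unfold badLim
  split_ifs with hh
  · norm_num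
  · have h1 : 4 * D ≤ Nat.sqrt h := by
      rw [Nat.le_sqrt]; nlinarith
    have h2 : 1 ≤ Nat.sqrt h / (2 * D) := by
      rw [Nat.le_div_iff_mul_le (by omega)]; omega
    have h3 : 0 < h := by nlinarith
    have h2' : (1 : ℝ) ≤ (Nat.sqrt h / (2 * D) : ℕ) := by exact_mod_cast h2
    have h3' : (0 : ℝ) < h := by exact_mod_cast h3
    positivity

theorem box_chain {ψ V : ℤ × ℤ → ℝ} {lam Ebar A Θ γ κ ρ c₀ : ℝ} {F S : Set (ℤ × ℤ)}
    {n : ℤ × ℤ} {D amax J : ℕ} {Bn : Finset (ℤ × ℤ)} (hJ : 1 ≤ J) (hD : 1 ≤ D)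
    (hE : EigOn V lam ψ S) (hS : ∀ y ∈ tBox (tilt n) (4 * 2 ^ J), y ∈ S)
    (hV : ∀ n ∈ S, |4 + V n - lam| ≤ A) (hV' : ∀ n ∈ S, |4 + V n - Ebar| ≤ A)
    (hA : 0 ≤ A) (hγ : 0 < γ) (hγ1 : γ ≤ 1) (hlam : |lam - Ebar| ≤ κ)
    (hΘ : 64 * 2 ^ J * (A + 2) ≤ Θ) (hΘγ : 128 / γ ≤ Θ)
    (hκ : ∀ b, b ≤ Nat.sqrt (2 ^ J) → 4 * 2 ^ J * (κ * (2 * Θ ^ (b + 1))) ≤ hopMesh b Θ γ)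
    (hρ : 0 < ρ) (hρ1 : ρ ≤ 1) (hc₀ : 0 ≤ c₀) (hc₀ρ : c₀ ≤ ρ / 100)
    (hgood : HopAll (tiltC V Ebar) F S D amax ρ Θ γ) (hamax : 4 * 2 ^ J ≤ amax)
    (hsp : ∀ j, 1 ≤ j → j ≤ J → SparseIn c₀ F (tBox (tilt n) (4 * 2 ^ j)))
    (hBn : ∀ y ∈ tBox (tilt n) (4 * 2 ^ J), y ∉ F → 1 < |ψ y| → y ∈ Bn)
    (hcard : ∀ j, 1 ≤ j → j ≤ J →
      ((Bn.filter fun y => y ∈ tBox (tilt n) (4 * 2 ^ j)).card : ℝ) < badLim ρ D (2 ^ j)) :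
    ∀ x, InBox (tilt n) (2 ^ (J + 1)) x → |tiltU ψ x| ≤ Θ ^ (48 * 2 ^ J) := by
  have hκ0 : 0 ≤ κ := (abs_nonneg _).trans hlam
  have h2J : (1 : ℝ) ≤ 2 ^ J := one_le_pow₀ (by norm_num)
  have hΘ1 : 1 ≤ Θ := by nlinarith
  have hmono : ∀ j ≤ J, ∀ y ∈ tBox (tilt n) (4 * 2 ^ j), y ∈ tBox (tilt n) (4 * 2 ^ J) := by
    intro j hj y hy
    have h2 : (2 : ℕ) ^ j ≤ 2 ^ J := Nat.pow_le_pow_right (by norm_num) hj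
    rw [mem_tBox, InBox.iff] at hy ⊢
    zify at h2
    push_cast at hy ⊢
    omega
  have key : ∀ j ≤ J, ∀ x, InBox (tilt n) (2 ^ (j + 1)) x → |tiltU ψ x| ≤ Θ ^ (48 * 2 ^ j) := by
    intro j
    induction j with
    | zero =>
      intro _ x hx
      refine le_trans ?_ (one_le_pow₀ hΘ1)
      by_cases hpar : (x.1 + x.2) % 2 = 0
      · have hmem : untilt x ∈ tBox (tilt n) (4 * 2 ^ 1) := by
          rw [mem_tBox, tilt_untilt hpar, InBox.iff]
          rw [InBox.iff] at hx
          push_cast at hx ⊢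
          omega
        rw [tiltU_even _ hpar]
        by_contra hcon
        rw [not_le] at hcon
        have hnF : untilt x ∉ F := by
          intro hF
          have h1 := (hsp 1 le_rfl hJ ((untilt x).1 + (untilt x).2)).1
          have h2 := (ncard_tBox_line (tilt n) (4 * 2 ^ 1) ((untilt x).1 + (untilt x).2)).1
          have h3 : 1 ≤ (F ∩ tBox (tilt n) (4 * 2 ^ 1) ∩
              {y | y.1 + y.2 = (untilt x).1 + (untilt x).2}).ncard := by
            refine (Set.ncard_pos (((finite_tBox _ _).inter_of_right F).inter_of_left _)).2 ?_
            exact ⟨untilt x, ⟨hF, hmem⟩, rfl⟩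
          have h2' : ((tBox (tilt n) (4 * 2 ^ 1) ∩
              {y | y.1 + y.2 = (untilt x).1 + (untilt x).2}).ncard : ℝ) ≤ 9 := by
            exact_mod_cast h2
          have h3' : (1 : ℝ) ≤ (F ∩ tBox (tilt n) (4 * 2 ^ 1) ∩
              {y | y.1 + y.2 = (untilt x).1 + (untilt x).2}).ncard := by exact_mod_cast h3
          have := mul_le_mul_of_nonneg_left h2' hc₀
          linarith
        have hB := hBn _ (hmono 1 hJ _ hmem) hnF hcon
        have hc := hcard 1 le_rfl hJ
        have hD2 : 1 ≤ D ^ 2 := Nat.one_le_pow _ _ hD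
        rw [badLim, if_pos (by omega)] at hc
        have h0 : (Bn.filter fun y => y ∈ tBox (tilt n) (4 * 2 ^ 1)).card < 1 := by
          exact_mod_cast hc
        have : 0 < (Bn.filter fun y => y ∈ tBox (tilt n) (4 * 2 ^ 1)).card :=
          Finset.card_pos.2 ⟨_, Finset.mem_filter.2 ⟨hB, hmem⟩⟩
        omega
      · rw [tiltU_odd _ _ hpar, abs_zero]; norm_num
    | succ j ih =>
      intro hj x hx
      have hp : (2 : ℝ) ^ (j + 1) ≤ 2 ^ J := pow_le_pow_right₀ (by norm_num) hj
      have hpN : 2 ^ (j + 1) ≤ 2 ^ J := Nat.pow_le_pow_right (by norm_num) hj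
      have h := box_step (h := 2 ^ (j + 1)) (amax := amax) (B := Θ ^ (48 * 2 ^ j))
        (Bn := Bn.filter fun y => y ∈ tBox (tilt n) (4 * 2 ^ (j + 1))) (tilt_even n)
        (by rw [pow_succ]; have := Nat.one_le_two_pow (n := j); omega)
        (by rw [pow_succ]; omega) hD hE (fun y hy => hS y (hmono _ hj y hy)) hV hV' hA hγ hγ1
        hlam (by push_cast; nlinarith) hΘγ
        (fun b hb => by
          push_cast
          refine le_trans ?_ (hκ b (hb.trans (Nat.sqrt_le_sqrt hpN)))
          gcongr) hρ hρ1 hc₀ hc₀ρ hgood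
        (by omega) (hsp _ (by omega) hj)
        (fun y hy hF h1 => Finset.mem_filter.2 ⟨hBn y (hmono _ hj y hy) hF h1, hy⟩)
        (hcard _ (by omega) hj) (one_le_pow₀ hΘ1) (ih (by omega)) x
        (by rwa [show 2 * 2 ^ (j + 1) = 2 ^ (j + 1 + 1) by ring])
      refine h.trans ?_
      rw [← pow_add]
      exact pow_le_pow_right₀ hΘ1 (by rw [pow_succ]; omega)
  exact key J le_rfl

/-- Smallness at the centre of a square where `F` is regular and few sites are exceptional. -/
theorem centre_small {ψ V : ℤ × ℤ → ℝ} {lam Ebar A Θ γ κ ρ c₀ η : ℝ} {F S : Set (ℤ × ℤ)}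
    {a b : ℤ} {D amax J : ℕ} {Bn : Finset (ℤ × ℤ)} (hJ : 1 ≤ J) (hD : 1 ≤ D)
    (hE : EigOn V lam ψ S) (hS : ∀ y ∈ sqZ a b (2 ^ (J + 4)), y ∈ S)
    (hV : ∀ n ∈ S, |4 + V n - lam| ≤ A) (hV' : ∀ n ∈ S, |4 + V n - Ebar| ≤ A)
    (hA : 0 ≤ A) (hγ : 0 < γ) (hγ1 : γ ≤ 1) (hlam : |lam - Ebar| ≤ κ)
    (hΘ : 64 * 2 ^ J * (A + 2) ≤ Θ) (hΘγ : 128 / γ ≤ Θ)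
    (hκ : ∀ b, b ≤ Nat.sqrt (2 ^ J) → 4 * 2 ^ J * (κ * (2 * Θ ^ (b + 1))) ≤ hopMesh b Θ γ)
    (hρ : 0 < ρ) (hρ1 : ρ ≤ 1) (hc₀ρ : c₀ ≤ ρ / 100) (hη : 0 ≤ η) (hηc : η ≤ c₀)
    (hgood : HopAll (tiltC V Ebar) F S D amax ρ Θ γ) (hamax : 4 * 2 ^ J ≤ amax)
    (hreg : RegularIn η F (sqZ a b (2 ^ (J + 4)) : Set (ℤ × ℤ)))
    (hBn : ∀ y ∈ sqZ a b (2 ^ (J + 4)), y ∉ F → 1 < |ψ y| → y ∈ Bn)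
    (hcount : ∑ j ∈ Finset.Icc 1 J, Bn.card * (2 * (4 * 2 ^ j : ℕ) + 1) ^ 2 / badLim ρ D (2 ^ j)
      + 49 * (η * 2 ^ (2 * J + 8)) < (2 : ℝ) ^ (2 * J)) :
    |ψ (a + 2 ^ (J + 3), b + 2 ^ (J + 3))| ≤ Θ ^ (48 * 2 ^ J) := by
  obtain ⟨i, rfl⟩ : ∃ i, J = i + 1 := ⟨J - 1, by omega⟩
  set n₀ : ℤ × ℤ := (a + 2 ^ (i + 1 + 3), b + 2 ^ (i + 1 + 3)) with hn₀
  set Z : Finset (ℤ × ℤ) := Finset.Icc (n₀.1 - 2 ^ i) (n₀.1 + 2 ^ i) ×ˢ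
    Finset.Icc (n₀.2 - 2 ^ i) (n₀.2 + 2 ^ i) with hZ
  have hZcard : 2 ^ (2 * (i + 1)) ≤ Z.card := by
    rw [hZ, Finset.card_product, Int.card_Icc, Int.card_Icc, two_mul, pow_add]
    have e : (2 : ℤ) ^ i = ((2 ^ i : ℕ) : ℤ) := by push_cast; rfl
    rw [e]
    refine Nat.mul_le_mul ?_ ?_ <;> rw [pow_succ] <;> omega
  have hZmem : ∀ n ∈ Z, ∀ y ∈ tBox (tilt n) (4 * 2 ^ (i + 1)), y ∈ sqZ a b (2 ^ (i + 1 + 4)) := by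
    intro n hn y hy
    simp only [hZ, Finset.mem_product, Finset.mem_Icc, hn₀] at hn
    rw [mem_tBox, InBox.iff] at hy
    simp only [tilt] at hy
    simp only [sqZ, Finset.mem_product, Finset.mem_Icc]
    have hp : (1 : ℤ) ≤ 2 ^ i := one_le_pow₀ (by norm_num)
    push_cast at hy ⊢
    rw [show i + 1 + 4 = i + 5 by ring, show (2 : ℤ) ^ (i + 5) = 32 * 2 ^ i by ring]
    rw [show (2 : ℤ) ^ (i + 1 + 3) = 16 * 2 ^ i by ring] at hn
    rw [show (2 : ℤ) ^ (i + 1) = 2 * 2 ^ i by ring] at hy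
    omega
  have hmono : ∀ j ≤ i + 1, ∀ n, tBox (tilt n) (4 * 2 ^ j) ⊆ tBox (tilt n) (4 * 2 ^ (i + 1)) := by
    intro j hj n y hy
    have h2 : (2 : ℕ) ^ j ≤ 2 ^ (i + 1) := Nat.pow_le_pow_right (by norm_num) hj
    rw [mem_tBox, InBox.iff] at hy ⊢
    zify at h2
    push_cast at hy ⊢
    omega
  set Z₁ := Z.filter fun n => ∃ j, (1 ≤ j ∧ j ≤ i + 1) ∧
    ¬ SparseIn η F (tBox (tilt n) (4 * 2 ^ j)) with hZ₁
  set Z₂ := (Finset.Icc 1 (i + 1)).biUnion fun j => Z.filter fun n => badLim ρ D (2 ^ j) ≤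
    ((Bn.filter fun y => y ∈ tBox (tilt n) (4 * 2 ^ j)).card : ℝ) with hZ₂
  have hc1 : (Z₁.card : ℝ) ≤ 49 * (η * 2 ^ (2 * (i + 1) + 8)) := by
    have hch : ∀ n ∈ Z₁, ∃ j, (1 ≤ j ∧ j ≤ i + 1) ∧
        ¬ SparseIn η F (tBox (tilt n) (4 * 2 ^ j)) := fun n hn => (Finset.mem_filter.1 hn).2
    choose! j hj hns using hch
    have := card_centres_le hreg Z₁ (fun n => 4 * 2 ^ j n)
      (fun n _ => by have := Nat.one_le_two_pow (n := j n); omega)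
      (fun n hn y hy => hZmem n (Finset.mem_filter.1 hn).1 y (hmono _ (hj n hn).2 n hy)) hns
    refine this.trans (le_of_eq ?_)
    rw [Set.ncard_coe_finset, sqZ, Finset.card_product, Int.card_Icc, Int.card_Icc]
    have e1 : (a + (2 ^ (i + 1 + 4) : ℕ) - 1 + 1 - a).toNat = 2 ^ (i + 1 + 4) := by
      rw [sub_add_cancel, add_sub_cancel_left, Int.toNat_natCast]
    have e2 : (b + (2 ^ (i + 1 + 4) : ℕ) - 1 + 1 - b).toNat = 2 ^ (i + 1 + 4) := by
      rw [sub_add_cancel, add_sub_cancel_left, Int.toNat_natCast]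
    rw [e1, e2]; push_cast; ring
  have hc2 : (Z₂.card : ℝ) ≤ ∑ j ∈ Finset.Icc 1 (i + 1),
      Bn.card * (2 * (4 * 2 ^ j : ℕ) + 1) ^ 2 / badLim ρ D (2 ^ j) := by
    have h1 : (Z₂.card : ℝ) ≤ ((∑ j ∈ Finset.Icc 1 (i + 1), (Z.filter fun n =>
        badLim ρ D (2 ^ j) ≤ ((Bn.filter fun y => y ∈ tBox (tilt n) (4 * 2 ^ j)).card : ℝ)).card :
        ℕ) : ℝ) := by exact_mod_cast Finset.card_biUnion_le
    refine h1.trans ?_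
    push_cast
    refine Finset.sum_le_sum fun j _ => ?_
    have := card_heavy_le Z Bn (4 * 2 ^ j) (badLim ρ D (2 ^ j)) (badLim_pos hρ hD)
    push_cast at this
    exact this
  have hlt : (Z₁ ∪ Z₂).card < Z.card := by
    have h1 : ((Z₁ ∪ Z₂).card : ℝ) ≤ Z₁.card + Z₂.card := by exact_mod_cast Finset.card_union_le _ _
    have h2 : ((2 ^ (2 * (i + 1)) : ℕ) : ℝ) ≤ Z.card := by exact_mod_cast hZcard
    push_cast at h2
    have : ((Z₁ ∪ Z₂).card : ℝ) < Z.card := by linarith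
    exact_mod_cast this
  obtain ⟨n, hnZ, hn⟩ : ∃ n ∈ Z, n ∉ Z₁ ∪ Z₂ := by
    by_contra! hcon
    exact absurd (Finset.card_le_card hcon) (not_le.2 hlt)
  rw [Finset.mem_union, not_or] at hn
  have hchain := box_chain (n := n) (c₀ := c₀) (Bn := Bn) hJ hD hE
    (fun y hy => hS y (hZmem n hnZ y hy)) hV hV' hA hγ hγ1 hlam hΘ hΘγ hκ hρ hρ1
    (hη.trans hηc) hc₀ρ hgood hamax
    (fun j hj1 hj2 => by
      by_contra hcon
      exact hn.1 (Finset.mem_filter.2 ⟨hnZ, j, ⟨hj1, hj2⟩, fun h => hcon (h.mono hηc)⟩))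
    (fun y hy => hBn y (hZmem n hnZ y hy))
    (fun j hj1 hj2 => by
      by_contra hcon
      exact hn.2 (Finset.mem_biUnion.2 ⟨j, Finset.mem_Icc.2 ⟨hj1, hj2⟩,
        Finset.mem_filter.2 ⟨hnZ, not_lt.1 hcon⟩⟩))
    (tilt n₀) ?_
  · rwa [tiltU_tilt] at hchain
  · simp only [hZ, Finset.mem_product, Finset.mem_Icc] at hnZ
    rw [InBox.iff]
    simp only [tilt]
    push_cast
    rw [show (2 : ℤ) ^ (i + 1 + 1) = 4 * 2 ^ i by ring]
    have hp : (1 : ℤ) ≤ 2 ^ i := one_le_pow₀ (by norm_num)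
    omega

lemma exists_free_strip {K L : ℕ} (hL : 1 ≤ L) (Λ' : Fin K → Finset (ℤ × ℤ))
    (hΛ' : ∀ k, ∃ a' b' : ℤ, Λ' k = sqZ a' b' L) (x₁ : ℤ) :
    ∃ i : ℕ, i ≤ K ∧ ∀ k, ∀ n ∈ Λ' k, ¬ (x₁ + 8 * L * i ≤ n.1 ∧ n.1 < x₁ + 8 * L * i + 4 * L) := by
  by_contra! hcon
  have hch : ∀ i : Fin (K + 1), ∃ k : Fin K, ∃ n ∈ Λ' k,
      x₁ + 8 * L * (i : ℕ) ≤ n.1 ∧ n.1 < x₁ + 8 * L * (i : ℕ) + 4 * L := fun i =>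
    hcon i (by omega)
  choose k n hn hlo hhi using hch
  have hinj : Function.Injective k := by
    intro i j hij
    obtain ⟨a', b', hk⟩ := hΛ' (k i)
    have h1 := hn i
    have h2 := hn j
    rw [← hij] at h2
    rw [hk] at h1 h2
    simp only [sqZ, Finset.mem_product, Finset.mem_Icc] at h1 h2
    have h3 := hlo i
    have h4 := hhi i
    have h5 := hlo j
    have h6 := hhi j
    have hL' : (1 : ℤ) ≤ L := by exact_mod_cast hL
    rcases lt_trichotomy (i : ℕ) (j : ℕ) with h | h | h
    · have h7 : ((i : ℕ) : ℤ) + 1 ≤ (j : ℕ) := by exact_mod_cast h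
      have h8 := mul_le_mul_of_nonneg_left h7 (show (0 : ℤ) ≤ 8 * L by omega)
      rw [mul_add] at h8
      omega
    · exact Fin.ext h
    · have h7 : ((j : ℕ) : ℤ) + 1 ≤ (i : ℕ) := by exact_mod_cast h
      have h8 := mul_le_mul_of_nonneg_left h7 (show (0 : ℤ) ≤ 8 * L by omega)
      rw [mul_add] at h8
      omega
  have := Fintype.card_le_of_injective k hinj
  simp at this

lemma abs_next_le {A m c u v₁ v₂ v₃ w : ℝ} (h : c * u - v₁ - v₂ - v₃ - w = 0) (hc : |c| ≤ A)
    (hu : |u| ≤ m) (h1 : |v₁| ≤ m) (h2 : |v₂| ≤ m) (h3 : |v₃| ≤ m) : |w| ≤ (A + 3) * m := by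
  have hw : w = c * u - v₁ - v₂ - v₃ := by linarith
  rw [hw]
  have hcu : |c * u| ≤ A * m := by
    rw [abs_mul]
    exact mul_le_mul hc hu (abs_nonneg _) ((abs_nonneg _).trans hc)
  calc |c * u - v₁ - v₂ - v₃| ≤ |c * u| + |v₁| + |v₂| + |v₃| := by
        refine (abs_sub _ _).trans ?_
        gcongr
        refine (abs_sub _ _).trans ?_
        gcongr
        exact abs_sub _ _
    _ ≤ (A + 3) * m := by linarith

/-- Descending (`s = -1`) or ascending (`s = 1`) from two rows of width `r - l`. -/
lemma cone_bound {ψ V : ℤ × ℤ → ℝ} {lam A X : ℝ} {S : Set (ℤ × ℤ)} (hE : EigOn V lam ψ S)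
    (hV : ∀ n ∈ S, |4 + V n - lam| ≤ A) (hA : 0 ≤ A) (hX : 0 ≤ X) {s : ℤ} (hs : s = 1 ∨ s = -1)
    {l r y : ℤ} {N : ℕ}
    (hS : ∀ j : ℕ, j ≤ N → ∀ x, l ≤ x → x ≤ r → (x, y + s * j) ∈ S)
    (h0 : ∀ x, l ≤ x → x ≤ r → |ψ (x, y)| ≤ X)
    (h1 : ∀ x, l ≤ x → x ≤ r → |ψ (x, y - s)| ≤ X) :
    ∀ j : ℕ, j ≤ N → ∀ x, l + j ≤ x → x ≤ r - j →
      |ψ (x, y + s * j)| ≤ X * (A + 3) ^ j ∧ |ψ (x, y + s * j - s)| ≤ X * (A + 3) ^ j := by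
  intro j
  induction j with
  | zero =>
    intro _ x hx1 hx2
    simp only [Nat.cast_zero, mul_zero, add_zero, pow_zero, mul_one]
    exact ⟨h0 x (by omega) (by omega), h1 x (by omega) (by omega)⟩
  | succ j ih =>
    intro hj x hx1 hx2
    push_cast at hx1 hx2
    have hG : (1 : ℝ) ≤ A + 3 := by linarith
    have hm : 0 ≤ X * (A + 3) ^ j := by positivity
    obtain ⟨i1, i2⟩ := ih (by omega) x (by omega) (by omega)
    obtain ⟨i3, -⟩ := ih (by omega) (x + 1) (by omega) (by omega)
    obtain ⟨i4, -⟩ := ih (by omega) (x - 1) (by omega) (by omega)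
    have hmem := hS j (by omega) x (by omega) (by omega)
    have heq := hE _ hmem
    simp only at heq
    constructor
    · have e : X * (A + 3) ^ (j + 1) = (A + 3) * (X * (A + 3) ^ j) := by ring
      rw [e]
      rcases hs with rfl | rfl
      · refine abs_next_le (c := 4 + V (x, y + 1 * j) - lam) (u := ψ (x, y + 1 * j)) ?_
          (hV _ hmem) i1 i3 i4 i2
        have e2 : y + 1 * (j : ℤ) + 1 = y + 1 * ((j + 1 : ℕ) : ℤ) := by push_cast; ring
        rw [e2] at heq
        linarith
      · refine abs_next_le (c := 4 + V (x, y + -1 * j) - lam) (u := ψ (x, y + -1 * j)) ?_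
          (hV _ hmem) i1 i3 i4 i2
        have e2 : y + -1 * (j : ℤ) - 1 = y + -1 * ((j + 1 : ℕ) : ℤ) := by push_cast; ring
        have e3 : y + -1 * (j : ℤ) - -1 = y + -1 * (j : ℤ) + 1 := by ring
        rw [e2] at heq
        rw [e3]
        linarith
    · have e : y + s * ((j + 1 : ℕ) : ℤ) - s = y + s * j := by push_cast; ring
      rw [e]
      refine i1.trans ?_
      rw [pow_succ]
      nlinarith

/-- Propagation of full columns of a square, in the direction `s`. -/
lemma column_bound {ψ V : ℤ × ℤ → ℝ} {lam A X : ℝ} {a b : ℤ} {L₀ : ℕ}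
    (hE : EigOn V lam ψ (sqZ a b L₀)) (h0 : ∀ n, n ∉ sqZ a b L₀ → ψ n = 0)
    (hV : ∀ n ∈ sqZ a b L₀, |4 + V n - lam| ≤ A) (hA : 0 ≤ A) (hX : 0 ≤ X) {s : ℤ}
    (hs : s = 1 ∨ s = -1) {c : ℤ} (hc : ∀ y, |ψ (c, y)| ≤ X) (hc' : ∀ y, |ψ (c - s, y)| ≤ X)
    (N : ℕ) (hN : ∀ j : ℕ, j < N → a ≤ c + s * j ∧ c + s * j < a + L₀) :
    ∀ y, |ψ (c + s * N, y)| ≤ X * (A + 3) ^ N := by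
  have key : ∀ j : ℕ, j ≤ N → ∀ y, |ψ (c + s * j, y)| ≤ X * (A + 3) ^ j ∧
      |ψ (c + s * j - s, y)| ≤ X * (A + 3) ^ j := by
    intro j
    induction j with
    | zero => intro _ y; simpa using ⟨hc y, hc' y⟩
    | succ j ih =>
      intro hj y
      have hm : 0 ≤ X * (A + 3) ^ j := by positivity
      have hG : (1 : ℝ) ≤ A + 3 := by linarith
      have ih := fun y => ih (by omega) y
      have hr := hN j (by omega)
      constructor
      · by_cases hy : b ≤ y ∧ y < b + L₀
        · have hmem : (c + s * j, y) ∈ sqZ a b L₀ := by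
            simp only [sqZ, Finset.mem_product, Finset.mem_Icc]; omega
          have heq := hE _ (Finset.mem_coe.2 hmem)
          simp only at heq
          have e : X * (A + 3) ^ (j + 1) = (A + 3) * (X * (A + 3) ^ j) := by ring
          rw [e]
          refine abs_next_le (c := 4 + V (c + s * j, y) - lam) (u := ψ (c + s * j, y)) ?_
            (hV _ hmem) (ih y).1 (ih (y + 1)).1 (ih (y - 1)).1 (ih y).2
          rcases hs with rfl | rfl
          · have e2 : c + 1 * (j : ℤ) + 1 = c + 1 * ((j + 1 : ℕ) : ℤ) := by push_cast; ring
            rw [e2] at heq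
            linarith
          · have e2 : c + -1 * (j : ℤ) - 1 = c + -1 * ((j + 1 : ℕ) : ℤ) := by push_cast; ring
            have e3 : c + -1 * (j : ℤ) - -1 = c + -1 * (j : ℤ) + 1 := by ring
            rw [e2] at heq
            rw [e3]
            linarith
        · rw [h0, abs_zero]
          · positivity
          · simp only [sqZ, Finset.mem_product, Finset.mem_Icc]; omega
      · have e : c + s * ((j + 1 : ℕ) : ℤ) - s = c + s * j := by push_cast; ring
        rw [e]
        refine (ih y).1.trans ?_
        rw [pow_succ]
        nlinarith
  exact fun y => (key N le_rfl y).1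

/-- An eigenfunction that is small at the centre of every defect-free square is small. -/
theorem eigenfunction_small {ψ V : ℤ × ℤ → ℝ} {lam A X : ℝ} {a b : ℤ} {L₀ K l : ℕ}
    {Λ' : Fin K → Finset (ℤ × ℤ)} (hl : 1 ≤ l)
    (hΛ' : ∀ k, ∃ a' b' : ℤ, Λ' k = sqZ a' b' (2 * l)) (hL : 16 * l * (K + 1) ≤ L₀)
    (hE : EigOn V lam ψ (sqZ a b L₀)) (h0 : ∀ n, n ∉ sqZ a b L₀ → ψ n = 0)
    (hV : ∀ n ∈ sqZ a b L₀, |4 + V n - lam| ≤ A) (hA : 0 ≤ A) (hX : 0 ≤ X)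
    (hcen : ∀ a'' b'' : ℤ, (sqZ a'' b'' (2 * l) : Set (ℤ × ℤ)) ⊆
      (sqZ a b L₀ : Set (ℤ × ℤ)) \ (⋃ k, (Λ' k : Set (ℤ × ℤ))) →
      |ψ (a'' + l, b'' + l)| ≤ X) (g : ℤ × ℤ) :
    |ψ g| ≤ X * (A + 3) ^ (17 * l * (K + 1)) := by
  have hG : (1 : ℝ) ≤ A + 3 := by linarith
  by_cases hg : g ∈ sqZ a b L₀
  swap
  · rw [h0 g hg, abs_zero]; positivity
  simp only [sqZ, Finset.mem_product, Finset.mem_Icc] at hg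
  set x₁ : ℤ := min g.1 (a + L₀ - 16 * l * (K + 1)) with hx₁
  obtain ⟨i, hiK, hfree⟩ := exists_free_strip (L := 2 * l) (by omega) Λ' hΛ' x₁
  set x₂ : ℤ := x₁ + 8 * (2 * l : ℕ) * i with hx₂
  have hLZ : 16 * (l : ℤ) * (K + 1) ≤ L₀ := by exact_mod_cast hL
  have hi0 : (0 : ℤ) ≤ 16 * l * i := by positivity
  have hi1 : 16 * (l : ℤ) * i ≤ 16 * l * K := by
    have : (i : ℤ) ≤ K := by exact_mod_cast hiK
    exact mul_le_mul_of_nonneg_left this (by positivity)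
  have hx₂' : x₂ = x₁ + 16 * l * i := by rw [hx₂]; push_cast; ring
  have hKe : 16 * (l : ℤ) * (K + 1) = 16 * l * K + 16 * l := by ring
  have ha1 : a ≤ x₁ := by rw [hx₁]; omega
  have ha2 : a ≤ x₂ := by omega
  have hb2 : x₂ + 8 * l ≤ a + L₀ := by omega
  have hinner : ∀ x y : ℤ, x₂ + l ≤ x → x ≤ x₂ + 7 * l → b + l ≤ y → y ≤ b + L₀ - l →
      |ψ (x, y)| ≤ X := by
    intro x y hx1 hx2 hy1 hy2
    have := hcen (x - l) (y - l) ?_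
    · simpa using this
    · intro n hn
      simp only [sqZ, Finset.mem_coe, Finset.mem_product, Finset.mem_Icc] at hn
      push_cast at hn
      refine ⟨?_, ?_⟩
      · simp only [sqZ, Finset.mem_coe, Finset.mem_product, Finset.mem_Icc]; omega
      · rw [Set.mem_iUnion]
        rintro ⟨k, hk⟩
        exact hfree k n hk ⟨by omega, by push_cast; omega⟩
  have hll : (l : ℤ) ≤ 16 * l * K + 16 * l := by
    have : (0 : ℤ) ≤ 16 * l * K := by positivity
    omega
  set X₁ := X * (A + 3) ^ l with hX₁
  have hX₁0 : 0 ≤ X₁ := by positivity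
  have hXX₁ : X ≤ X₁ := le_mul_of_one_le_right hX (one_le_pow₀ hG)
  have hpw : ∀ j : ℕ, j ≤ l → X * (A + 3) ^ j ≤ X₁ := fun j hj =>
    mul_le_mul_of_nonneg_left (pow_le_pow_right₀ hG hj) hX
  have hcols : ∀ x, x₂ + 2 * l ≤ x → x ≤ x₂ + 6 * l → ∀ y, |ψ (x, y)| ≤ X₁ := by
    intro x hx1 hx2 y
    by_cases hy : b ≤ y ∧ y < b + L₀
    swap
    · rw [h0, abs_zero]
      · positivity
      · simp only [sqZ, Finset.mem_product, Finset.mem_Icc]; omega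
    by_cases hy1 : y < b + l
    · have := cone_bound hE hV hA hX (s := -1) (Or.inr rfl) (l := x₂ + l) (r := x₂ + 7 * l)
        (y := b + l) (N := l)
        (by
          intro j hj x h1 h2
          simp only [sqZ, Finset.mem_coe, Finset.mem_product, Finset.mem_Icc]; omega)
        (fun x h1 h2 => hinner x _ h1 h2 le_rfl (by omega))
        (fun x h1 h2 => hinner x _ h1 h2 (by omega) (by omega))
        (b + l - y).toNat (by omega) x (by omega) (by omega)
      have e : b + l + -1 * ((b + l - y).toNat : ℤ) = y := by omega
      rw [e] at this
      exact this.1.trans (hpw _ (by omega))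
    by_cases hy2 : b + L₀ - l < y
    · have := cone_bound hE hV hA hX (s := 1) (Or.inl rfl) (l := x₂ + l) (r := x₂ + 7 * l)
        (y := b + L₀ - l) (N := l - 1)
        (by
          intro j hj x h1 h2
          simp only [sqZ, Finset.mem_coe, Finset.mem_product, Finset.mem_Icc]; omega)
        (fun x h1 h2 => hinner x _ h1 h2 (by omega) le_rfl)
        (fun x h1 h2 => hinner x _ h1 h2 (by omega) (by omega))
        (y - (b + L₀ - l)).toNat (by omega) x (by omega) (by omega)
      have e : b + L₀ - l + 1 * ((y - (b + L₀ - l)).toNat : ℤ) = y := by omega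
      rw [e] at this
      exact this.1.trans (hpw _ (by omega))
    · exact (hinner x y (by omega) (by omega) (by omega) (by omega)).trans hXX₁
  have hfin : ∀ N : ℕ, N ≤ 16 * l * (K + 1) → X₁ * (A + 3) ^ N ≤
      X * (A + 3) ^ (17 * l * (K + 1)) := by
    intro N hN
    rw [hX₁, mul_assoc, ← pow_add]
    refine mul_le_mul_of_nonneg_left (pow_le_pow_right₀ hG ?_) hX
    nlinarith
  have hNbound : |g.1 - (x₂ + 4 * l)| ≤ 16 * l * (K + 1) := by
    rw [abs_le]
    rcases min_choice g.1 (a + L₀ - 16 * l * (K + 1)) with h | h <;>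
      rw [h] at hx₁ <;> omega
  obtain ⟨g1, g2⟩ := g
  simp only at hg hNbound hx₁ ⊢
  rw [abs_le] at hNbound
  have hNN : ∀ N : ℕ, (N : ℤ) ≤ 16 * l * (K + 1) → N ≤ 16 * l * (K + 1) := fun N h => by
    exact_mod_cast h
  rcases le_total (x₂ + 4 * l) g1 with hle | hle
  · have := column_bound hE h0 hV hA hX₁0 (s := 1) (Or.inl rfl) (c := x₂ + 4 * l)
      (hcols _ (by omega) (by omega)) (hcols _ (by omega) (by omega))
      (g1 - (x₂ + 4 * l)).toNat (by intro j hj; omega) g2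
    rw [show x₂ + 4 * l + 1 * ((g1 - (x₂ + 4 * l)).toNat : ℤ) = g1 by omega] at this
    exact this.trans (hfin _ (hNN _ (by omega)))
  · have := column_bound hE h0 hV hA hX₁0 (s := -1) (Or.inr rfl) (c := x₂ + 4 * l)
      (hcols _ (by omega) (by omega)) (hcols _ (by omega) (by omega))
      (x₂ + 4 * l - g1).toNat (by intro j hj; omega) g2
    rw [show x₂ + 4 * l + -1 * ((x₂ + 4 * l - g1).toNat : ℤ) = g1 by omega] at this
    exact this.trans (hfin _ (hNN _ (by omega)))

/-! ### Counting eigenvalues of symmetric matrices -/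

section Counting

variable {ι : Type*} [Fintype ι]

/-- An orthonormal basis of eigenvectors of a symmetric matrix. -/
structure EigBasis (A : Matrix ι ι ℝ) where
  /-- the eigenvectors -/
  vec : ι → ι → ℝ
  /-- the eigenvalues -/
  val : ι → ℝ
  dot : ∀ i j, vec i ⬝ᵥ vec j = if i = j then 1 else 0
  mulVec_eq : ∀ i, A.mulVec (vec i) = val i • vec i
  repr : ∀ u, ∑ i, (vec i ⬝ᵥ u) • vec i = u

/-- The eigenbasis provided by the spectral theorem. -/
def hermitianBasis {A : Matrix ι ι ℝ} (hA : A.IsHermitian) : EigBasis A where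
  vec i := (hA.eigenvectorBasis i).ofLp
  val := hA.eigenvalues
  dot i j := by
    have h := orthonormal_iff_ite.mp hA.eigenvectorBasis.orthonormal i j
    rw [← h]
    simp [EuclideanSpace.inner_eq_star_dotProduct, dotProduct_comm]
  mulVec_eq i := by simpa using hA.mulVec_eigenvectorBasis i
  repr u := by
    have h := hA.eigenvectorBasis.sum_repr (WithLp.toLp 2 u)
    have h2 := congrArg WithLp.ofLp h
    simp only [WithLp.ofLp_sum, WithLp.ofLp_smul] at h2
    refine Eq.trans (Finset.sum_congr rfl fun i _ => ?_) h2
    congr 1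
    rw [OrthonormalBasis.repr_apply_apply]
    simp [EuclideanSpace.inner_eq_star_dotProduct, dotProduct_comm]

/-- An eigenbasis of `A` is one of `-A`. -/
def EigBasis.neg {A : Matrix ι ι ℝ} (hA : EigBasis A) : EigBasis (-A) where
  vec := hA.vec
  val i := -hA.val i
  dot := hA.dot
  mulVec_eq i := by rw [Matrix.neg_mulVec, hA.mulVec_eq, neg_smul]
  repr := hA.repr

/-- The `i`-th eigenvector of an eigenbasis. -/
def specVec {A : Matrix ι ι ℝ} (hA : EigBasis A) (i : ι) : ι → ℝ := hA.vec i

/-- The vector with coordinates `c` in the eigenbasis. -/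
def specComb {A : Matrix ι ι ℝ} (hA : EigBasis A) (c : ι → ℝ) : ι → ℝ :=
  ∑ i, c i • specVec hA i

/-- The number of eigenvalues above the level `s`. -/
def numAbove {A : Matrix ι ι ℝ} (hA : EigBasis A) (s : ℝ) : ℕ :=
  (Finset.univ.filter fun i => s < hA.val i).card

lemma specVec_dot {A : Matrix ι ι ℝ} (hA : EigBasis A) (i j : ι) :
    specVec hA i ⬝ᵥ specVec hA j = if i = j then 1 else 0 := hA.dot i j

lemma mulVec_specVec {A : Matrix ι ι ℝ} (hA : EigBasis A) (i : ι) :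
    A.mulVec (specVec hA i) = hA.val i • specVec hA i := hA.mulVec_eq i

lemma sum_sq_specVec {A : Matrix ι ι ℝ} (hA : EigBasis A) (i : ι) :
    ∑ z, specVec hA i z ^ 2 = 1 := by
  have := specVec_dot hA i i
  simpa [dotProduct, sq] using this

lemma specVec_dot_comb {A : Matrix ι ι ℝ} (hA : EigBasis A) (c : ι → ℝ) (i : ι) :
    specVec hA i ⬝ᵥ specComb hA c = c i := by
  simp [specComb, dotProduct_sum, specVec_dot]

lemma specComb_dot {A : Matrix ι ι ℝ} (hA : EigBasis A) (c : ι → ℝ) :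
    specComb hA c ⬝ᵥ specComb hA c = ∑ i, c i ^ 2 := by
  conv_lhs => arg 1; unfold specComb
  simp [sum_dotProduct, specVec_dot_comb, sq]

lemma specComb_sq {A : Matrix ι ι ℝ} (hA : EigBasis A) (c : ι → ℝ) :
    ∑ z, specComb hA c z ^ 2 = ∑ i, c i ^ 2 := by
  rw [← specComb_dot hA c]
  simp [dotProduct, sq]

lemma specComb_form {A : Matrix ι ι ℝ} (hA : EigBasis A) (c : ι → ℝ) :
    specComb hA c ⬝ᵥ A.mulVec (specComb hA c) = ∑ i, hA.val i * c i ^ 2 := by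
  have h : A.mulVec (specComb hA c) = ∑ i, (c i * hA.val i) • specVec hA i := by
    simp [specComb, Matrix.mulVec_sum, Matrix.mulVec_smul, mulVec_specVec, smul_smul]
  rw [h, dotProduct_sum]
  refine Finset.sum_congr rfl fun i _ => ?_
  rw [dotProduct_smul, dotProduct_comm, specVec_dot_comb, smul_eq_mul]
  ring

lemma specComb_repr {A : Matrix ι ι ℝ} (hA : EigBasis A) (u : ι → ℝ) :
    specComb hA (fun i => specVec hA i ⬝ᵥ u) = u := hA.repr u

/-- A family of eigenvectors of `A` on whose span the form of `A'` exceeds the level `s`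
has at most as many members as `A'` has eigenvalues above `s`. -/
lemma card_le_numAbove {A A' : Matrix ι ι ℝ} (hA : EigBasis A) (hA' : EigBasis A')
    (P : Finset ι) (s : ℝ)
    (h : ∀ c : ι → ℝ, (∀ i, i ∉ P → c i = 0) → c ≠ 0 →
      s * ∑ i, c i ^ 2 < specComb hA c ⬝ᵥ A'.mulVec (specComb hA c)) :
    P.card ≤ numAbove hA' s := by
  by_contra! hlt
  let ext : (P → ℝ) →ₗ[ℝ] (ι → ℝ) :=
    { toFun := fun c i => if hi : i ∈ P then c ⟨i, hi⟩ else 0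
      map_add' := fun c d => by ext i; by_cases hi : i ∈ P <;> simp [hi]
      map_smul' := fun r c => by ext i; by_cases hi : i ∈ P <;> simp [hi] }
  let comb : (ι → ℝ) →ₗ[ℝ] (ι → ℝ) :=
    { toFun := fun c => specComb hA c
      map_add' := fun c d => by simp [specComb, add_smul, Finset.sum_add_distrib]
      map_smul' := fun r c => by simp [specComb, Finset.smul_sum, smul_smul] }
  let read : (ι → ℝ) →ₗ[ℝ] ({i // s < hA'.val i} → ℝ) :=
    { toFun := fun u i => specVec hA' i.1 ⬝ᵥ u
      map_add' := fun c d => by ext i; simp [dotProduct_add]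
      map_smul' := fun r c => by ext i; simp [dotProduct_smul] }
  have hker : LinearMap.ker (read ∘ₗ comb ∘ₗ ext) ≠ ⊥ := by
    apply LinearMap.ker_ne_bot_of_finrank_lt
    rw [Module.finrank_pi, Module.finrank_pi, Fintype.card_subtype, Fintype.card_coe]
    exact hlt
  obtain ⟨c, hc, hc0⟩ := (Submodule.ne_bot_iff _).mp hker
  have hne : ext c ≠ 0 := by
    intro h0
    apply hc0
    ext i
    have := congrFun h0 i.1
    simpa [ext] using this
  have hlt2 := h (ext c) (fun i hi => by simp [ext, hi]) hne
  set u := specComb hA (ext c) with hu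
  have hzero : ∀ i, s < hA'.val i → specVec hA' i ⬝ᵥ u = 0 := fun i hi => by
    have := congrFun (LinearMap.mem_ker.mp hc) ⟨i, hi⟩
    exact this
  have hle : u ⬝ᵥ A'.mulVec u ≤ s * (u ⬝ᵥ u) := by
    rw [← specComb_repr hA' u, specComb_form, specComb_dot, Finset.mul_sum]
    refine Finset.sum_le_sum fun i _ => ?_
    by_cases hi : s < hA'.val i
    · simp [hzero i hi]
    · exact mul_le_mul_of_nonneg_right (not_lt.mp hi) (sq_nonneg _)
  rw [hu, specComb_dot] at hle
  exact absurd hlt2 (not_lt.mpr hle)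

lemma numAbove_mono {A A' : Matrix ι ι ℝ} (hA : EigBasis A) (hA' : EigBasis A') (s : ℝ)
    (h : ∀ u : ι → ℝ, u ⬝ᵥ A.mulVec u ≤ u ⬝ᵥ A'.mulVec u) :
    numAbove hA s ≤ numAbove hA' s := by
  refine card_le_numAbove hA hA' _ s fun c hc hc0 => lt_of_lt_of_le ?_ (h _)
  rw [specComb_form, Finset.mul_sum]
  obtain ⟨j, hj⟩ := Function.ne_iff.mp hc0
  have hj' : c j ≠ 0 := hj
  have hpt : ∀ i, s * c i ^ 2 ≤ hA.val i * c i ^ 2 := fun i => by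
    by_cases hi : s < hA.val i
    · exact mul_le_mul_of_nonneg_right hi.le (sq_nonneg _)
    · simp [hc i (by simpa using hi)]
  have hjs : s < hA.val j := by
    by_contra hn
    exact hj (hc j (by simpa using hn))
  refine Finset.sum_lt_sum (fun i _ => hpt i) ⟨j, Finset.mem_univ _, ?_⟩
  have : 0 < c j ^ 2 := by positivity
  exact mul_lt_mul_of_pos_right hjs this

/-- The eigenvalue count above a fixed level can only go up under a small perturbation. -/
lemma exists_numAbove_le {A : Matrix ι ι ℝ} (hA : EigBasis A) (s : ℝ) :
    ∃ r > 0, ∀ (A' : Matrix ι ι ℝ) (hA' : EigBasis A'),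
      (∀ u : ι → ℝ, u ⬝ᵥ A.mulVec u - r * ∑ z, u z ^ 2 ≤ u ⬝ᵥ A'.mulVec u) →
      numAbove hA s ≤ numAbove hA' s := by
  set P := Finset.univ.filter fun i => s < hA.val i with hP
  obtain ⟨S, hsS, hS⟩ : ∃ S, s < S ∧ ∀ i ∈ P, S ≤ hA.val i := by
    rcases P.eq_empty_or_nonempty with h | h
    · exact ⟨s + 1, by linarith, by simp [h]⟩
    · obtain ⟨j, hj, hmin⟩ := P.exists_min_image hA.val h
      exact ⟨hA.val j, by simpa [hP] using hj, hmin⟩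
  refine ⟨(S - s) / 2, by linarith, fun A' hA' h => ?_⟩
  refine card_le_numAbove hA hA' P s fun c hc hc0 => lt_of_lt_of_le ?_ (h _)
  rw [specComb_form, specComb_sq]
  have h1 : S * ∑ i, c i ^ 2 ≤ ∑ i, hA.val i * c i ^ 2 := by
    rw [Finset.mul_sum]
    refine Finset.sum_le_sum fun i _ => ?_
    by_cases hi : i ∈ P
    · exact mul_le_mul_of_nonneg_right (hS i hi) (sq_nonneg _)
    · simp [hc i hi]
  obtain ⟨j, hj⟩ := Function.ne_iff.mp hc0
  have h2 : 0 < ∑ i, c i ^ 2 :=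
    Finset.sum_pos' (fun i _ => sq_nonneg _) ⟨j, Finset.mem_univ _, by
      have : c j ≠ 0 := hj
      positivity⟩
  nlinarith

/-- Raising the potential at a site where an eigenvector of small eigenvalue is not negligible
lifts that eigenvalue above the level `s`, if there is a spectral gap above `s`. -/
lemma numAbove_jump {A A' : Matrix ι ι ℝ} (hA : EigBasis A) (hA' : EigBasis A')
    {s S r g : ℝ} (hs : 0 < s) (hr : 0 < r) (hg : 16 * s < g * r ^ 2)
    (hS : 9 * s ≤ S * r ^ 2) (hr1 : r ≤ 1)
    (hgap : ∀ i, s < hA.val i → S ≤ hA.val i)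
    (i₀ : ι) (hi₀ : |hA.val i₀| ≤ s) (n : ι) (hn : r ≤ |specVec hA i₀ n|)
    (hform : ∀ u : ι → ℝ, u ⬝ᵥ A.mulVec u + g * u n ^ 2 ≤ u ⬝ᵥ A'.mulVec u) :
    numAbove hA s + 1 ≤ numAbove hA' s := by
  set P := Finset.univ.filter fun i => s < hA.val i with hP
  have hi₀P : i₀ ∉ P := by
    simp only [hP, Finset.mem_filter, Finset.mem_univ, true_and, not_lt]
    exact (abs_le.mp hi₀).2
  have hcard : numAbove hA s + 1 = (insert i₀ P).card := by
    rw [Finset.card_insert_of_notMem hi₀P]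
    rfl
  rw [hcard]
  refine card_le_numAbove hA hA' _ s fun c hc hc0 => lt_of_lt_of_le ?_ (hform _)
  set x := c i₀ with hx
  set d : ι → ℝ := fun i => if i = i₀ then 0 else c i with hd
  set w := specComb hA d with hw
  have hdP : ∀ i, i ∉ P → d i = 0 := fun i hi => by
    by_cases h : i = i₀
    · simp [hd, h]
    · simp only [hd, h, if_false]
      exact hc i (by simp [h, hi])
  have hcomb : specComb hA c n = w n + x * specVec hA i₀ n := by
    have : specComb hA c = w + x • specVec hA i₀ := by
      rw [hw, specComb, specComb, ← Finset.add_sum_erase _ _ (Finset.mem_univ i₀),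
        ← Finset.add_sum_erase (a := i₀) _ (fun i => d i • specVec hA i) (Finset.mem_univ i₀)]
      have h0 : d i₀ = 0 := by simp [hd]
      rw [h0, zero_smul, zero_add, add_comm]
      congr 1
      refine Finset.sum_congr rfl fun i hi => ?_
      simp [hd, Finset.ne_of_mem_erase hi]
    rw [this]
    simp
  have hsum : ∀ f : ι → ℝ, ∑ i, f i * c i ^ 2 = ∑ i, f i * d i ^ 2 + f i₀ * x ^ 2 := fun f => by
    rw [← Finset.add_sum_erase _ _ (Finset.mem_univ i₀),
      ← Finset.add_sum_erase (a := i₀) _ (fun i => f i * d i ^ 2) (Finset.mem_univ i₀)]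
    have h0 : d i₀ = 0 := by simp [hd]
    have : ∑ i ∈ Finset.univ.erase i₀, f i * c i ^ 2
        = ∑ i ∈ Finset.univ.erase i₀, f i * d i ^ 2 := by
      refine Finset.sum_congr rfl fun i hi => ?_
      simp [hd, Finset.ne_of_mem_erase hi]
    rw [this, h0]
    ring
  set y := ∑ i, d i ^ 2 with hy
  have hy0 : 0 ≤ y := Finset.sum_nonneg fun i _ => sq_nonneg _
  have hwn : w n ^ 2 ≤ y := by
    rw [hy, ← specComb_sq hA d]
    exact Finset.single_le_sum (f := fun z => w z ^ 2) (fun z _ => sq_nonneg _) (Finset.mem_univ n)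
  have hcs : ∑ i, c i ^ 2 = y + x ^ 2 := by simpa using hsum fun _ => 1
  have hq : S * y - s * x ^ 2 ≤ ∑ i, hA.val i * c i ^ 2 := by
    rw [hsum, hy, Finset.mul_sum]
    have h1 : ∑ i, S * d i ^ 2 ≤ ∑ i, hA.val i * d i ^ 2 :=
      Finset.sum_le_sum fun i _ => by
        by_cases hi : i ∈ P
        · exact mul_le_mul_of_nonneg_right (hgap i (by simpa [hP] using hi)) (sq_nonneg _)
        · simp [hdP i hi]
    nlinarith [(abs_le.mp hi₀).1, sq_nonneg x]
  have hpos : 0 < y + x ^ 2 := by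
    rw [← hcs]
    obtain ⟨j, hj⟩ := Function.ne_iff.mp hc0
    exact Finset.sum_pos' (fun i _ => sq_nonneg _) ⟨j, Finset.mem_univ _, by
      have : c j ≠ 0 := hj
      positivity⟩
  rw [specComb_form, hcs, hcomb]
  set p := specVec hA i₀ n
  have hp2 : r ^ 2 ≤ p ^ 2 := by
    rw [← sq_abs p]
    gcongr
  have hr2 : r ^ 2 ≤ 1 := by nlinarith
  have hg0 : 0 < g := by
    by_contra hneg
    nlinarith [sq_nonneg r]
  have hSs : 9 * s ≤ S := by
    have hS0 : 0 < S := by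
      by_contra hneg
      nlinarith [sq_nonneg r]
    nlinarith
  by_cases hcase : 4 * y ≤ x ^ 2 * p ^ 2
  · have hxpos : 0 < x ^ 2 := by
      rcases (sq_nonneg x).lt_or_eq with h | h
      · exact h
      · rw [← h] at hcase hpos
        linarith
    have hlow : x ^ 2 * p ^ 2 ≤ 4 * (w n + x * p) ^ 2 := by
      have habs : |2 * w n| ≤ |x * p| := sq_le_sq.mp (by nlinarith)
      rcases le_total 0 (x * p) with hxp | hxp
      · rw [abs_of_nonneg hxp] at habs
        nlinarith [(abs_le.mp habs).1, (abs_le.mp habs).2]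
      · rw [abs_of_nonpos hxp] at habs
        nlinarith [(abs_le.mp habs).1, (abs_le.mp habs).2]
    have h3 : x ^ 2 * r ^ 2 ≤ x ^ 2 * p ^ 2 := by gcongr
    have h4 : g * (x ^ 2 * r ^ 2) ≤ g * (4 * (w n + x * p) ^ 2) :=
      mul_le_mul_of_nonneg_left (by linarith) hg0.le
    nlinarith
  · push Not at hcase
    have h3 : x ^ 2 * r ^ 2 ≤ x ^ 2 * p ^ 2 := by gcongr
    have h5 : 0 ≤ g * (w n + x * p) ^ 2 := by positivity
    have h6 : x ^ 2 * r ^ 2 < 4 * y := by linarith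
    nlinarith

lemma specComb_add {A : Matrix ι ι ℝ} (hA : EigBasis A) (c d : ι → ℝ) :
    specComb hA (c + d) = specComb hA c + specComb hA d := by
  simp [specComb, add_smul, Finset.sum_add_distrib]

/-- A set of eigenvectors each of which has mass at least `1/4` on `G` has at most `4|G|`
members. -/
lemma card_le_of_mass {A : Matrix ι ι ℝ} (hA : EigBasis A) (P G : Finset ι)
    (h : ∀ i ∈ P, 1 / 4 ≤ ∑ z ∈ G, specVec hA i z ^ 2) : P.card ≤ 4 * G.card := by
  have hbes : ∀ z, ∑ i ∈ P, specVec hA i z ^ 2 ≤ 1 := fun z => by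
    have h1 : ∑ i, specVec hA i z ^ 2 = 1 := by
      have h2 := specComb_sq hA fun i => specVec hA i ⬝ᵥ Pi.single z 1
      rw [specComb_repr] at h2
      simpa [Pi.single_apply, ite_pow] using h2.symm
    rw [← h1]
    exact Finset.sum_le_sum_of_subset_of_nonneg (Finset.subset_univ _) fun _ _ _ => sq_nonneg _
  have h1 : (P.card : ℝ) * (1 / 4) ≤ G.card := by
    calc (P.card : ℝ) * (1 / 4) = ∑ i ∈ P, (1 / 4 : ℝ) := by simp
      _ ≤ ∑ i ∈ P, ∑ z ∈ G, specVec hA i z ^ 2 := Finset.sum_le_sum h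
      _ = ∑ z ∈ G, ∑ i ∈ P, specVec hA i z ^ 2 := Finset.sum_comm
      _ ≤ ∑ z ∈ G, (1 : ℝ) := Finset.sum_le_sum fun z _ => hbes z
      _ = G.card := by simp
  have h2 : (P.card : ℝ) ≤ ((4 * G.card : ℕ) : ℝ) := by
    push_cast
    linarith
  exact_mod_cast h2

/-- A combination of few eigenvectors, each of small mass on `T`, has small mass on `T`. -/
lemma specComb_mass_le {A : Matrix ι ι ℝ} (hA : EigBasis A) {Q T : Finset ι} {m : ℕ} {θ : ℝ}
    (hQ : Q.card ≤ m) (hθ : 0 ≤ θ) (hmass : ∀ i ∈ Q, ∑ z ∈ T, specVec hA i z ^ 2 ≤ θ)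
    {c : ι → ℝ} (hc : ∀ i, i ∉ Q → c i = 0) :
    ∑ z ∈ T, specComb hA c z ^ 2 ≤ m * θ * ∑ i, c i ^ 2 := by
  have hpt : ∀ z, specComb hA c z ^ 2 ≤ (∑ i, c i ^ 2) * ∑ i ∈ Q, specVec hA i z ^ 2 := fun z => by
    have h1 : specComb hA c z = ∑ i ∈ Q, c i * specVec hA i z := by
      rw [specComb, Finset.sum_apply]
      refine (Finset.sum_subset (Finset.subset_univ Q) fun i _ hi => ?_).symm
      simp [hc i hi]
    have h2 : ∑ i ∈ Q, c i ^ 2 ≤ ∑ i, c i ^ 2 :=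
      Finset.sum_le_sum_of_subset_of_nonneg (Finset.subset_univ _) fun _ _ _ => sq_nonneg _
    rw [h1]
    exact (Finset.sum_mul_sq_le_sq_mul_sq Q _ _).trans
      (mul_le_mul_of_nonneg_right h2 (Finset.sum_nonneg fun _ _ => sq_nonneg _))
  have hc0 : 0 ≤ ∑ i, c i ^ 2 := Finset.sum_nonneg fun _ _ => sq_nonneg _
  calc ∑ z ∈ T, specComb hA c z ^ 2
      ≤ ∑ z ∈ T, (∑ i, c i ^ 2) * ∑ i ∈ Q, specVec hA i z ^ 2 := Finset.sum_le_sum fun z _ => hpt z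
    _ = (∑ i, c i ^ 2) * ∑ i ∈ Q, ∑ z ∈ T, specVec hA i z ^ 2 := by
        rw [← Finset.mul_sum, Finset.sum_comm]
    _ ≤ (∑ i, c i ^ 2) * ∑ i ∈ Q, θ :=
        mul_le_mul_of_nonneg_left (Finset.sum_le_sum hmass) hc0
    _ ≤ (∑ i, c i ^ 2) * (m * θ) := by
        rw [Finset.sum_const, nsmul_eq_mul]
        gcongr
    _ = _ := by ring

/-- Lowering the potential on `T` by a small amount `h` removes an eigenvalue only if it lies
just above the level, provided the eigenvectors in the window `[-w, w]` are tiny on `T`. -/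
lemma numAbove_step {A A' : Matrix ι ι ℝ} (hA : EigBasis A) (hA' : EigBasis A')
    {T : Finset ι} {m : ℕ} {θ h l w : ℝ} (hθ : 0 ≤ θ) (hh : 0 ≤ h) (hl : 0 ≤ l)
    (hw : l + 2 * h < w)
    (hform : ∀ u : ι → ℝ, u ⬝ᵥ A'.mulVec u = u ⬝ᵥ A.mulVec u + h * ∑ z ∈ T, u z ^ 2)
    (hcard : (Finset.univ.filter fun i => |hA'.val i| ≤ w).card ≤ m)
    (hmass : ∀ i, |hA'.val i| ≤ w → ∑ z ∈ T, specVec hA' i z ^ 2 ≤ θ) :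
    numAbove hA' (l + 2 * h * (m * θ)) ≤ numAbove hA l := by
  set l' := l + 2 * h * (m * θ) with hl'
  have hl0 : l ≤ l' := by
    have : 0 ≤ 2 * h * (m * θ) := by positivity
    linarith
  refine card_le_numAbove hA' hA _ l fun c hc hc0 => ?_
  have hcj : ∀ i, c i ≠ 0 → l' < hA'.val i := fun i hi => by
    by_contra hn
    exact hi (hc i (by simpa using hn))
  set c₁ : ι → ℝ := fun i => if hA'.val i ≤ w then c i else 0 with hc₁
  set c₂ : ι → ℝ := fun i => if hA'.val i ≤ w then 0 else c i with hc₂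
  have hsplit : c = c₁ + c₂ := by
    ext i
    by_cases hi : hA'.val i ≤ w <;> simp [hc₁, hc₂, hi]
  have hm1 : ∑ z ∈ T, specComb hA' c₁ z ^ 2 ≤ m * θ * ∑ i, c₁ i ^ 2 := by
    refine specComb_mass_le hA' hcard hθ (fun i hi => hmass i (by simpa using hi)) fun i hi => ?_
    by_contra hne
    have h1 : hA'.val i ≤ w ∧ c i ≠ 0 := by
      simp only [hc₁] at hne
      by_cases hw' : hA'.val i ≤ w
      · exact ⟨hw', by simpa [hw'] using hne⟩
      · simp [hw'] at hne
    have h2 := hcj i h1.2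
    apply hi
    simp only [Finset.mem_filter, Finset.mem_univ, true_and]
    exact abs_le.mpr ⟨by linarith, h1.1⟩
  have hm2 : ∑ z ∈ T, specComb hA' c₂ z ^ 2 ≤ ∑ i, c₂ i ^ 2 := by
    rw [← specComb_sq hA' c₂]
    exact Finset.sum_le_sum_of_subset_of_nonneg (Finset.subset_univ _) fun _ _ _ => sq_nonneg _
  have hm : ∑ z ∈ T, specComb hA' c z ^ 2
      ≤ 2 * (m * θ * ∑ i, c₁ i ^ 2) + 2 * ∑ i, c₂ i ^ 2 := by
    calc ∑ z ∈ T, specComb hA' c z ^ 2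
        ≤ ∑ z ∈ T, (2 * specComb hA' c₁ z ^ 2 + 2 * specComb hA' c₂ z ^ 2) := by
          refine Finset.sum_le_sum fun z _ => ?_
          rw [hsplit, specComb_add, Pi.add_apply]
          nlinarith [sq_nonneg (specComb hA' c₁ z - specComb hA' c₂ z)]
      _ = 2 * ∑ z ∈ T, specComb hA' c₁ z ^ 2 + 2 * ∑ z ∈ T, specComb hA' c₂ z ^ 2 := by
          rw [Finset.sum_add_distrib, Finset.mul_sum, Finset.mul_sum]
      _ ≤ _ := by linarith
  have hq := hform (specComb hA' c)
  rw [specComb_form] at hq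
  have hpt : ∀ i, l * c i ^ 2 + 2 * h * (m * θ) * c₁ i ^ 2 + 2 * h * c₂ i ^ 2
      ≤ hA'.val i * c i ^ 2 ∧ (c i ≠ 0 →
      l * c i ^ 2 + 2 * h * (m * θ) * c₁ i ^ 2 + 2 * h * c₂ i ^ 2
      < hA'.val i * c i ^ 2) := fun i => by
    by_cases h0 : c i = 0
    · have h1 : c₁ i = 0 := by simp [hc₁, h0]
      have h2 : c₂ i = 0 := by simp [hc₂, h0]
      simp [h0, h1, h2]
    · have hp : 0 < c i ^ 2 := by positivity
      have hlt : l * c i ^ 2 + 2 * h * (m * θ) * c₁ i ^ 2 + 2 * h * c₂ i ^ 2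
          < hA'.val i * c i ^ 2 := by
        by_cases hi : hA'.val i ≤ w
        · have := mul_lt_mul_of_pos_right (hcj i h0) hp
          simp only [hc₁, hc₂, hi, if_true]
          rw [hl'] at this
          nlinarith
        · simp only [hc₁, hc₂, hi, if_false]
          have h3 : l + 2 * h < hA'.val i := by linarith [not_le.mp hi]
          have := mul_lt_mul_of_pos_right h3 hp
          nlinarith
      exact ⟨hlt.le, fun _ => hlt⟩
  obtain ⟨j, hj⟩ := Function.ne_iff.mp hc0
  have hsum := Finset.sum_lt_sum (fun i (_ : i ∈ Finset.univ) => (hpt i).1)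
    ⟨j, Finset.mem_univ _, (hpt j).2 hj⟩
  simp only [Finset.sum_add_distrib, ← Finset.mul_sum] at hsum
  have h9 := mul_le_mul_of_nonneg_left hm hh
  nlinarith

/-- Along a path raising the potential on `T`, at most as many eigenvalues cross the level `s`
as can be in the window `[-w, w]` at one time. -/
lemma numAbove_path {A : ℝ → Matrix ι ι ℝ} (hA : ∀ t, EigBasis (A t))
    {T : Finset ι} {m : ℕ} {θ s w M : ℝ} (hM : 0 ≤ M) (hθ : 0 ≤ θ) (hs : 0 ≤ s)
    (hw : s + 2 * M * (m * θ) < w)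
    (hform : ∀ t t' (u : ι → ℝ),
      u ⬝ᵥ (A t').mulVec u = u ⬝ᵥ (A t).mulVec u + (t' - t) * ∑ z ∈ T, u z ^ 2)
    (hcard : ∀ t ∈ Set.Icc 0 M,
      (Finset.univ.filter fun i => |(hA t).val i| ≤ w).card ≤ m)
    (hmass : ∀ t ∈ Set.Icc 0 M, ∀ i, |(hA t).val i| ≤ w →
      ∑ z ∈ T, specVec (hA t) i z ^ 2 ≤ θ) :
    numAbove (hA M) s ≤ numAbove (hA 0) s + m := by
  obtain ⟨n, hn⟩ := exists_nat_gt (2 * M / (w - (s + 2 * M * (m * θ))))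
  have hd : 0 < w - (s + 2 * M * (m * θ)) := by linarith
  have hn0 : (0 : ℝ) < n := lt_of_le_of_lt (by positivity) hn
  set h := M / n with hh
  have hh0 : 0 ≤ h := by positivity
  have hnh : n * h = M := by rw [hh]; field_simp
  have hhd : 2 * h < w - (s + 2 * M * (m * θ)) := by
    rw [div_lt_iff₀ hd] at hn
    rw [hh, ← mul_div_assoc, div_lt_iff₀ hn0]
    linarith
  have key : ∀ k : ℕ, k ≤ n →
      numAbove (hA (k * h)) (s + 2 * (k * h) * (m * θ)) ≤ numAbove (hA 0) s := by
    intro k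
    induction k with
    | zero =>
      intro _
      simpa using numAbove_mono (hA ((0 : ℕ) * h)) (hA 0) s fun u => by simp
    | succ k ih =>
      intro hk
      have hk1 : ((k + 1 : ℕ) : ℝ) * h ≤ M := by
        rw [← hnh]
        gcongr
      have hk0 : (k : ℝ) * h ≤ M := by
        refine le_trans ?_ hk1
        gcongr
        omega
      have hb : (k : ℝ) * h * (m * θ) ≤ M * (m * θ) := by gcongr
      have hstep := numAbove_step (hA (k * h)) (hA ((k + 1 : ℕ) * h)) (T := T) (m := m) (θ := θ)
        (h := h) (l := s + 2 * (k * h) * (m * θ)) (w := w) hθ hh0 (by positivity)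
        (by linarith) (fun u => by rw [hform (k * h)]; push_cast; ring)
        (hcard _ ⟨by positivity, hk1⟩) (hmass _ ⟨by positivity, hk1⟩)
      have heq : s + 2 * (((k + 1 : ℕ) : ℝ) * h) * (m * θ)
          = s + 2 * (k * h) * (m * θ) + 2 * h * (m * θ) := by
        push_cast
        ring
      rw [heq]
      exact hstep.trans (ih (by omega))
  have hlast := key n le_rfl
  rw [hnh] at hlast
  have hsub : numAbove (hA M) s ≤ numAbove (hA M) (s + 2 * M * (m * θ))
      + (Finset.univ.filter fun i => |(hA M).val i| ≤ w).card := by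
    unfold numAbove
    refine le_trans (Finset.card_le_card ?_) (Finset.card_union_le _ _)
    intro i hi
    simp only [Finset.mem_union, Finset.mem_filter, Finset.mem_univ, true_and] at hi ⊢
    by_cases hc : s + 2 * M * (m * θ) < (hA M).val i
    · exact Or.inl hc
    · exact Or.inr (abs_le.mpr ⟨by linarith, by linarith⟩)
  have := hcard M ⟨hM, le_rfl⟩
  omega

end Counting

/-! ### Influences of bounded functions on product spaces -/

section Influence

variable {κ : Type*} [Fintype κ] (ν : κ → Measure ℝ) [∀ i, IsProbabilityMeasure (ν i)]

/-- Exchanging a coordinate with an independent copy preserves the product measure. -/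
lemma measurePreserving_exchange (n : κ) :
    MeasurePreserving (fun p : (κ → ℝ) × ℝ => (Function.update p.1 n p.2, p.1 n))
      ((Measure.pi ν).prod (ν n)) ((Measure.pi ν).prod (ν n)) := by
  have hupd : Measurable fun p : (κ → ℝ) × ℝ => Function.update p.1 n p.2 := by
    refine measurable_pi_lambda _ fun j => ?_
    by_cases hj : j = n
    · subst hj
      simpa using measurable_snd
    · simp only [Function.update_of_ne hj]
      exact (measurable_pi_apply j).comp measurable_fst
  have hm : Measurable fun p : (κ → ℝ) × ℝ => (Function.update p.1 n p.2, p.1 n) :=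
    hupd.prodMk ((measurable_pi_apply n).comp measurable_fst)
  refine ⟨hm, Measure.ext_of_lintegral _ fun F hF => ?_⟩
  rw [lintegral_map hF hm, lintegral_prod _ hF.aemeasurable]
  refine (lintegral_prod _ (hF.comp hm).aemeasurable).trans ?_
  simp only [Function.comp_apply]
  have hG : Measurable fun x : κ → ℝ => ∫⁻ t, F (Function.update x n t, x n) ∂ν n :=
    (hF.comp hm).lintegral_prod_right'
  rw [← lintegral_pi_update ν n hG]
  have hH : Measurable fun x : κ → ℝ => ∫⁻ s, F (x, s) ∂ν n := hF.lintegral_prod_right'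
  rw [← lintegral_pi_update ν n hH]
  refine lintegral_congr fun x => ?_
  simp only [Function.update_idem, Function.update_self]
  refine lintegral_lintegral_swap ?_
  have : Measurable fun p : ℝ × ℝ => (Function.update x n p.2, p.1) :=
    ((measurable_update x).comp measurable_snd).prodMk measurable_fst
  exact (hF.comp this).aemeasurable

/-- The expected sign of the difference with an independent copy. -/
def meanSign (m : Measure ℝ) (s : ℝ) : ℝ := ∫ t, Real.sign (s - t) ∂m

lemma abs_sign_le_one (x : ℝ) : |Real.sign x| ≤ 1 := by
  rcases lt_trichotomy x 0 with h | h | h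
  · simp [Real.sign_of_neg h]
  · simp [h]
  · simp [Real.sign_of_pos h]

lemma measurable_sign : Measurable Real.sign := by
  unfold Real.sign
  exact Measurable.ite measurableSet_Iio measurable_const
    (Measurable.ite measurableSet_Ioi measurable_const measurable_const)

lemma integrable_of_abs_le {α : Type*} [MeasurableSpace α] {m : Measure α} [IsFiniteMeasure m]
    {f : α → ℝ} (hf : Measurable f) {B : ℝ} (hB : ∀ x, |f x| ≤ B) : Integrable f m :=
  Integrable.of_bound hf.aestronglyMeasurable B (Filter.Eventually.of_forall hB)

lemma measurable_meanSign (m : Measure ℝ) [IsProbabilityMeasure m] : Measurable (meanSign m) := by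
  have h : Measurable fun p : ℝ × ℝ => Real.sign (p.1 - p.2) :=
    measurable_sign.comp (measurable_fst.sub measurable_snd)
  exact (h.stronglyMeasurable.integral_prod_right').measurable

lemma abs_meanSign_le_one (m : Measure ℝ) [IsProbabilityMeasure m] (s : ℝ) :
    |meanSign m s| ≤ 1 := by
  have h := norm_integral_le_of_norm_le_const (μ := m) (f := fun t => Real.sign (s - t)) (C := 1)
    (Filter.Eventually.of_forall fun t => abs_sign_le_one _)
  simpa [meanSign] using h

lemma integral_meanSign (m : Measure ℝ) [IsProbabilityMeasure m] : ∫ s, meanSign m s ∂m = 0 := by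
  have h : Measurable fun p : ℝ × ℝ => Real.sign (p.1 - p.2) :=
    measurable_sign.comp (measurable_fst.sub measurable_snd)
  have hi : Integrable (fun p : ℝ × ℝ => Real.sign (p.1 - p.2)) (m.prod m) :=
    integrable_of_abs_le h fun p => abs_sign_le_one _
  have h1 := integral_integral_swap (f := fun s t => Real.sign (s - t)) hi
  have h2 : ∀ t, ∫ s, Real.sign (s - t) ∂m = - ∫ s, Real.sign (t - s) ∂m := fun t => by
    rw [← integral_neg]
    refine integral_congr_ae (Filter.Eventually.of_forall fun s => ?_)
    simp only
    rw [← Real.sign_neg, neg_sub]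
  simp only [h2, integral_neg] at h1
  unfold meanSign
  linarith

/-- Sums of mean signs have at most square-root size on average. -/
lemma integral_abs_sum_meanSign_le (S : Finset κ) :
    ∫ x, |∑ n ∈ S, meanSign (ν n) (x n)| ∂Measure.pi ν ≤ Real.sqrt S.card := by
  rcases S.eq_empty_or_nonempty with rfl | hS
  · simp
  set X : κ → (κ → ℝ) → ℝ := fun n x => meanSign (ν n) (x n) with hX
  have hXm : ∀ n, Measurable (X n) := fun n =>
    (measurable_meanSign (ν n)).comp (measurable_pi_apply n)
  have hX1 : ∀ n x, |X n x| ≤ 1 := fun n x => abs_meanSign_le_one _ _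
  have hLp : ∀ n, MemLp (X n) 2 (Measure.pi ν) := fun n =>
    MemLp.of_bound (hXm n).aestronglyMeasurable 1 (Filter.Eventually.of_forall (hX1 n))
  have hind : iIndepFun X (Measure.pi ν) :=
    iIndepFun_pi (μ := ν) (X := fun n => meanSign (ν n)) fun n =>
      (measurable_meanSign (ν n)).aemeasurable
  have hmean : ∀ n, ∫ x, X n x ∂Measure.pi ν = 0 := fun n => by
    have := integral_comp_eval (μ := ν) (i := n) (f := meanSign (ν n))
      (measurable_meanSign (ν n)).aestronglyMeasurable
    rw [← integral_meanSign (ν n), ← this]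
  have hvar : variance (∑ n ∈ S, X n) (Measure.pi ν) ≤ S.card := by
    rw [IndepFun.variance_sum (fun n _ => hLp n) fun i _ j _ hij => hind.indepFun hij]
    calc ∑ n ∈ S, variance (X n) (Measure.pi ν) ≤ ∑ n ∈ S, (1 : ℝ) := by
          refine Finset.sum_le_sum fun n _ => ?_
          have h := variance_le_sq_of_bounded (μ := Measure.pi ν) (X := X n) (a := -1) (b := 1)
            (Filter.Eventually.of_forall fun x => abs_le.mp (hX1 n x)) (hXm n).aemeasurable
          norm_num at h
          exact h
      _ = S.card := by simp
  have hsumLp : MemLp (∑ n ∈ S, X n) 2 (Measure.pi ν) := memLp_finsetSum' _ fun n _ => hLp n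
  have hsq : ∫ x, (∑ n ∈ S, X n x) ^ 2 ∂Measure.pi ν ≤ S.card := by
    have h := variance_eq_sub hsumLp
    have h0 : ∫ x, (∑ n ∈ S, X n) x ∂Measure.pi ν = 0 := by
      simp only [Finset.sum_apply]
      rw [integral_finsetSum _ fun n _ => (hLp n).integrable (by norm_num)]
      simp [hmean]
    rw [h0] at h
    rw [h] at hvar
    simpa using hvar
  have hc : (0 : ℝ) < S.card := by exact_mod_cast hS.card_pos
  have hr : 0 < Real.sqrt S.card := Real.sqrt_pos.mpr hc
  have hInt : Integrable (fun x => (∑ n ∈ S, X n x) ^ 2) (Measure.pi ν) := by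
    simpa using hsumLp.integrable_sq
  have hle : ∫ x, |∑ n ∈ S, X n x| ∂Measure.pi ν
      ≤ ∫ x, ((∑ n ∈ S, X n x) ^ 2 / (2 * Real.sqrt S.card) + Real.sqrt S.card / 2)
          ∂Measure.pi ν := by
    refine integral_mono ?_ ((hInt.div_const _).add (integrable_const _)) fun x => ?_
    · have h1 := (hsumLp.integrable (by norm_num)).abs
      simpa only [Finset.sum_apply] using h1
    · simp only
      have h := sq_nonneg (|∑ n ∈ S, X n x| - Real.sqrt S.card)
      rw [← sq_abs (∑ n ∈ S, X n x)]
      rw [div_add_div _ _ (by positivity) (by positivity), le_div_iff₀ (by positivity)]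
      nlinarith
  refine hle.trans ?_
  rw [integral_add (hInt.div_const _) (integrable_const _), integral_div]
  simp only [integral_const, probReal_univ, smul_eq_mul, one_mul]
  have h3 : (∫ x, (∑ n ∈ S, X n x) ^ 2 ∂Measure.pi ν) / (2 * Real.sqrt S.card)
      ≤ Real.sqrt S.card / 2 := by
    rw [div_le_div_iff₀ (by positivity) (by positivity)]
    nlinarith [Real.mul_self_sqrt hc.le]
  linarith

/-- The total influence of the coordinates in `S` on a bounded function, monotone in these
coordinates, is at most of order `√|S|`. -/
theorem sum_influence_le (S : Finset κ) {g : (κ → ℝ) → ℝ} (hg : Measurable g) {B : ℝ}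
    (hB : ∀ x, |g x| ≤ B) (hmono : ∀ n ∈ S, ∀ x, Monotone fun t => g (Function.update x n t)) :
    ∑ n ∈ S, ∫ x, ∫ t, |g x - g (Function.update x n t)| ∂ν n ∂Measure.pi ν
      ≤ 2 * B * Real.sqrt S.card := by
  have hupd : ∀ n : κ, Measurable fun p : (κ → ℝ) × ℝ => Function.update p.1 n p.2 := fun n =>
    measurable_fst.comp (measurePreserving_exchange ν n).measurable
  have hone : ∀ n ∈ S, ∫ x, ∫ t, |g x - g (Function.update x n t)| ∂ν n ∂Measure.pi ν
      = 2 * ∫ x, g x * meanSign (ν n) (x n) ∂Measure.pi ν := by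
    intro n hn
    set P := (Measure.pi ν).prod (ν n) with hP
    have hsg : Measurable fun p : (κ → ℝ) × ℝ => Real.sign (p.1 n - p.2) :=
      measurable_sign.comp (((measurable_pi_apply n).comp measurable_fst).sub measurable_snd)
    have hsg' : Measurable fun p : (κ → ℝ) × ℝ => Real.sign (p.2 - p.1 n) :=
      measurable_sign.comp (measurable_snd.sub ((measurable_pi_apply n).comp measurable_fst))
    have hm1 : Measurable fun p : (κ → ℝ) × ℝ => g p.1 * Real.sign (p.1 n - p.2) :=
      (hg.comp measurable_fst).mul hsg
    have hm2 : Measurable fun p : (κ → ℝ) × ℝ =>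
        g (Function.update p.1 n p.2) * Real.sign (p.1 n - p.2) := (hg.comp (hupd n)).mul hsg
    have hb : ∀ (y z : ℝ), |y| ≤ B → |y * Real.sign z| ≤ B := fun y z hy => by
      rw [abs_mul]
      exact (mul_le_of_le_one_right (abs_nonneg _) (abs_sign_le_one z)).trans hy
    have hi1 : Integrable (fun p : (κ → ℝ) × ℝ => g p.1 * Real.sign (p.1 n - p.2)) P :=
      integrable_of_abs_le hm1 fun p => hb _ _ (hB _)
    have hi2 : Integrable (fun p : (κ → ℝ) × ℝ =>
        g (Function.update p.1 n p.2) * Real.sign (p.1 n - p.2)) P :=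
      integrable_of_abs_le hm2 fun p => hb _ _ (hB _)
    have hpt : ∀ p : (κ → ℝ) × ℝ, |g p.1 - g (Function.update p.1 n p.2)|
        = g p.1 * Real.sign (p.1 n - p.2)
          - g (Function.update p.1 n p.2) * Real.sign (p.1 n - p.2) := fun p => by
      have hmn := hmono n hn p.1
      have hself : g p.1 = g (Function.update p.1 n (p.1 n)) := by
        rw [Function.update_eq_self]
      rw [← sub_mul]
      rcases lt_trichotomy (p.1 n) p.2 with h | h | h
      · have h1 := hmn h.le
        simp only at h1
        rw [Real.sign_of_neg (by linarith), abs_of_nonpos (by linarith)]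
        ring
      · rw [← h, Function.update_eq_self]
        simp
      · have h1 := hmn h.le
        simp only at h1
        rw [Real.sign_of_pos (by linarith), abs_of_nonneg (by linarith)]
        ring
    have hI : ∫ x, ∫ t, |g x - g (Function.update x n t)| ∂ν n ∂Measure.pi ν
        = ∫ p, |g p.1 - g (Function.update p.1 n p.2)| ∂P := by
      rw [hP, integral_prod]
      simp only [hpt]
      exact hi1.sub hi2
    have hswap : ∫ p, g (Function.update p.1 n p.2) * Real.sign (p.1 n - p.2) ∂P
        = - ∫ p, g p.1 * Real.sign (p.1 n - p.2) ∂P := by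
      have hex := measurePreserving_exchange ν n
      have h1 := integral_map (μ := P) hex.measurable.aemeasurable
        (f := fun p : (κ → ℝ) × ℝ => g p.1 * Real.sign (p.2 - p.1 n))
        ((hg.comp measurable_fst).mul hsg').aestronglyMeasurable
      rw [hP, hex.map_eq] at h1
      simp only [Function.update_self] at h1
      rw [hP, ← h1, ← integral_neg]
      refine integral_congr_ae (Filter.Eventually.of_forall fun p => ?_)
      simp only
      rw [← mul_neg, ← Real.sign_neg, neg_sub]
    have hfub : ∫ p, g p.1 * Real.sign (p.1 n - p.2) ∂P
        = ∫ x, g x * meanSign (ν n) (x n) ∂Measure.pi ν := by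
      rw [hP, integral_prod _ hi1]
      refine integral_congr_ae (Filter.Eventually.of_forall fun x => ?_)
      simp only [meanSign]
      rw [integral_const_mul]
    rw [hI]
    simp only [hpt]
    rw [integral_sub hi1 hi2, hswap, hfub]
    ring
  rw [Finset.sum_congr rfl hone, ← Finset.mul_sum]
  have hmX : ∀ n, Measurable fun x : κ → ℝ => meanSign (ν n) (x n) := fun n =>
    (measurable_meanSign (ν n)).comp (measurable_pi_apply n)
  have hgi : ∀ n, Integrable (fun x : κ → ℝ => g x * meanSign (ν n) (x n)) (Measure.pi ν) :=
    fun n => integrable_of_abs_le (hg.mul (hmX n)) (B := B) fun x => by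
      rw [abs_mul]
      exact (mul_le_of_le_one_right (abs_nonneg _) (abs_meanSign_le_one _ _)).trans (hB x)
  rw [← integral_finsetSum _ fun n _ => hgi n]
  have hsm : Measurable fun x : κ → ℝ => ∑ n ∈ S, meanSign (ν n) (x n) :=
    Finset.measurable_fun_sum _ fun n _ => hmX n
  have hsi : Integrable (fun x : κ → ℝ => ∑ n ∈ S, meanSign (ν n) (x n)) (Measure.pi ν) :=
    integrable_finsetSum _ fun n _ => integrable_of_abs_le (hmX n) fun x => abs_meanSign_le_one _ _
  have hB0 : 0 ≤ B := (abs_nonneg _).trans (hB fun _ => 0)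
  have hfin : ∫ x, ∑ n ∈ S, g x * meanSign (ν n) (x n) ∂Measure.pi ν
      ≤ ∫ x, B * |∑ n ∈ S, meanSign (ν n) (x n)| ∂Measure.pi ν := by
    refine integral_mono (integrable_finsetSum _ fun n _ => hgi n) (hsi.abs.const_mul B) fun x => ?_
    simp only
    rw [← Finset.mul_sum]
    refine (le_abs_self _).trans ?_
    rw [abs_mul]
    exact mul_le_mul_of_nonneg_right (hB x) (abs_nonneg _)
  rw [integral_const_mul] at hfin
  have := mul_le_mul_of_nonneg_left (integral_abs_sum_meanSign_le ν S) hB0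
  linarith

end Influence

/-! ### A Wegner estimate for eigenvectors that are spread out on many sites -/

section Wegner

variable {ι κ : Type*} [Fintype ι] [Fintype κ]

lemma measurable_numAbove {A : (κ → ℝ) → Matrix ι ι ℝ} (bas : ∀ W, EigBasis (A W)) (s : ℝ)
    (h : ∀ W W' (u : ι → ℝ), u ⬝ᵥ (A W).mulVec u - dist W' W * ∑ z, u z ^ 2
      ≤ u ⬝ᵥ (A W').mulVec u) :
    Measurable fun W => numAbove (bas W) s := by
  refine measurable_of_Ici fun k => IsOpen.measurableSet ?_
  rw [Metric.isOpen_iff]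
  intro W hW
  obtain ⟨r, hr, hle⟩ := exists_numAbove_le (bas W) s
  refine ⟨r, hr, fun W' hW' => ?_⟩
  refine le_trans (show k ≤ numAbove (bas W) s from hW) (hle _ (bas W') fun u => ?_)
  refine le_trans ?_ (h W W' u)
  have h0 : 0 ≤ ∑ z, u z ^ 2 := Finset.sum_nonneg fun _ _ => sq_nonneg _
  have := mul_le_mul_of_nonneg_right (Metric.mem_ball.mp hW').le h0
  linarith

/-- The signed eigenvalue count: eigenvalues above `s` minus eigenvalues below `-s`. -/
def signedCount {A : Matrix ι ι ℝ} (hA : EigBasis A) (s : ℝ) : ℝ :=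
  (numAbove hA s : ℝ) - numAbove hA.neg s

variable {H : (κ → ℝ) → Matrix ι ι ℝ} (bas : ∀ W, EigBasis (H W)) {e : κ → ι}

/-- Replace the coordinates in `S` by the value `t`. -/
def setOn (S : Finset κ) (t : ℝ) (W : κ → ℝ) : κ → ℝ := fun n => if n ∈ S then t else W n

lemma sum_sq_comp_le (he : Function.Injective e) (u : ι → ℝ) :
    ∑ n, u (e n) ^ 2 ≤ ∑ z, u z ^ 2 := by
  rw [← Finset.sum_image (f := fun z => u z ^ 2) (g := e) fun x _ y _ h => he h]
  exact Finset.sum_le_sum_of_subset_of_nonneg (Finset.subset_univ _) fun _ _ _ => sq_nonneg _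

lemma neg_form (A : Matrix ι ι ℝ) (u : ι → ℝ) :
    u ⬝ᵥ (-A).mulVec u = -(u ⬝ᵥ A.mulVec u) := by
  rw [Matrix.neg_mulVec, dotProduct_neg]

lemma measurable_signedCount (he : Function.Injective e)
    (hform : ∀ W W' (u : ι → ℝ), u ⬝ᵥ (H W').mulVec u
      = u ⬝ᵥ (H W).mulVec u + ∑ n, (W' n - W n) * u (e n) ^ 2) (s : ℝ) :
    Measurable fun W => signedCount (bas W) s := by
  have hb : ∀ (W W' : κ → ℝ) (u : ι → ℝ), |∑ n, (W' n - W n) * u (e n) ^ 2|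
      ≤ dist W' W * ∑ z, u z ^ 2 := fun W W' u => by
    calc |∑ n, (W' n - W n) * u (e n) ^ 2| ≤ ∑ n, |(W' n - W n) * u (e n) ^ 2| :=
          Finset.abs_sum_le_sum_abs _ _
      _ ≤ ∑ n, dist W' W * u (e n) ^ 2 := by
          refine Finset.sum_le_sum fun n _ => ?_
          rw [abs_mul, abs_of_nonneg (sq_nonneg (u (e n)))]
          refine mul_le_mul_of_nonneg_right ?_ (sq_nonneg _)
          rw [← Real.dist_eq]
          exact dist_le_pi_dist W' W n
      _ ≤ _ := by
          rw [← Finset.mul_sum]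
          exact mul_le_mul_of_nonneg_left (sum_sq_comp_le he u) dist_nonneg
  have h1 := measurable_numAbove bas s fun W W' u => by
    rw [hform W W']
    linarith [(abs_le.mp (hb W W' u)).1]
  have h2 := measurable_numAbove (fun W => (bas W).neg) s fun W W' u => by
    rw [neg_form, neg_form, hform W W']
    linarith [(abs_le.mp (hb W W' u)).2]
  have hc : Measurable fun k : ℕ => (k : ℝ) := measurable_from_top
  exact (hc.comp h1).sub (hc.comp h2)

lemma signedCount_mono
    (hform : ∀ W W' (u : ι → ℝ), u ⬝ᵥ (H W').mulVec u
      = u ⬝ᵥ (H W).mulVec u + ∑ n, (W' n - W n) * u (e n) ^ 2) (s : ℝ)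
    {W W' : κ → ℝ} (hW : ∀ n, W n ≤ W' n) :
    signedCount (bas W) s ≤ signedCount (bas W') s := by
  have h0 : ∀ u : ι → ℝ, 0 ≤ ∑ n, (W' n - W n) * u (e n) ^ 2 := fun u =>
    Finset.sum_nonneg fun n _ => mul_nonneg (by linarith [hW n]) (sq_nonneg _)
  have h1 : numAbove (bas W) s ≤ numAbove (bas W') s := numAbove_mono _ _ _ fun u => by
    rw [hform W W']
    linarith [h0 u]
  have h2 : numAbove (bas W').neg s ≤ numAbove (bas W).neg s := numAbove_mono _ _ _ fun u => by
    rw [neg_form, neg_form, hform W W']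
    linarith [h0 u]
  have h1' : (numAbove (bas W) s : ℝ) ≤ numAbove (bas W') s := by exact_mod_cast h1
  have h2' : (numAbove (bas W').neg s : ℝ) ≤ numAbove (bas W).neg s := by exact_mod_cast h2
  unfold signedCount
  linarith

/-- Moving only the coordinates in `S` within `[0, M]` changes the signed count by at most `2 * m`. -/
lemma signedCount_range (he : Function.Injective e)
    (hform : ∀ W W' (u : ι → ℝ), u ⬝ᵥ (H W').mulVec u
      = u ⬝ᵥ (H W).mulVec u + ∑ n, (W' n - W n) * u (e n) ^ 2)
    {M θ w s : ℝ} {m : ℕ} {S : Finset κ} (hM : 0 ≤ M) (hθ : 0 ≤ θ) (hs : 0 ≤ s)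
    (hw : s + 2 * M * (m * θ) < w)
    (hcard : ∀ W, (∀ n, W n ∈ Set.Icc 0 M) →
      (Finset.univ.filter fun i => |(bas W).val i| ≤ w).card ≤ m)
    (hmass : ∀ W, (∀ n, W n ∈ Set.Icc 0 M) → ∀ i, |(bas W).val i| ≤ w →
      ∑ n ∈ S, specVec (bas W) i (e n) ^ 2 ≤ θ)
    {W : κ → ℝ} (hW : ∀ n, W n ∈ Set.Icc 0 M) :
    |signedCount (bas W) s - signedCount (bas (setOn S 0 W)) s| ≤ 2 * m := by
  have hmem : ∀ t ∈ Set.Icc 0 M, ∀ n, setOn S t W n ∈ Set.Icc 0 M := fun t ht n => by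
    unfold setOn
    split_ifs
    exacts [ht, hW n]
  have hdiff : ∀ (t t' : ℝ) (u : ι → ℝ), ∑ n, (setOn S t' W n - setOn S t W n) * u (e n) ^ 2
      = (t' - t) * ∑ z ∈ S.image e, u z ^ 2 := fun t t' u => by
    rw [Finset.sum_image fun x _ y _ h => he h, Finset.mul_sum,
      ← Finset.sum_subset (Finset.subset_univ S)]
    · exact Finset.sum_congr rfl fun n hn => by simp [setOn, hn]
    · intro n _ hn
      simp [setOn, hn]
  have himg : ∀ t ∈ Set.Icc 0 M, ∀ i, |(bas (setOn S t W)).val i| ≤ w →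
      ∑ z ∈ S.image e, specVec (bas (setOn S t W)) i z ^ 2 ≤ θ := fun t ht i hi => by
    rw [Finset.sum_image fun x _ y _ h => he h]
    exact hmass _ (hmem t ht) i hi
  have hp := numAbove_path (A := fun t => H (setOn S t W)) (fun t => bas (setOn S t W))
    (T := S.image e) hM hθ hs hw (fun t t' u => by rw [hform (setOn S t W), hdiff])
    (fun t ht => hcard _ (hmem t ht)) himg
  have hflip : ∀ t ∈ Set.Icc 0 M, M - t ∈ Set.Icc 0 M := fun t ht =>
    ⟨by linarith [ht.2], by linarith [ht.1]⟩
  have hn := numAbove_path (A := fun t => -H (setOn S (M - t) W))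
    (fun t => (bas (setOn S (M - t) W)).neg) (T := S.image e) hM hθ hs hw
    (fun t t' u => by
      rw [neg_form, neg_form, hform (setOn S (M - t) W), hdiff]
      ring)
    (fun t ht => by
      simpa [EigBasis.neg] using hcard _ (hmem _ (hflip t ht)))
    (fun t ht i hi => himg _ (hflip t ht) i (by simpa [EigBasis.neg] using hi))
  have hlo : ∀ n, setOn S 0 W n ≤ W n := fun n => by
    unfold setOn
    split_ifs
    exacts [(hW n).1, le_rfl]
  have hhi : ∀ n, W n ≤ setOn S M W n := fun n => by
    unfold setOn
    split_ifs
    exacts [(hW n).2, le_rfl]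
  have hp' : (numAbove (bas (setOn S M W)) s : ℝ) ≤ numAbove (bas (setOn S 0 W)) s + m := by
    exact_mod_cast hp
  have hn' : (numAbove (bas (setOn S 0 W)).neg s : ℝ)
      ≤ numAbove (bas (setOn S M W)).neg s + m := by
    have h : numAbove (bas (setOn S (M - M) W)).neg s
      ≤ numAbove (bas (setOn S (M - 0) W)).neg s + m := hn
    rw [sub_self, sub_zero] at h
    exact_mod_cast h
  have h1 := signedCount_mono bas hform s hlo
  have h2 := signedCount_mono bas hform s hhi
  rw [abs_of_nonneg (by linarith)]
  unfold signedCount at h2 ⊢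
  linarith

/-- A jump of the potential at a site where an eigenvector of small eigenvalue is not negligible
changes the signed count. -/
lemma one_le_signedCount_sub
    (hform : ∀ W W' (u : ι → ℝ), u ⬝ᵥ (H W').mulVec u
      = u ⬝ᵥ (H W).mulVec u + ∑ n, (W' n - W n) * u (e n) ^ 2)
    {s s' r g : ℝ} (hs : 0 < s) (hr : 0 < r) (hr1 : r ≤ 1) (hg : 16 * s < g * r ^ 2)
    (hs' : 9 * s ≤ s' * r ^ 2) {W : κ → ℝ}
    (hgap : ∀ i, ¬(s < |(bas W).val i| ∧ |(bas W).val i| ≤ s'))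
    {i₀ : ι} (hi₀ : |(bas W).val i₀| ≤ s) {n : κ} (hn : r ≤ |specVec (bas W) i₀ (e n)|)
    {t : ℝ} (ht : g < |t - W n|) :
    1 ≤ |signedCount (bas W) s - signedCount (bas (Function.update W n t)) s| := by
  have hsum : ∀ u : ι → ℝ, ∑ k, (Function.update W n t k - W k) * u (e k) ^ 2
      = (t - W n) * u (e n) ^ 2 := fun u => by
    rw [Finset.sum_eq_single n]
    · simp
    · intro k _ hk
      simp [Function.update_of_ne hk]
    · simp
  have hg0 : 0 < g := by
    by_contra hneg
    nlinarith [sq_nonneg r]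
  rcases le_total (W n) t with h | h
  · rw [abs_of_nonneg (by linarith)] at ht
    have hj := numAbove_jump (bas W) (bas (Function.update W n t)) hs hr hg hs' hr1
      (fun i hi => by
        by_contra hc
        rw [not_le] at hc
        refine hgap i ⟨hi.trans_le (le_abs_self _), ?_⟩
        rw [abs_of_pos (hs.trans hi)]
        exact hc.le) i₀ hi₀ (e n) hn (fun u => by
        rw [hform W (Function.update W n t), hsum]
        nlinarith [sq_nonneg (u (e n))])
    have h2 : numAbove (bas (Function.update W n t)).neg s ≤ numAbove (bas W).neg s :=
      numAbove_mono _ _ _ fun u => by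
        rw [neg_form, neg_form, hform W (Function.update W n t), hsum]
        nlinarith [sq_nonneg (u (e n))]
    have hj' : (numAbove (bas W) s : ℝ) + 1 ≤ numAbove (bas (Function.update W n t)) s := by
      exact_mod_cast hj
    have h2' : (numAbove (bas (Function.update W n t)).neg s : ℝ) ≤ numAbove (bas W).neg s := by
      exact_mod_cast h2
    rw [abs_sub_comm]
    refine le_trans ?_ (le_abs_self _)
    unfold signedCount
    linarith
  · rw [abs_of_nonpos (by linarith)] at ht
    have hj := numAbove_jump (bas W).neg (bas (Function.update W n t)).neg hs hr hg hs' hr1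
      (fun i hi => by
        by_contra hc
        rw [not_le] at hc
        have hv : (bas W).neg.val i = -(bas W).val i := rfl
        rw [hv] at hi hc
        refine hgap i ⟨hi.trans_le (neg_le_abs _), ?_⟩
        rw [abs_of_neg (by linarith)]
        exact hc.le) i₀ (by
        have hv : (bas W).neg.val i₀ = -(bas W).val i₀ := rfl
        rw [hv, abs_neg]
        exact hi₀) (e n) hn (fun u => by
        rw [neg_form, neg_form, hform W (Function.update W n t), hsum]
        nlinarith [sq_nonneg (u (e n))])
    have h2 : numAbove (bas (Function.update W n t)) s ≤ numAbove (bas W) s :=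
      numAbove_mono _ _ _ fun u => by
        rw [hform W (Function.update W n t), hsum]
        nlinarith [sq_nonneg (u (e n))]
    have hj' : (numAbove (bas W).neg s : ℝ) + 1
        ≤ numAbove (bas (Function.update W n t)).neg s := by
      exact_mod_cast hj
    have h2' : (numAbove (bas (Function.update W n t)) s : ℝ) ≤ numAbove (bas W) s := by
      exact_mod_cast h2
    refine le_trans ?_ (le_abs_self _)
    unfold signedCount
    linarith

/-- The probability of an eigenvalue in `[-s, s]` with a spectral gap up to `s'`, when the
eigenvectors are spread out over `N₀` sites of `S`. -/
lemma measure_gap_event_le (ν : κ → Measure ℝ) [∀ i, IsProbabilityMeasure (ν i)]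
    {M ρ g : ℝ} (hM : 0 ≤ M) (hρ : 0 < ρ)
    (hsupp : ∀ n, ν n (Set.Icc 0 M) = 1)
    (hac : ∀ n, ∀ t ∈ Set.Icc (0:ℝ) M, ENNReal.ofReal ρ ≤ ν n {s | g < |s - t|})
    (he : Function.Injective e)
    (hform : ∀ W W' (u : ι → ℝ), u ⬝ᵥ (H W').mulVec u
      = u ⬝ᵥ (H W).mulVec u + ∑ n, (W' n - W n) * u (e n) ^ 2)
    {θ w s s' r N₀ : ℝ} {m : ℕ} {S : Finset κ} (hθ : 0 ≤ θ) (hw : s + 2 * M * (m * θ) < w)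
    (hcard : ∀ W, (∀ n, W n ∈ Set.Icc 0 M) →
      (Finset.univ.filter fun i => |(bas W).val i| ≤ w).card ≤ m)
    (hmass : ∀ W, (∀ n, W n ∈ Set.Icc 0 M) → ∀ i, |(bas W).val i| ≤ w →
      ∑ n ∈ S, specVec (bas W) i (e n) ^ 2 ≤ θ)
    (hs : 0 < s) (hr : 0 < r) (hr1 : r ≤ 1) (hg : 16 * s < g * r ^ 2)
    (hs' : 9 * s ≤ s' * r ^ 2) (hN₀ : 0 < N₀) :
    Measure.pi ν {W | (∀ n, W n ∈ Set.Icc 0 M) ∧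
      (∀ i, ¬(s < |(bas W).val i| ∧ |(bas W).val i| ≤ s')) ∧
      ∃ i, |(bas W).val i| ≤ s ∧
        N₀ ≤ ((S.filter fun n => r ≤ |specVec (bas W) i (e n)|).card : ℝ)}
      ≤ ENNReal.ofReal (4 * m * Real.sqrt S.card / (ρ * N₀)) := by
  set cl : (κ → ℝ) → κ → ℝ := fun W n => clamp M (W n) with hcl
  have hclm : Measurable cl := measurable_pi_lambda _ fun n =>
    (measurable_clamp M).comp (measurable_pi_apply n)
  have hcl0 : ∀ W n, cl W n ∈ Set.Icc 0 M := fun W n => clamp_mem hM _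
  have hcleq : ∀ W, (∀ n, W n ∈ Set.Icc 0 M) → cl W = W := fun W hW =>
    funext fun n => clamp_eq (hW n)
  have hzm : Measurable (setOn S 0 : (κ → ℝ) → κ → ℝ) := measurable_pi_lambda _ fun n => by
    by_cases hn : n ∈ S
    · simp [setOn, hn]
    · simpa [setOn, hn] using measurable_pi_apply n
  have hfm := measurable_signedCount bas he hform s
  set f : (κ → ℝ) → ℝ := fun W => signedCount (bas W) s with hf
  set G : (κ → ℝ) → ℝ := fun W => f (cl W) - f (setOn S 0 (cl W)) with hG
  have hGm : Measurable G := (hfm.comp hclm).sub (hfm.comp (hzm.comp hclm))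
  have hGb : ∀ W, |G W| ≤ 2 * m := fun W =>
    signedCount_range bas he hform hM hθ hs.le hw hcard hmass (hcl0 W)
  have hset : ∀ n ∈ S, ∀ x t, setOn S 0 (cl (Function.update x n t)) = setOn S 0 (cl x) := by
    intro n hn x t
    ext k
    by_cases hk : k ∈ S
    · simp [setOn, hk]
    · have hne : k ≠ n := fun h => hk (h ▸ hn)
      simp [setOn, hk, hcl, Function.update_of_ne hne]
  have hGmono : ∀ n ∈ S, ∀ x, Monotone fun t => G (Function.update x n t) := by
    intro n hn x t t' htt
    simp only [hG, hset n hn]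
    have : f (cl (Function.update x n t)) ≤ f (cl (Function.update x n t')) := by
      refine signedCount_mono bas hform s fun k => ?_
      simp only [hcl]
      by_cases hk : k = n
      · subst hk
        simp only [Function.update_self]
        exact max_le_max le_rfl (min_le_min le_rfl htt)
      · simp [Function.update_of_ne hk]
    linarith
  have hinf := sum_influence_le ν S hGm hGb hGmono
  have hupd : ∀ n : κ, Measurable fun p : (κ → ℝ) × ℝ => Function.update p.1 n p.2 := fun n =>
    measurable_fst.comp (measurePreserving_exchange ν n).measurable
  have hFm : ∀ n, Measurable fun p : (κ → ℝ) × ℝ => |G p.1 - G (Function.update p.1 n p.2)| :=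
    fun n => ((hGm.comp measurable_fst).sub (hGm.comp (hupd n))).abs
  have hFb : ∀ x y, |G x - G y| ≤ 4 * m := fun x y => by
    refine (abs_sub _ _).trans ?_
    linarith [hGb x, hGb y]
  set Φ : (κ → ℝ) → ℝ := fun x => ∑ n ∈ S, ∫ t, |G x - G (Function.update x n t)| ∂ν n with hΦ
  have hΦi : ∀ n, Integrable (fun x => ∫ t, |G x - G (Function.update x n t)| ∂ν n)
      (Measure.pi ν) := fun n => by
    refine Integrable.integral_prod_left (f := fun p : (κ → ℝ) × ℝ =>
      |G p.1 - G (Function.update p.1 n p.2)|) ?_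
    refine integrable_of_abs_le (hFm n) (B := 4 * m) fun p => ?_
    rw [abs_abs]
    exact hFb _ _
  have hΦ0 : ∀ x, 0 ≤ Φ x := fun x => Finset.sum_nonneg fun n _ =>
    integral_nonneg fun t => abs_nonneg _
  have hΦint : ∫ x, Φ x ∂Measure.pi ν ≤ 4 * m * Real.sqrt S.card := by
    rw [hΦ, integral_finsetSum _ fun n _ => hΦi n]
    linarith
  have hsub : {W | (∀ n, W n ∈ Set.Icc 0 M) ∧
      (∀ i, ¬(s < |(bas W).val i| ∧ |(bas W).val i| ≤ s')) ∧
      ∃ i, |(bas W).val i| ≤ s ∧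
        N₀ ≤ ((S.filter fun n => r ≤ |specVec (bas W) i (e n)|).card : ℝ)}
      ⊆ {x | ρ * N₀ ≤ Φ x} := by
    rintro W ⟨hW, hgap, i, hi, hN⟩
    have hone : ∀ n ∈ S.filter fun n => r ≤ |specVec (bas W) i (e n)|,
        ρ ≤ ∫ t, |G W - G (Function.update W n t)| ∂ν n := by
      intro n hn
      obtain ⟨hnS, hnr⟩ := Finset.mem_filter.mp hn
      have hInt : Integrable (fun t => |G W - G (Function.update W n t)|) (ν n) := by
        refine integrable_of_abs_le ?_ (B := 4 * m) fun t => ?_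
        · exact (measurable_const.sub (hGm.comp (measurable_update W))).abs
        · rw [abs_abs]
          exact hFb _ _
      have hmk := mul_meas_ge_le_integral_of_nonneg (μ := ν n)
        (Filter.Eventually.of_forall fun t => abs_nonneg (G W - G (Function.update W n t))) hInt 1
      rw [one_mul] at hmk
      refine le_trans ?_ hmk
      have hsub1 : {t | g < |t - W n|} ⊆
          {t | 1 ≤ |G W - G (Function.update W n t)|} ∪ (Set.Icc 0 M)ᶜ := by
        intro t ht
        by_cases htM : t ∈ Set.Icc 0 M
        · left
          have hupd0 : ∀ k, Function.update W n t k ∈ Set.Icc 0 M := fun k => by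
            by_cases hk : k = n
            · subst hk
              simpa using htM
            · rw [Function.update_of_ne hk]
              exact hW k
          have h1 := one_le_signedCount_sub bas hform hs hr hr1 hg hs' hgap hi hnr ht
          have h2 : G W - G (Function.update W n t) = f W - f (Function.update W n t) := by
            simp only [hG, hset n hnS]
            rw [hcleq W hW, hcleq _ hupd0]
            ring
          change 1 ≤ |G W - G (Function.update W n t)|
          rw [h2]
          exact h1
        · exact Or.inr htM
      have hnull : ν n (Set.Icc 0 M)ᶜ = 0 := by
        rw [prob_compl_eq_zero_iff measurableSet_Icc]
        exact hsupp n
      have hle : ENNReal.ofReal ρ ≤ ν n {t | 1 ≤ |G W - G (Function.update W n t)|} := by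
        refine (hac n (W n) (hW n)).trans ((measure_mono hsub1).trans ?_)
        refine (measure_union_le _ _).trans ?_
        rw [hnull, add_zero]
      exact (ENNReal.ofReal_le_iff_le_toReal (measure_ne_top _ _)).mp hle
    change ρ * N₀ ≤ Φ W
    calc ρ * N₀ ≤ ρ * ((S.filter fun n => r ≤ |specVec (bas W) i (e n)|).card : ℝ) := by gcongr
      _ = ∑ n ∈ S.filter fun n => r ≤ |specVec (bas W) i (e n)|, ρ := by
          rw [Finset.sum_const, nsmul_eq_mul, mul_comm]
      _ ≤ ∑ n ∈ S.filter fun n => r ≤ |specVec (bas W) i (e n)|,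
            ∫ t, |G W - G (Function.update W n t)| ∂ν n := Finset.sum_le_sum hone
      _ ≤ Φ W := Finset.sum_le_sum_of_subset_of_nonneg (Finset.filter_subset _ _)
          fun n _ _ => integral_nonneg fun t => abs_nonneg _
  refine (measure_mono hsub).trans ?_
  have hmk := mul_meas_ge_le_integral_of_nonneg (μ := Measure.pi ν)
    (Filter.Eventually.of_forall hΦ0) (integrable_finsetSum _ fun n _ => hΦi n) (ρ * N₀)
  rw [← ENNReal.ofReal_toReal (measure_ne_top (Measure.pi ν) _)]
  refine ENNReal.ofReal_le_ofReal ?_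
  rw [le_div_iff₀ (by positivity), mul_comm]
  exact hmk.trans hΦint

/-- Wegner estimate: eigenvectors spread out over `N₀` sites make eigenvalues near `0` unlikely. -/
theorem measure_small_eigenvalue_le (ν : κ → Measure ℝ) [∀ i, IsProbabilityMeasure (ν i)]
    {M ρ g : ℝ} (hM : 0 ≤ M) (hρ : 0 < ρ)
    (hsupp : ∀ n, ν n (Set.Icc 0 M) = 1)
    (hac : ∀ n, ∀ t ∈ Set.Icc (0:ℝ) M, ENNReal.ofReal ρ ≤ ν n {s | g < |s - t|})
    (he : Function.Injective e)
    (hform : ∀ W W' (u : ι → ℝ), u ⬝ᵥ (H W').mulVec u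
      = u ⬝ᵥ (H W).mulVec u + ∑ n, (W' n - W n) * u (e n) ^ 2)
    {θ w r N₀ : ℝ} {m : ℕ} {S : Finset κ} {s : ℕ → ℝ} (hθ : 0 ≤ θ)
    (hw : ∀ l ≤ m, s l + 2 * M * (m * θ) < w)
    (hcard : ∀ W, (∀ n, W n ∈ Set.Icc 0 M) →
      (Finset.univ.filter fun i => |(bas W).val i| ≤ w).card ≤ m)
    (hmass : ∀ W, (∀ n, W n ∈ Set.Icc 0 M) → ∀ i, |(bas W).val i| ≤ w →
      ∑ n ∈ S, specVec (bas W) i (e n) ^ 2 ≤ θ)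
    (hs : ∀ l, 0 < s l) (hr : 0 < r) (hr1 : r ≤ 1) (hg : ∀ l < m, 16 * s l < g * r ^ 2)
    (hs' : ∀ l, 9 * s l ≤ s (l + 1) * r ^ 2) (hN₀ : 0 < N₀) (good : Set (κ → ℝ))
    (hgood : ∀ W ∈ good, (∀ n, W n ∈ Set.Icc 0 M) → ∀ i, |(bas W).val i| ≤ w →
      N₀ ≤ ((S.filter fun n => r ≤ |specVec (bas W) i (e n)|).card : ℝ)) :
    Measure.pi ν {W | (∀ n, W n ∈ Set.Icc 0 M) ∧ ∃ i, |(bas W).val i| ≤ s 0}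
      ≤ Measure.pi ν goodᶜ + m * ENNReal.ofReal (4 * m * Real.sqrt S.card / (ρ * N₀)) := by
  set E : ℕ → Set (κ → ℝ) := fun l => {W | (∀ n, W n ∈ Set.Icc 0 M) ∧
      (∀ i, ¬(s l < |(bas W).val i| ∧ |(bas W).val i| ≤ s (l + 1))) ∧
      ∃ i, |(bas W).val i| ≤ s l ∧
        N₀ ≤ ((S.filter fun n => r ≤ |specVec (bas W) i (e n)|).card : ℝ)} with hE
  have hmono : Monotone s := monotone_nat_of_le_succ fun l => by
    have h1 := hs' l
    have h2 : r ^ 2 ≤ 1 := by nlinarith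
    nlinarith [hs l, hs (l + 1)]
  have hsw : ∀ l ≤ m, s l ≤ w := fun l hl => by
    have h1 := hw l hl
    have h2 : 0 ≤ 2 * M * (m * θ) := by positivity
    linarith
  have hsub : {W | (∀ n, W n ∈ Set.Icc 0 M) ∧ ∃ i, |(bas W).val i| ≤ s 0}
      ⊆ goodᶜ ∪ ⋃ l ∈ Finset.range m, E l := by
    rintro W ⟨hW, i₀, hi₀⟩
    by_cases hWg : W ∈ good
    swap
    · exact Or.inl hWg
    right
    by_contra hcon
    have hlev : ∀ l < m, ∃ i, s l < |(bas W).val i| ∧ |(bas W).val i| ≤ s (l + 1) := by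
      intro l hl
      by_contra hno
      push Not at hno
      apply hcon
      simp only [Set.mem_iUnion, Finset.mem_range]
      refine ⟨l, hl, hW, fun i hi => absurd hi.2 (not_le.mpr (hno i hi.1)), i₀,
        hi₀.trans (hmono (Nat.zero_le l)), ?_⟩
      exact hgood W hWg hW i₀ (hi₀.trans (hsw 0 (Nat.zero_le m)))
    have hlev' : ∀ k, ∃ i, k ≤ m → |(bas W).val i| ≤ s k ∧
        (∀ l, l + 1 = k → s l < |(bas W).val i|) := by
      intro k
      rcases k with _ | k
      · exact ⟨i₀, fun _ => ⟨hi₀, fun l hl => by omega⟩⟩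
      · by_cases hk : k + 1 ≤ m
        · obtain ⟨i, h1, h2⟩ := hlev k (by omega)
          exact ⟨i, fun _ => ⟨h2, fun l hl => by
            have : l = k := by omega
            rw [this]
            exact h1⟩⟩
        · exact ⟨i₀, fun h => absurd h hk⟩
    choose φ hφ using hlev'
    have hlt : ∀ j k, j < k → k ≤ m → |(bas W).val (φ j)| < |(bas W).val (φ k)| := by
      intro j k hjk hk
      obtain ⟨l, rfl⟩ : ∃ l, k = l + 1 := ⟨k - 1, by omega⟩
      calc |(bas W).val (φ j)| ≤ s j := (hφ j (by omega)).1
        _ ≤ s l := hmono (by omega)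
        _ < _ := (hφ (l + 1) hk).2 l rfl
    have hinj : Set.InjOn φ (Finset.range (m + 1)) := by
      intro j hj k hk hjk
      simp only [Finset.coe_range, Set.mem_Iio] at hj hk
      rcases lt_trichotomy j k with h | h | h
      · exact absurd (congrArg (fun i => |(bas W).val i|) hjk) (hlt j k h (by omega)).ne
      · exact h
      · exact absurd (congrArg (fun i => |(bas W).val i|) hjk) (hlt k j h (by omega)).ne'
    have h1 := Finset.card_image_of_injOn hinj
    rw [Finset.card_range] at h1
    have h2 : ((Finset.range (m + 1)).image φ).card
        ≤ (Finset.univ.filter fun i => |(bas W).val i| ≤ w).card := by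
      refine Finset.card_le_card fun i hi => ?_
      obtain ⟨k, hk, rfl⟩ := Finset.mem_image.mp hi
      have hk' : k ≤ m := by
        have := Finset.mem_range.mp hk
        omega
      simp only [Finset.mem_filter, Finset.mem_univ, true_and]
      exact (hφ k hk').1.trans (hsw k hk')
    have h3 := hcard W hW
    omega
  refine (measure_mono hsub).trans ((measure_union_le _ _).trans ?_)
  gcongr
  refine (measure_biUnion_finset_le _ _).trans ?_
  calc ∑ l ∈ Finset.range m, Measure.pi ν (E l)
      ≤ ∑ l ∈ Finset.range m, ENNReal.ofReal (4 * m * Real.sqrt S.card / (ρ * N₀)) := by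
        refine Finset.sum_le_sum fun l hl => ?_
        have hlm := Finset.mem_range.mp hl
        exact measure_gap_event_le bas ν hM hρ hsupp hac he hform hθ (hw l hlm.le) hcard hmass
          (hs l) hr hr1 (hg l hlm) (hs' l) hN₀
    _ = _ := by rw [Finset.sum_const, Finset.card_range, nsmul_eq_mul]

end Wegner

/-! ### Eigenfunctions of the truncated Hamiltonian are spread out -/

lemma extV_of_mem {Λ : Finset (ℤ × ℤ)} (ψ : Λ → ℝ) {n : ℤ × ℤ} (h : n ∈ Λ) :
    extV Λ ψ n = ψ ⟨n, h⟩ := dif_pos h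

lemma extV_of_notMem {Λ : Finset (ℤ × ℤ)} (ψ : Λ → ℝ) {n : ℤ × ℤ} (h : n ∉ Λ) :
    extV Λ ψ n = 0 := dif_neg h

lemma ham_mulVec (V : ℤ × ℤ → ℝ) (Λ : Finset (ℤ × ℤ)) (ψ : Λ → ℝ) (n : Λ) :
    (Ham V Λ).mulVec ψ n = (4 + V n) * extV Λ ψ n - extV Λ ψ (n.1.1 + 1, n.1.2)
      - extV Λ ψ (n.1.1 - 1, n.1.2) - extV Λ ψ (n.1.1, n.1.2 + 1)
      - extV Λ ψ (n.1.1, n.1.2 - 1) := by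
  have key : ∀ (p : ℤ × ℤ) (c : ℝ), ∑ y ∈ Λ, (if y = p then c * extV Λ ψ y else 0)
      = c * extV Λ ψ p := fun p c => by
    rw [Finset.sum_ite_eq' Λ p fun y => c * extV Λ ψ y]
    split_ifs with h
    · rfl
    · rw [extV_of_notMem ψ h, mul_zero]
  have h1 : (Ham V Λ).mulVec ψ n = ∑ y ∈ Λ,
      ((if y = n.1 then (4 + V n) * extV Λ ψ y else 0)
        + (if y = (n.1.1 + 1, n.1.2) then (-1) * extV Λ ψ y else 0)
        + (if y = (n.1.1 - 1, n.1.2) then (-1) * extV Λ ψ y else 0)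
        + (if y = (n.1.1, n.1.2 + 1) then (-1) * extV Λ ψ y else 0)
        + (if y = (n.1.1, n.1.2 - 1) then (-1) * extV Λ ψ y else 0)) := by
    rw [← Finset.sum_coe_sort Λ]
    refine Finset.sum_congr rfl fun y _ => ?_
    rw [extV_of_mem ψ y.2]
    obtain ⟨⟨n1, n2⟩, hn⟩ := n
    obtain ⟨⟨y1, y2⟩, hy⟩ := y
    simp only [Ham, Prod.mk.injEq]
    by_cases h0 : n1 = y1 ∧ n2 = y2
    · obtain ⟨rfl, rfl⟩ := h0
      simp [show ¬n1 = n1 - 1 by omega, show ¬n2 = n2 - 1 by omega]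
    rw [if_neg h0, if_neg (show ¬(y1 = n1 ∧ y2 = n2) by omega)]
    by_cases h1 : y1 = n1 + 1 ∧ y2 = n2
    · rw [if_pos (by omega), if_pos h1, if_neg (by omega), if_neg (by omega), if_neg (by omega)]
      ring
    by_cases h2 : y1 = n1 - 1 ∧ y2 = n2
    · rw [if_pos (by omega), if_neg h1, if_pos h2, if_neg (by omega), if_neg (by omega)]
      ring
    by_cases h3 : y1 = n1 ∧ y2 = n2 + 1
    · rw [if_pos (by omega), if_neg h1, if_neg h2, if_pos h3, if_neg (by omega)]
      ring
    by_cases h4 : y1 = n1 ∧ y2 = n2 - 1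
    · rw [if_pos (by omega), if_neg h1, if_neg h2, if_neg h3, if_pos h4]
      ring
    rw [if_neg (by omega), if_neg h1, if_neg h2, if_neg h3, if_neg h4]
    ring
  rw [h1]
  simp only [Finset.sum_add_distrib, key]
  ring

lemma eigOn_of_mulVec {V : ℤ × ℤ → ℝ} {Λ : Finset (ℤ × ℤ)} {ψ : Λ → ℝ} {E : ℝ}
    (h : (Ham V Λ).mulVec ψ = E • ψ) : EigOn V E (extV Λ ψ) Λ := by
  intro n hn
  have := congrFun h ⟨n, hn⟩
  rw [ham_mulVec] at this
  rw [this, extV_of_mem ψ hn]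
  rfl

lemma abs_le_of_eigOn {V ψ : ℤ × ℤ → ℝ} {Λ : Finset (ℤ × ℤ)} {E M : ℝ}
    (hV : ∀ n ∈ Λ, V n ∈ Set.Icc 0 M) (h : EigOn V E ψ Λ) (h0 : ∀ n, n ∉ Λ → ψ n = 0)
    (hne : ∃ n, ψ n ≠ 0) : |E| ≤ M + 8 := by
  have hΛ : Λ.Nonempty := by
    obtain ⟨n, hn⟩ := hne
    exact ⟨n, by_contra fun hc => hn (h0 n hc)⟩
  obtain ⟨n, hn, hmax⟩ := Finset.exists_max_image Λ (fun n => |ψ n|) hΛ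
  have hall : ∀ y, |ψ y| ≤ |ψ n| := fun y => by
    by_cases hy : y ∈ Λ
    · exact hmax y hy
    · rw [h0 y hy, abs_zero]
      exact abs_nonneg _
  have hpos : 0 < |ψ n| := by
    obtain ⟨y, hy⟩ := hne
    exact (abs_pos.mpr hy).trans_le (hall y)
  have he := h n hn
  have h1 := abs_le.mp (hall (n.1 + 1, n.2))
  have h2 := abs_le.mp (hall (n.1 - 1, n.2))
  have h3 := abs_le.mp (hall (n.1, n.2 + 1))
  have h4 := abs_le.mp (hall (n.1, n.2 - 1))
  have h5 : |(4 + V n) * ψ n| ≤ (4 + M) * |ψ n| := by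
    rw [abs_mul, abs_of_nonneg (by linarith [(hV n hn).1])]
    exact mul_le_mul_of_nonneg_right (by linarith [(hV n hn).2]) (abs_nonneg _)
  have h6 : |E| * |ψ n| ≤ (M + 8) * |ψ n| := by
    rw [← abs_mul, ← he]
    have h7 := abs_le.mp h5
    rw [abs_le]
    constructor <;> linarith
  exact le_of_mul_le_mul_right h6 hpos

lemma EigOn.smul {V ψ : ℤ × ℤ → ℝ} {S : Set (ℤ × ℤ)} {E : ℝ} (h : EigOn V E ψ S) (t : ℝ) :
    EigOn V E (fun n => t * ψ n) S := by
  intro n hn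
  have := h n hn
  linear_combination t * this

/-- An eigenfunction which exceeds `r` at few free sites outside of the defects is tiny. -/
theorem eigenfunction_small_of_few {ψ V : ℤ × ℤ → ℝ} {lam Ebar A Θ γ κ ρ c₀ η r N₀ : ℝ}
    {F : Set (ℤ × ℤ)} {a b : ℤ} {L₀ K D amax J : ℕ} {Λ' : Fin K → Finset (ℤ × ℤ)}
    (hJ : 1 ≤ J) (hD : 1 ≤ D)
    (hΛ' : ∀ k, ∃ a' b' : ℤ, Λ' k = sqZ a' b' (2 ^ (J + 4)))
    (hL : 16 * 2 ^ (J + 3) * (K + 1) ≤ L₀)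
    (hE : EigOn V lam ψ (sqZ a b L₀)) (h0 : ∀ n, n ∉ sqZ a b L₀ → ψ n = 0)
    (hV : ∀ n ∈ sqZ a b L₀, |4 + V n - lam| ≤ A) (hV' : ∀ n ∈ sqZ a b L₀, |4 + V n - Ebar| ≤ A)
    (hA : 0 ≤ A) (hγ : 0 < γ) (hγ1 : γ ≤ 1) (hlam : |lam - Ebar| ≤ κ)
    (hΘ : 64 * 2 ^ J * (A + 2) ≤ Θ) (hΘγ : 128 / γ ≤ Θ)
    (hκ : ∀ b, b ≤ Nat.sqrt (2 ^ J) → 4 * 2 ^ J * (κ * (2 * Θ ^ (b + 1))) ≤ hopMesh b Θ γ)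
    (hρ : 0 < ρ) (hρ1 : ρ ≤ 1) (hc₀ρ : c₀ ≤ ρ / 100) (hη : 0 ≤ η) (hηc : η ≤ c₀)
    (hgood : HopAll (tiltC V Ebar) F (sqZ a b L₀) D amax ρ Θ γ) (hamax : 4 * 2 ^ J ≤ amax)
    (hreg : ∀ a'' b'' : ℤ, (sqZ a'' b'' (2 ^ (J + 4)) : Set (ℤ × ℤ)) ⊆
      (sqZ a b L₀ : Set (ℤ × ℤ)) \ (⋃ k, (Λ' k : Set (ℤ × ℤ))) →
      RegularIn η F (sqZ a'' b'' (2 ^ (J + 4)) : Set (ℤ × ℤ)))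
    (hr : 0 < r)
    (hfew : ((((sqZ a b L₀).filter fun n => n ∉ F ∧ n ∉ ⋃ k, (Λ' k : Set (ℤ × ℤ))).filter
      fun n => r ≤ |ψ n|).card : ℝ) ≤ N₀)
    (hcount : ∑ j ∈ Finset.Icc 1 J, N₀ * (2 * (4 * 2 ^ j : ℕ) + 1) ^ 2 / badLim ρ D (2 ^ j)
      + 49 * (η * 2 ^ (2 * J + 8)) < (2 : ℝ) ^ (2 * J)) (g : ℤ × ℤ) :
    |ψ g| ≤ r * Θ ^ (48 * 2 ^ J) * (A + 3) ^ (17 * 2 ^ (J + 3) * (K + 1)) := by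
  have hΘ0 : 0 ≤ Θ := le_trans (by positivity) hΘ
  have h2l : 2 * 2 ^ (J + 3) = 2 ^ (J + 4) := by ring
  refine eigenfunction_small (l := 2 ^ (J + 3)) Nat.one_le_two_pow (by rw [h2l]; exact hΛ') hL hE h0 hV hA
    (by positivity) (fun a'' b'' hsub => ?_) g
  rw [h2l] at hsub
  have hc := centre_small (a := a'') (b := b'') (F := F) (Bn := ((sqZ a b L₀).filter fun n =>
      n ∉ F ∧ n ∉ ⋃ k, (Λ' k : Set (ℤ × ℤ))).filter fun n => r ≤ |ψ n|) hJ hD (hE.smul r⁻¹)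
    (fun y hy => (hsub hy).1) hV hV' hA hγ hγ1 hlam hΘ hΘγ hκ hρ hρ1 hc₀ρ hη hηc hgood hamax
    (hreg a'' b'' hsub)
    (fun y hy hyF h1 => by
      have hm := hsub hy
      rw [abs_mul, abs_of_pos (inv_pos.mpr hr), inv_mul_eq_div, lt_div_iff₀ hr, one_mul] at h1
      simp only [Finset.mem_filter]
      exact ⟨⟨hm.1, hyF, hm.2⟩, h1.le⟩)
    (by
      refine lt_of_le_of_lt ?_ hcount
      gcongr with j hj
      exact (badLim_pos hρ hD).le)
  rw [abs_mul, abs_of_pos (inv_pos.mpr hr), inv_mul_eq_div, div_le_iff₀ hr] at hc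
  push_cast
  rw [mul_comm r]
  exact hc

/-! ### The probability that all hop events hold -/

/-- The potential which is `v` on `F` and `W` on the free sites of `Λ`. -/
def freePot (v : ℤ × ℤ → ℝ) (F : Set (ℤ × ℤ)) (Λ : Finset (ℤ × ℤ))
    (W : (Λ.filter (· ∉ F) : Finset (ℤ × ℤ)) → ℝ) : ℤ × ℤ → ℝ :=
  fun n => if n ∈ F then v n else extV (Λ.filter (· ∉ F)) W n

section HopAll

variable {v : ℤ × ℤ → ℝ} {F : Set (ℤ × ℤ)} {Λ : Finset (ℤ × ℤ)} {M : ℝ}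

lemma freePot_free (W : (Λ.filter (· ∉ F) : Finset (ℤ × ℤ)) → ℝ)
    (n : (Λ.filter (· ∉ F) : Finset (ℤ × ℤ))) : freePot v F Λ W n = W n := by
  have h := (Finset.mem_filter.mp n.2).2
  unfold freePot
  rw [if_neg h]
  exact dif_pos n.2

lemma freePot_mem (hM : 0 ≤ M) (hv : ∀ n ∈ F, v n ∈ Set.Icc 0 M)
    {W : (Λ.filter (· ∉ F) : Finset (ℤ × ℤ)) → ℝ} (hW : ∀ n, W n ∈ Set.Icc 0 M) (n : ℤ × ℤ) :
    freePot v F Λ W n ∈ Set.Icc 0 M := by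
  unfold freePot extV
  split_ifs with h1 h2
  exacts [hv n h1, hW _, ⟨le_rfl, hM⟩]

/-- The free potential with values truncated to `[0, M]`. -/
def clampPot (M : ℝ) (v : ℤ × ℤ → ℝ) (F : Set (ℤ × ℤ)) (Λ : Finset (ℤ × ℤ))
    (W : (Λ.filter (· ∉ F) : Finset (ℤ × ℤ)) → ℝ) : ℤ × ℤ → ℝ :=
  freePot v F Λ fun n => clamp M (W n)

lemma clampPot_eq {W : (Λ.filter (· ∉ F) : Finset (ℤ × ℤ)) → ℝ} (hW : ∀ n, W n ∈ Set.Icc 0 M) :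
    clampPot M v F Λ W = freePot v F Λ W := by
  unfold clampPot
  congr 1
  exact funext fun n => clamp_eq (hW n)

lemma clampPot_mem (hM : 0 ≤ M) (hv : ∀ n ∈ F, v n ∈ Set.Icc 0 M)
    (W : (Λ.filter (· ∉ F) : Finset (ℤ × ℤ)) → ℝ) (n : ℤ × ℤ) :
    clampPot M v F Λ W n ∈ Set.Icc 0 M :=
  freePot_mem hM hv (fun _ => clamp_mem hM _) n

lemma measurable_clampPot (n : ℤ × ℤ) : Measurable fun W => clampPot M v F Λ W n := by
  unfold clampPot freePot extV
  split_ifs with h1 h2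
  · exact measurable_const
  · exact (measurable_clamp M).comp (measurable_pi_apply _)
  · exact measurable_const

lemma clampPot_update_same [DecidableEq (Λ.filter (· ∉ F) : Finset (ℤ × ℤ))]
    (W : (Λ.filter (· ∉ F) : Finset (ℤ × ℤ)) → ℝ)
    (n : (Λ.filter (· ∉ F) : Finset (ℤ × ℤ))) (t : ℝ) :
    clampPot M v F Λ (Function.update W n t) n = clamp M t := by
  unfold clampPot
  rw [freePot_free, Function.update_self]

lemma clampPot_update_ne [DecidableEq (Λ.filter (· ∉ F) : Finset (ℤ × ℤ))]
    (W : (Λ.filter (· ∉ F) : Finset (ℤ × ℤ)) → ℝ)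
    (n : (Λ.filter (· ∉ F) : Finset (ℤ × ℤ))) (t : ℝ) {k : ℤ × ℤ} (hk : k ≠ n) :
    clampPot M v F Λ (Function.update W n t) k = clampPot M v F Λ W k := by
  unfold clampPot freePot extV
  split_ifs with h1 h2
  · rfl
  · show clamp M _ = clamp M _
    rw [Function.update_of_ne]
    exact fun hc => hk (congrArg Subtype.val hc)
  · rfl

theorem measure_not_hopAll_le {γ₀ γ ρ A Θ Ebar P : ℝ} {D amax : ℕ}
    (ν : (Λ.filter (· ∉ F) : Finset (ℤ × ℤ)) → Measure ℝ) [∀ i, IsProbabilityMeasure (ν i)]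
    (hM : 0 ≤ M) (hρ0 : 0 ≤ ρ) (hρ1 : ρ ≤ 1) (hγ : γ ≤ γ₀) (hγ0 : 0 < γ)
    (hsupp : ∀ i, ν i (Set.Icc 0 M) = 1)
    (hac : ∀ i, ∀ t ∈ Set.Icc (0:ℝ) M, ENNReal.ofReal ρ ≤ ν i {s | γ₀ / 2 < |s - t|})
    (hv : ∀ n ∈ F, v n ∈ Set.Icc 0 M) (hD : 1 ≤ D)
    (hA : M + 4 + |Ebar| ≤ A) (hΘ : 16 * amax * (A + 2) ≤ Θ)
    (hP : ∀ a b : ℕ, 32 * D ^ 2 ≤ a → a ≤ amax → 1 ≤ b → b ^ 2 * D ^ 2 ≤ a →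
      b * (2 * hopCount b Θ γ + 1 : ℕ) ^ (b + 2) * Real.exp (-(ρ * a / 16)) ≤ P) :
    Measure.pi ν {W | ¬ HopAll (tiltC (clampPot M v F Λ W) Ebar) F Λ D amax ρ Θ γ}
      ≤ ENNReal.ofReal (4 * Λ.card * (amax + 1) ^ 2 * P) := by
  have hA0 : 0 ≤ A := le_trans (by positivity) hA
  set I : Finset ((Bool × Bool) × (ℤ × ℤ) × ℕ × ℕ) :=
    (Finset.univ ×ˢ Λ ×ˢ Finset.range (amax + 1) ×ˢ Finset.range (amax + 1)).filter fun i =>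
      32 * D ^ 2 ≤ i.2.2.1 ∧ 1 ≤ i.2.2.2 ∧ i.2.2.2 ^ 2 * D ^ 2 ≤ i.2.2.1 ∧
      ∀ p ≤ i.2.2.1, ∀ q ≤ i.2.2.2 + 1, p % 2 = q % 2 →
        untilt (frame i.1.1 i.1.2 (tilt i.2.1) p q) ∈ Λ with hI
  have hsub : {W | ¬ HopAll (tiltC (clampPot M v F Λ W) Ebar) F Λ D amax ρ Θ γ} ⊆
      ⋃ i ∈ I, {W | ¬ HopGood (fun p q => tiltC (clampPot M v F Λ W) Ebar
        (frame i.1.1 i.1.2 (tilt i.2.1) p q)) (frameSet (tiltF F) i.1.1 i.1.2 (tilt i.2.1))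
        i.2.2.1 i.2.2.2 ⌊ρ * i.2.2.1 / 16⌋₊ Θ γ} := by
    intro W hW
    have hW : ¬ HopAll _ _ _ _ _ _ _ _ := hW
    unfold HopAll at hW
    push Not at hW
    obtain ⟨σ, τ, x, a, b, hx, ha, ham, hb, hba, hmem, hbad⟩ := hW
    have hx0 : frame σ τ x 0 0 = x := by cases σ <;> cases τ <;> simp [frame]
    have hxt : tilt (untilt x) = x := tilt_untilt hx
    have hxΛ : untilt x ∈ Λ := by
      have := hmem 0 (by omega) 0 (by omega) rfl
      rwa [hx0] at this
    have hD2 : 1 ≤ D ^ 2 := Nat.one_le_pow _ _ hD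
    have hbam : b ≤ amax := by nlinarith
    simp only [Set.mem_iUnion]
    refine ⟨((σ, τ), untilt x, a, b), ?_, ?_⟩
    · simp only [hI, Finset.mem_filter, Finset.mem_product, Finset.mem_univ, true_and,
        Finset.mem_range, hxt]
      exact ⟨⟨hxΛ, by omega, by omega⟩, ha, hb, hba, hmem⟩
    · show ¬ _
      simp only [hxt]
      exact hbad
  have hbound : ∀ i ∈ I, Measure.pi ν {W | ¬ HopGood (fun p q => tiltC (clampPot M v F Λ W) Ebar
        (frame i.1.1 i.1.2 (tilt i.2.1) p q)) (frameSet (tiltF F) i.1.1 i.1.2 (tilt i.2.1))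
        i.2.2.1 i.2.2.2 ⌊ρ * i.2.2.1 / 16⌋₊ Θ γ} ≤ ENNReal.ofReal P := by
    rintro ⟨⟨σ, τ⟩, n, a, b⟩ hi
    simp only [hI, Finset.mem_filter, Finset.mem_product, Finset.mem_univ, true_and,
        Finset.mem_range] at hi
    obtain ⟨⟨hn, ham, -⟩, ha, hb, hba, hmem⟩ := hi
    have hD2 : 1 ≤ D ^ 2 := Nat.one_le_pow _ _ hD
    have hfree : ∀ p q, p ≤ a → q ≤ b + 1 → p % 2 = q % 2 →
        (p, q) ∉ frameSet (tiltF F) σ τ (tilt n) →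
        untilt (frame σ τ (tilt n) p q) ∈ Λ.filter (· ∉ F) := by
      intro p q hp hq hpq hF
      refine Finset.mem_filter.mpr ⟨hmem p hp q hq hpq, fun hc => hF ⟨?_, hc⟩⟩
      exact (frame_parity σ τ _ (tilt_even n) p q).mpr hpq
    by_cases hne : Nonempty (Λ.filter (· ∉ F) : Finset (ℤ × ℤ))
    swap
    · have hemp : {W | ¬ HopGood (fun p q => tiltC (clampPot M v F Λ W) Ebar
          (frame σ τ (tilt n) p q)) (frameSet (tiltF F) σ τ (tilt n)) a b ⌊ρ * a / 16⌋₊ Θ γ}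
          = ∅ := by
        refine Set.eq_empty_of_forall_notMem fun W hW => hW ?_
        intro q₀ hq₀ k _ _ _ hcard
        have hpos : 0 < (hopSites (frameSet (tiltF F) σ τ (tilt n)) a q₀).card := by omega
        obtain ⟨p, hp⟩ := Finset.card_pos.mp hpos
        simp only [hopSites, Finset.mem_filter, Finset.mem_Ico] at hp hq₀
        exact absurd ⟨⟨_, hfree p q₀ (by omega) (by omega) hp.2.1 hp.2.2⟩⟩ hne
      simp only at hemp ⊢
      rw [hemp]
      simp
    obtain ⟨d⟩ := hne
    refine (measure_hop_fail_le (A := A) (Θ := Θ) ν hρ0 hρ1 hγ hγ0 hsupp hac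
      (fun W p q => tiltC (clampPot M v F Λ W) Ebar (frame σ τ (tilt n) p q))
      (frameSet (tiltF F) σ τ (tilt n)) a b ⌊ρ * a / 16⌋₊
      (fun p q => if h : untilt (frame σ τ (tilt n) p q) ∈ Λ.filter (· ∉ F) then ⟨_, h⟩ else d)
      ?_ (by omega) hA0 ?_ ?_ (Nat.floor_le (by positivity)) ?_).trans ?_
    · intro p q
      unfold tiltC tiltU
      split_ifs
      · exact (measurable_const.add (measurable_clampPot _)).sub measurable_const
      · exact measurable_const
    · intro W p q _ _
      show |tiltC _ _ _| ≤ A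
      unfold tiltC tiltU
      split_ifs
      · have h1 := clampPot_mem (Λ := Λ) hM hv W (untilt (frame σ τ (tilt n) p q))
        have h2 := abs_le.mp (le_refl |Ebar|)
        rw [abs_le]
        constructor <;> linarith [h1.1, h1.2, h2.1, h2.2]
      · rwa [abs_zero]
    · refine le_trans ?_ hΘ
      gcongr
      omega
    · intro p q hp1 hpa hq2 hqb hF hpq W
      have hm := hfree p q hpa.le (by omega) hpq hF
      have heven := (frame_parity σ τ _ (tilt_even n) p q).mpr hpq
      intro t
      simp only [dif_pos hm]
      refine ⟨fun p' q' hne => ?_, 4 - Ebar, fun t => ?_⟩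
      · unfold tiltC tiltU
        split_ifs with he
        · refine congrArg (fun z => 4 + z - Ebar)
            (@clampPot_update_ne v F Λ M (fun x y => Classical.propDecidable (x = y)) W ⟨_, hm⟩ t _ fun hc => hne ?_)
          have h1 := congrArg tilt hc
          rw [tilt_untilt he, tilt_untilt heven] at h1
          obtain ⟨rfl, rfl⟩ := frame_inj σ τ (tilt n) h1
          rfl
        · rfl
      · unfold tiltC
        rw [tiltU_even _ heven]
        refine (congrArg (fun z => 4 + z - Ebar)
          (@clampPot_update_same v F Λ M (fun x y => Classical.propDecidable (x = y)) W ⟨_, hm⟩ t)).trans ?_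
        ring
    · rw [← ENNReal.ofReal_natCast b, ← ENNReal.ofReal_natCast (2 * hopCount b Θ γ + 1),
        ← ENNReal.ofReal_pow (by positivity), ← ENNReal.ofReal_mul (by positivity),
        ← ENNReal.ofReal_mul (by positivity)]
      exact ENNReal.ofReal_le_ofReal (hP a b ha (by omega) hb hba)
  refine (measure_mono hsub).trans ((measure_biUnion_finset_le _ _).trans
    ((Finset.sum_le_sum hbound).trans ?_))
  rw [Finset.sum_const, nsmul_eq_mul]
  have hcard : I.card ≤ 4 * Λ.card * (amax + 1) ^ 2 := by
    refine (Finset.card_filter_le _ _).trans (le_of_eq ?_)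
    simp only [Finset.card_product, Finset.card_univ, Fintype.card_prod, Fintype.card_bool,
      Finset.card_range]
    ring
  rw [ENNReal.ofReal_mul (by positivity)]
  gcongr
  rw [← ENNReal.ofReal_natCast]
  refine ENNReal.ofReal_le_ofReal ?_
  exact_mod_cast hcard

end HopAll

/-! ### The Wegner estimate with abstract parameters -/

lemma ham_isHermitian (V : ℤ × ℤ → ℝ) (Λ : Finset (ℤ × ℤ)) : (Ham V Λ).IsHermitian := by
  ext x y
  simp only [Matrix.conjTranspose_apply, star_trivial, Ham]
  by_cases h : (x : ℤ × ℤ) = y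
  · simp [h]
  · rw [if_neg h, if_neg (Ne.symm h)]
    congr 1
    apply propext
    constructor <;> intro h <;> omega

lemma shifted_isHermitian (V : ℤ × ℤ → ℝ) (Λ : Finset (ℤ × ℤ)) (E : ℝ) :
    (Ham V Λ - E • (1 : Matrix Λ Λ ℝ)).IsHermitian := by
  refine (ham_isHermitian V Λ).sub ?_
  rw [Matrix.IsHermitian, Matrix.conjTranspose_smul, Matrix.conjTranspose_one, star_trivial]

lemma ham_mulVec_of_shifted {V : ℤ × ℤ → ℝ} {Λ : Finset (ℤ × ℤ)} {E t : ℝ} {u : Λ → ℝ}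
    (h : (Ham V Λ - E • (1 : Matrix Λ Λ ℝ)).mulVec u = t • u) :
    (Ham V Λ).mulVec u = (E + t) • u := by
  rw [Matrix.sub_mulVec, Matrix.smul_mulVec, Matrix.one_mulVec] at h
  rw [add_smul, ← h]
  abel

lemma EigBasis.resolvent {ι : Type*} [Fintype ι] [DecidableEq ι] {A : Matrix ι ι ℝ}
    (hA : EigBasis A) {s : ℝ} (hs : 0 < s) (h : ∀ i, s < |hA.val i|) :
    IsUnit A.det ∧ ∀ u : ι → ℝ, Real.sqrt (∑ z, (A⁻¹.mulVec u) z ^ 2)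
      ≤ s⁻¹ * Real.sqrt (∑ z, u z ^ 2) := by
  have hexp : ∀ u : ι → ℝ, s ^ 2 * ∑ z, u z ^ 2 ≤ ∑ z, (A.mulVec u) z ^ 2 := fun u => by
    set c : ι → ℝ := fun i => specVec hA i ⬝ᵥ u with hc
    have hu : specComb hA c = u := specComb_repr hA u
    have hAu : A.mulVec u = specComb hA fun i => hA.val i * c i := by
      rw [← hu]
      simp [specComb, Matrix.mulVec_sum, Matrix.mulVec_smul, mulVec_specVec, smul_smul, mul_comm]
    rw [hAu, specComb_sq]
    conv_lhs => rw [← hu]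
    rw [specComb_sq, Finset.mul_sum]
    refine Finset.sum_le_sum fun i _ => ?_
    rw [mul_pow]
    refine mul_le_mul_of_nonneg_right ?_ (sq_nonneg _)
    rw [← sq_abs (hA.val i)]
    exact pow_le_pow_left₀ hs.le (h i).le 2
  have hunit : IsUnit A := by
    rw [← Matrix.mulVec_injective_iff_isUnit]
    intro u u' huu
    have h0 : A.mulVec (u - u') = 0 := by
      rw [Matrix.mulVec_sub]
      exact sub_eq_zero.mpr huu
    have h1 := hexp (u - u')
    rw [h0] at h1
    simp only [Pi.zero_apply, ne_eq, OfNat.ofNat_ne_zero, not_false_eq_true, zero_pow,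
      Finset.sum_const_zero] at h1
    have h2 : ∑ z, (u - u') z ^ 2 ≤ 0 := by
      by_contra hc
      rw [not_le] at hc
      have := mul_pos (pow_pos hs 2) hc
      linarith
    have h3 := (Finset.sum_eq_zero_iff_of_nonneg fun z _ => sq_nonneg _).mp
      (le_antisymm h2 (Finset.sum_nonneg fun z _ => sq_nonneg ((u - u') z)))
    exact funext fun z => sub_eq_zero.mp (pow_eq_zero_iff two_ne_zero |>.mp (h3 z (Finset.mem_univ z)))
  have hdet := (Matrix.isUnit_iff_isUnit_det A).mp hunit
  refine ⟨hdet, fun u => ?_⟩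
  have h1 := hexp (A⁻¹.mulVec u)
  rw [Matrix.mulVec_mulVec, Matrix.mul_nonsing_inv A hdet, Matrix.one_mulVec] at h1
  rw [← div_eq_inv_mul, le_div_iff₀ hs]
  refine Real.le_sqrt_of_sq_le ?_
  rw [mul_pow, Real.sq_sqrt (Finset.sum_nonneg fun z _ => sq_nonneg _), mul_comm]
  exact h1

section Assembly

variable {v : ℤ × ℤ → ℝ} {F : Set (ℤ × ℤ)} {Λ : Finset (ℤ × ℤ)}

/-- The inclusion of the free sites. -/
def freeIncl (F : Set (ℤ × ℤ)) (Λ : Finset (ℤ × ℤ))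
    (n : (Λ.filter (· ∉ F) : Finset (ℤ × ℤ))) : Λ := ⟨n, (Finset.mem_filter.mp n.2).1⟩

lemma freeIncl_injective : Function.Injective (freeIncl F Λ) := fun _ _ h =>
  Subtype.ext (congrArg (fun z : Λ => (z : ℤ × ℤ)) h)

lemma shifted_form (E : ℝ) (W W' : (Λ.filter (· ∉ F) : Finset (ℤ × ℤ)) → ℝ) (u : Λ → ℝ) :
    u ⬝ᵥ (Ham (freePot v F Λ W') Λ - E • (1 : Matrix Λ Λ ℝ)).mulVec u
      = u ⬝ᵥ (Ham (freePot v F Λ W) Λ - E • (1 : Matrix Λ Λ ℝ)).mulVec u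
        + ∑ n, (W' n - W n) * u (freeIncl F Λ n) ^ 2 := by
  set f : ℤ × ℤ → ℝ := fun n =>
    (freePot v F Λ W' n - freePot v F Λ W n) * extV Λ u n ^ 2 with hf
  have h1 : ∑ n, (W' n - W n) * u (freeIncl F Λ n) ^ 2 = ∑ x : Λ, f x := by
    have e1 : ∑ n, (W' n - W n) * u (freeIncl F Λ n) ^ 2
        = ∑ n : (Λ.filter (· ∉ F) : Finset (ℤ × ℤ)), f n := by
      refine Finset.sum_congr rfl fun n _ => ?_
      simp only [hf, freePot_free]
      rw [extV_of_mem u (Finset.mem_filter.mp n.2).1]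
      rfl
    rw [e1, Finset.sum_coe_sort (Λ.filter (· ∉ F)) f, Finset.sum_coe_sort Λ f]
    refine Finset.sum_filter_of_ne fun n _ hne hF => hne ?_
    simp only [hf, freePot, if_pos hF, sub_self, zero_mul]
  rw [h1]
  simp only [Matrix.sub_mulVec, dotProduct_sub]
  have h2 : u ⬝ᵥ (Ham (freePot v F Λ W') Λ).mulVec u
      = u ⬝ᵥ (Ham (freePot v F Λ W) Λ).mulVec u + ∑ x : Λ, f x := by
    simp only [dotProduct]
    rw [← Finset.sum_add_distrib]
    refine Finset.sum_congr rfl fun x _ => ?_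
    simp only [ham_mulVec, hf]
    rw [extV_of_mem u x.2]
    ring
  rw [h2]
  ring

end Assembly

lemma sqZ_card (a b : ℤ) (L : ℕ) : (sqZ a b L).card = L ^ 2 := by
  simp [sqZ, Finset.card_product, Int.card_Icc, sq]

theorem wegner_of_bounds {M γ₀ γ ρ Ebar A Θ η c₀ θ w r N₀ P : ℝ} (hM : 0 < M) (hρ : 0 < ρ)
    (hρ1 : ρ ≤ 1) (hγ : γ ≤ γ₀) (hγ0 : 0 < γ) (hγ1 : γ ≤ 1)
    (μ : ℤ × ℤ → Measure ℝ) [∀ n, IsProbabilityMeasure (μ n)]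
    (hsupp : ∀ n, μ n (Set.Icc 0 M) = 1)
    (hac : ∀ n, ∀ t ∈ Set.Icc (0:ℝ) M, ENNReal.ofReal ρ ≤ μ n {s | γ₀ / 2 < |s - t|})
    {a b : ℤ} {L₀ K D J m : ℕ} {Λ' : Fin K → Finset (ℤ × ℤ)} {G : Finset (ℤ × ℤ)}
    {F : Set (ℤ × ℤ)} {v : ℤ × ℤ → ℝ} {s : ℕ → ℝ}
    (hJ : 1 ≤ J) (hD : 1 ≤ D)
    (hΛ' : ∀ k, ∃ a' b' : ℤ, Λ' k = sqZ a' b' (2 ^ (J + 4)))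
    (hL : 16 * 2 ^ (J + 3) * (K + 1) ≤ L₀)
    (hreg : ∀ a'' b'' : ℤ, (sqZ a'' b'' (2 ^ (J + 4)) : Set (ℤ × ℤ)) ⊆
      (sqZ a b L₀ : Set (ℤ × ℤ)) \ (⋃ k, (Λ' k : Set (ℤ × ℤ))) →
      RegularIn η F (sqZ a'' b'' (2 ^ (J + 4)) : Set (ℤ × ℤ)))
    (hv : ∀ n ∈ F, v n ∈ Set.Icc (0:ℝ) M)
    (hloc : ∀ V : ℤ × ℤ → ℝ, (∀ n ∈ sqZ a b L₀, V n ∈ Set.Icc (0:ℝ) M) →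
      (∀ n ∈ sqZ a b L₀, n ∈ F → V n = v n) → ∀ E : ℝ, |E - Ebar| ≤ w →
      ∀ ψ : sqZ a b L₀ → ℝ, (Ham V (sqZ a b L₀)).mulVec ψ = E • ψ → ∑ z, ψ z ^ 2 = 1 →
      ∑ z : sqZ a b L₀, (if (z : ℤ × ℤ) ∈ (⋃ k, (Λ' k : Set (ℤ × ℤ))) then 0 else ψ z ^ 2) ≤ θ ∧
      1 / 4 ≤ ∑ z : sqZ a b L₀, (if (z : ℤ × ℤ) ∈ G then ψ z ^ 2 else 0))
    (hA : 2 * M + 14 ≤ A) (hw1 : w ≤ 1)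
    (hΘ : 64 * 2 ^ J * (A + 2) ≤ Θ) (hΘγ : 128 / γ ≤ Θ)
    (hκ : ∀ b, b ≤ Nat.sqrt (2 ^ J) → 4 * 2 ^ J * (w * (2 * Θ ^ (b + 1))) ≤ hopMesh b Θ γ)
    (hc₀ρ : c₀ ≤ ρ / 100) (hη : 0 ≤ η) (hηc : η ≤ c₀)
    (hcount : ∑ j ∈ Finset.Icc 1 J, N₀ * (2 * (4 * 2 ^ j : ℕ) + 1) ^ 2 / badLim ρ D (2 ^ j)
      + 49 * (η * 2 ^ (2 * J + 8)) < (2 : ℝ) ^ (2 * J))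
    (hP : ∀ a b : ℕ, 32 * D ^ 2 ≤ a → a ≤ 4 * 2 ^ J → 1 ≤ b → b ^ 2 * D ^ 2 ≤ a →
      b * (2 * hopCount b Θ γ + 1 : ℕ) ^ (b + 2) * Real.exp (-(ρ * a / 16)) ≤ P)
    (hm : m = 4 * G.card) (hθ : 0 ≤ θ) (hw : ∀ l ≤ m, s l + 2 * M * (m * θ) < w)
    (hs : ∀ l, 0 < s l) (hr : 0 < r) (hr1 : r ≤ 1) (hg : ∀ l < m, 16 * s l < γ₀ / 2 * r ^ 2)
    (hs' : ∀ l, 9 * s l ≤ s (l + 1) * r ^ 2) (hN₀ : 0 < N₀)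
    (hX : G.card * (r * Θ ^ (48 * 2 ^ J) * (A + 3) ^ (17 * 2 ^ (J + 3) * (K + 1))) ^ 2 < 1 / 4) :
    1 - (ENNReal.ofReal (4 * (L₀ ^ 2 : ℕ) * (4 * 2 ^ J + 1) ^ 2 * P)
        + m * ENNReal.ofReal (4 * m * L₀ / (ρ * N₀)))
      ≤ Measure.pi (fun n : ((sqZ a b L₀).filter (· ∉ F) : Finset (ℤ × ℤ)) => μ n.1)
        {W | IsUnit (Ham (freePot v F (sqZ a b L₀) W) (sqZ a b L₀)
                - Ebar • (1 : Matrix (sqZ a b L₀) (sqZ a b L₀) ℝ)).det ∧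
            ∀ ψ : sqZ a b L₀ → ℝ,
              Real.sqrt (∑ z : sqZ a b L₀,
                (((Ham (freePot v F (sqZ a b L₀) W) (sqZ a b L₀)
                    - Ebar • (1 : Matrix (sqZ a b L₀) (sqZ a b L₀) ℝ))⁻¹.mulVec ψ) z) ^ 2) ≤
                (s 0)⁻¹ * Real.sqrt (∑ z : sqZ a b L₀, ψ z ^ 2)} := by
  set Λ := sqZ a b L₀ with hΛ
  set κ := ((Λ.filter (· ∉ F) : Finset (ℤ × ℤ)) : Type) with hκdef
  set ν : κ → Measure ℝ := fun n => μ n.1 with hν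
  set H : (κ → ℝ) → Matrix Λ Λ ℝ := fun W =>
    Ham (freePot v F Λ W) Λ - Ebar • (1 : Matrix Λ Λ ℝ) with hH
  set bas : ∀ W, EigBasis (H W) := fun W => hermitianBasis (shifted_isHermitian _ Λ Ebar) with hbas
  set e : κ → Λ := freeIncl F Λ with he
  set good : Set (κ → ℝ) :=
    {W | HopAll (tiltC (clampPot M v F Λ W) Ebar) F Λ D (4 * 2 ^ J) ρ Θ γ} with hgood
  set S : Finset κ := Finset.univ.filter fun n => (n : ℤ × ℤ) ∉ ⋃ k, (Λ' k : Set (ℤ × ℤ)) with hS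
  have hA0 : 0 ≤ A := by linarith
  have heig : ∀ W i, (Ham (freePot v F Λ W) Λ).mulVec (specVec (bas W) i)
      = (Ebar + (bas W).val i) • specVec (bas W) i := fun W i =>
    ham_mulVec_of_shifted (mulVec_specVec (bas W) i)
  have hlocW : ∀ W : κ → ℝ, (∀ n, W n ∈ Set.Icc 0 M) → ∀ i, |(bas W).val i| ≤ w →
      ∑ z : Λ, (if (z : ℤ × ℤ) ∈ (⋃ k, (Λ' k : Set (ℤ × ℤ))) then 0 else
        specVec (bas W) i z ^ 2) ≤ θ ∧
      1 / 4 ≤ ∑ z : Λ, (if (z : ℤ × ℤ) ∈ G then specVec (bas W) i z ^ 2 else 0) :=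
    fun W hW i hi => hloc _ (fun n _ => freePot_mem hM.le hv hW n)
      (fun n _ hn => if_pos hn) (Ebar + (bas W).val i) (by rwa [add_sub_cancel_left]) _ (heig W i)
      (sum_sq_specVec (bas W) i)
  set bad : Set (κ → ℝ) := {W | (∀ n, W n ∈ Set.Icc 0 M) ∧ ∃ i, |(bas W).val i| ≤ s 0} with hbad
  have hsw : s 0 ≤ w := by
    have h1 := hw 0 (Nat.zero_le _)
    have h2 : 0 ≤ 2 * M * (m * θ) := by positivity
    linarith
  have hbadle : Measure.pi ν bad ≤ ENNReal.ofReal (4 * (L₀ ^ 2 : ℕ) * (4 * 2 ^ J + 1) ^ 2 * P)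
        + m * ENNReal.ofReal (4 * m * L₀ / (ρ * N₀)) := by
    by_cases hne : bad.Nonempty
    swap
    · rw [Set.not_nonempty_iff_eq_empty.mp hne, measure_empty]
      exact zero_le
    have hEb : |Ebar| ≤ M + 9 := by
      obtain ⟨W, hW, i, hi⟩ := hne
      have h1 := abs_le_of_eigOn (fun n _ => freePot_mem hM.le hv hW n)
        (eigOn_of_mulVec (heig W i)) (fun n hn => extV_of_notMem _ hn) (by
          by_contra! hc
          have h1 := sum_sq_specVec (bas W) i
          rw [Finset.sum_eq_zero fun z _ => by
            have := hc z
            rw [extV_of_mem _ z.2] at this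
            rw [this, sq, zero_mul]] at h1
          exact zero_ne_one h1)
      have h2 := abs_le.mp h1
      have h3 := abs_le.mp hi
      rw [abs_le]
      constructor <;> linarith
    have hEb' := abs_le.mp hEb
    refine (measure_small_eigenvalue_le bas ν hM.le hρ (fun n => hsupp n) (fun n => hac n)
      freeIncl_injective (fun W W' u => shifted_form Ebar W W' u) hθ hw ?_ ?_ hs hr hr1 hg hs' hN₀
      good ?_ (S := S)).trans ?_
    · intro W hW
      have h1 := card_le_of_mass (bas W) (Finset.univ.filter fun i => |(bas W).val i| ≤ w)
        (Finset.univ.filter fun z : Λ => (z : ℤ × ℤ) ∈ G) fun i hi => by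
          rw [Finset.sum_filter]
          exact (hlocW W hW i (Finset.mem_filter.mp hi).2).2
      refine h1.trans ?_
      rw [hm]
      refine Nat.mul_le_mul_left 4 ?_
      rw [← Finset.card_image_of_injective _ Subtype.val_injective]
      refine Finset.card_le_card fun x hx => ?_
      simp only [Finset.mem_image, Finset.mem_filter] at hx
      obtain ⟨z, hz, rfl⟩ := hx
      exact hz.2
    · intro W hW i hi
      refine le_trans ?_ (hlocW W hW i hi).1
      rw [← Finset.sum_image (f := fun z => specVec (bas W) i z ^ 2) (g := e)
        fun x _ y _ h => freeIncl_injective h]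
      calc ∑ z ∈ S.image e, specVec (bas W) i z ^ 2
          = ∑ z ∈ S.image e, (if (z : ℤ × ℤ) ∈ (⋃ k, (Λ' k : Set (ℤ × ℤ))) then 0 else
              specVec (bas W) i z ^ 2) := by
            refine Finset.sum_congr rfl fun z hz => ?_
            obtain ⟨n, hn, rfl⟩ := Finset.mem_image.mp hz
            exact (if_neg (Finset.mem_filter.mp hn).2).symm
        _ ≤ _ := Finset.sum_le_sum_of_subset_of_nonneg (Finset.subset_univ _) fun z _ _ => by
            split_ifs
            exacts [le_rfl, sq_nonneg _]
    · intro W hWg hW i hi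
      by_contra! hlt
      have hWg' : HopAll (tiltC (freePot v F Λ W) Ebar) F Λ D (4 * 2 ^ J) ρ Θ γ := by
        rw [← clampPot_eq hW]
        exact hWg
      have hi' := abs_le.mp hi
      have hpot : ∀ n, freePot v F Λ W n ∈ Set.Icc 0 M := freePot_mem hM.le hv hW
      have hsm := eigenfunction_small_of_few (N₀ := N₀) (r := r) hJ hD hΛ' hL
        (eigOn_of_mulVec (heig W i)) (fun n hn => extV_of_notMem _ hn)
        (fun n _ => by
          have := hpot n
          rw [abs_le]
          constructor <;> linarith [this.1, this.2])
        (fun n _ => by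
          have := hpot n
          rw [abs_le]
          constructor <;> linarith [this.1, this.2])
        hA0 hγ0 hγ1 (by rwa [add_sub_cancel_left]) hΘ hΘγ hκ hρ hρ1 hc₀ρ hη hηc hWg' le_rfl hreg hr
        (by
          refine le_trans ?_ hlt.le
          rw [← Finset.card_image_of_injective
            (S.filter fun n => r ≤ |specVec (bas W) i (e n)|) Subtype.val_injective]
          norm_cast
          refine Finset.card_le_card fun x hx => ?_
          simp only [Finset.mem_filter] at hx
          obtain ⟨⟨hxΛ, hxF, hxd⟩, hxr⟩ := hx
          rw [extV_of_mem _ hxΛ] at hxr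
          refine Finset.mem_image.mpr ⟨⟨x, Finset.mem_filter.mpr ⟨hxΛ, hxF⟩⟩, ?_, rfl⟩
          exact Finset.mem_filter.mpr ⟨Finset.mem_filter.mpr ⟨Finset.mem_univ _, hxd⟩, hxr⟩)
        hcount
      have h2 := (hlocW W hW i hi).2
      refine absurd h2 (not_le.mpr (lt_of_le_of_lt ?_ hX))
      set X := r * Θ ^ (48 * 2 ^ J) * (A + 3) ^ (17 * 2 ^ (J + 3) * (K + 1)) with hXdef
      rw [← Finset.sum_filter]
      calc ∑ z ∈ Finset.univ.filter fun z : Λ => (z : ℤ × ℤ) ∈ G, specVec (bas W) i z ^ 2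
          ≤ ∑ z ∈ Finset.univ.filter fun z : Λ => (z : ℤ × ℤ) ∈ G, X ^ 2 := by
            refine Finset.sum_le_sum fun z _ => ?_
            have h3 := hsm z
            rw [extV_of_mem _ z.2] at h3
            rw [← sq_abs]
            exact pow_le_pow_left₀ (abs_nonneg _) h3 2
        _ = ((Finset.univ.filter fun z : Λ => (z : ℤ × ℤ) ∈ G).card : ℝ) * X ^ 2 := by
            rw [Finset.sum_const, nsmul_eq_mul]
        _ ≤ _ := by
            refine mul_le_mul_of_nonneg_right ?_ (sq_nonneg _)
            rw [← Finset.card_image_of_injective _ Subtype.val_injective]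
            norm_cast
            refine Finset.card_le_card fun x hx => ?_
            simp only [Finset.mem_image, Finset.mem_filter] at hx
            obtain ⟨z, hz, rfl⟩ := hx
            exact hz.2
    · have hcardΛ : Λ.card = L₀ ^ 2 := sqZ_card a b L₀
      refine add_le_add ?_ ?_
      · have h1 := measure_not_hopAll_le (Λ := Λ) (F := F) (v := v) (A := A) (D := D) (P := P)
          (amax := 4 * 2 ^ J) (Ebar := Ebar) (Θ := Θ) ν hM.le hρ.le hρ1 hγ hγ0
          (fun n => hsupp n) (fun n => hac n) hv hD (by linarith)
          (by push_cast; linarith) hP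
        rw [hcardΛ] at h1
        push_cast at h1 ⊢
        exact h1
      · gcongr
        refine Real.sqrt_le_iff.mpr ⟨by positivity, ?_⟩
        have h1 : S.card ≤ L₀ ^ 2 := by
          refine (Finset.card_filter_le _ _).trans ?_
          rw [Finset.card_univ, Fintype.card_coe, ← hcardΛ]
          exact Finset.card_filter_le _ _
        exact_mod_cast h1
  have hbox : Measure.pi ν {W : κ → ℝ | ∀ n, W n ∈ Set.Icc 0 M}ᶜ = 0 := by
    have h1 : Measure.pi ν (Set.univ.pi fun _ => Set.Icc 0 M) = 1 := by
      rw [Measure.pi_pi]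
      exact Finset.prod_eq_one fun n _ => hsupp n
    have h2 : (Set.univ.pi fun _ : κ => Set.Icc 0 M) = {W : κ → ℝ | ∀ n, W n ∈ Set.Icc 0 M} := by
      ext W
      exact ⟨fun h n => h n trivial, fun h n _ => h n⟩
    rw [← h2]
    rw [prob_compl_eq_zero_iff (MeasurableSet.univ_pi fun _ => measurableSet_Icc)]
    exact h1
  rw [tsub_le_iff_right]
  set T := {W : κ → ℝ | IsUnit (H W).det ∧ ∀ ψ : Λ → ℝ, Real.sqrt (∑ z : Λ,
    (((H W)⁻¹.mulVec ψ) z) ^ 2) ≤ (s 0)⁻¹ * Real.sqrt (∑ z : Λ, ψ z ^ 2)} with hT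
  have hcover : (Set.univ : Set (κ → ℝ)) ⊆ T ∪ (bad ∪ {W : κ → ℝ | ∀ n, W n ∈ Set.Icc 0 M}ᶜ) := by
    intro W _
    by_cases hW : ∀ n, W n ∈ Set.Icc 0 M
    · by_cases hb : ∃ i, |(bas W).val i| ≤ s 0
      · exact Or.inr (Or.inl ⟨hW, hb⟩)
      · push Not at hb
        exact Or.inl ((bas W).resolvent (hs 0) hb)
    · exact Or.inr (Or.inr hW)
  calc (1 : ENNReal) = Measure.pi ν Set.univ := measure_univ.symm
    _ ≤ Measure.pi ν (T ∪ (bad ∪ {W : κ → ℝ | ∀ n, W n ∈ Set.Icc 0 M}ᶜ)) := measure_mono hcover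
    _ ≤ Measure.pi ν T + (Measure.pi ν bad + Measure.pi ν {W : κ → ℝ | ∀ n, W n ∈ Set.Icc 0 M}ᶜ) :=
        (measure_union_le _ _).trans (add_le_add le_rfl (measure_union_le _ _))
    _ ≤ _ := by
        rw [hbox, add_zero]
        exact add_le_add le_rfl hbadle

open Filter in
theorem eventually_mul_log_le (B : ℝ) {T c : ℝ} (hT : 0 < T) (hc : 0 < c) :
    ∀ᶠ x : ℝ in atTop, B * Real.log (T * x) ≤ x ^ c := by
  have h1 : Tendsto (fun x : ℝ => B * Real.log (T * x) / x ^ c) atTop (nhds 0) := by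
    have h2 := ((isLittleO_log_rpow_atTop hc).tendsto_div_nhds_zero).const_mul B
    have h3 : Tendsto (fun x : ℝ => B * Real.log T / x ^ c) atTop (nhds 0) :=
      tendsto_const_nhds.div_atTop (tendsto_rpow_atTop hc)
    have h4 := h3.add h2
    rw [mul_zero, add_zero] at h4
    refine h4.congr' ?_
    filter_upwards [eventually_gt_atTop 0] with x hx
    rw [Real.log_mul hT.ne' hx.ne']
    ring
  filter_upwards [h1.eventually (gt_mem_nhds one_pos), eventually_gt_atTop 0] with x hx hx0
  rw [div_lt_one (by positivity)] at hx
  exact hx.le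

theorem rpow_scale_le {N L L' ε k : ℝ} (hN : 1 ≤ N) (hε : 0 ≤ ε) (hε1 : ε ≤ 1) (hk : 0 ≤ k)
    (h : N ^ (1 - k * ε) ≤ L) (h' : L ^ (1 - ε) ≤ L') : N ^ (1 - (k + 1) * ε) ≤ L' := by
  have hN0 : 0 < N := by linarith
  refine le_trans ?_ h'
  calc N ^ (1 - (k + 1) * ε) ≤ (N ^ (1 - k * ε)) ^ (1 - ε) := by
        rw [← Real.rpow_mul hN0.le]
        refine Real.rpow_le_rpow_of_exponent_le hN ?_
        nlinarith [mul_nonneg hk (mul_nonneg hε hε)]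
    _ ≤ _ := Real.rpow_le_rpow (by positivity) h (by linarith)

/-- Largeness conditions on the outer scale. -/
def LargeScale (M γ₀ ρ T ε δ B : ℝ) (K : ℕ) (N : ℝ) : Prop :=
  608 / ρ * Real.log (T * N) ≤ N ^ (ε / 2) ∧ 5 / ρ * Real.log (200 * N) ≤ N ^ (ε / 2) ∧
  6 * Real.log (T * N) ≤ N ^ (2 / 5 : ℝ) ∧ 48 * (K + 1) * Real.log (T * N) ≤ N ^ δ ∧
  1 * Real.log (8 * N) ≤ N ^ (1 / 2 : ℝ) ∧ 24 ≤ N ^ (δ / 2) ∧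
  1 * Real.log (32 * M * N) ≤ N ^ (1 / 2 : ℝ) ∧ Real.log (32 / γ₀) ≤ N ^ (1 / 2 : ℝ) ∧
  B * Real.log (1 * N) ≤ N ^ ε ∧ 128 / ρ ≤ N ^ ε ∧ 8 * (K + 1) ≤ N ^ δ ∧ 1024 ≤ N

open Filter in
theorem eventually_largeScale {M T ε δ : ℝ} (γ₀ ρ B : ℝ) (K : ℕ) (hM : 0 < M) (hT : 0 < T)
    (hε : 0 < ε) (hδ : 0 < δ) : ∀ᶠ N in atTop, LargeScale M γ₀ ρ T ε δ B K N :=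
  (eventually_mul_log_le _ hT (half_pos hε)).and <|
  (eventually_mul_log_le _ (by norm_num) (half_pos hε)).and <|
  (eventually_mul_log_le _ hT (by norm_num)).and <|
  (eventually_mul_log_le _ hT hδ).and <|
  (eventually_mul_log_le _ (by norm_num) (by norm_num)).and <|
  ((tendsto_rpow_atTop (half_pos hδ)).eventually_ge_atTop _).and <|
  (eventually_mul_log_le _ (by positivity) (by norm_num)).and <|
  ((tendsto_rpow_atTop (by norm_num)).eventually_ge_atTop _).and <|
  (eventually_mul_log_le _ one_pos hε).and <|
  ((tendsto_rpow_atTop hε).eventually_ge_atTop _).and <|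
  ((tendsto_rpow_atTop hδ).eventually_ge_atTop _).and (eventually_ge_atTop _)

/-- The probability that hops fail is beaten by the mesh count. -/
theorem hop_failure_le {ρ γ Θ : ℝ} {D a b : ℕ} (hρ : 0 < ρ) (hγ : 0 < γ) (hΘ : 8 ≤ Θ)
    (hΘγ : 128 / γ ≤ Θ) (hbΘ : (a : ℝ) ≤ Θ) (hD1 : 1 ≤ D)
    (hD : 608 / ρ * Real.log Θ ≤ (D : ℝ) ^ 2) (ha : 32 * D ^ 2 ≤ a) (hb : 1 ≤ b)
    (hab : b ^ 2 * D ^ 2 ≤ a) :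
    b * (2 * hopCount b Θ γ + 1 : ℕ) ^ (b + 2) * Real.exp (-(ρ * a / 16))
      ≤ Real.exp (-(ρ * D ^ 2)) := by
  have hΘ0 : 0 < Θ := by linarith
  have hΘ1 : 1 ≤ Θ := by linarith
  have hD0 : (0 : ℝ) < D := by exact_mod_cast hD1
  have hb1 : (1 : ℝ) ≤ b := by exact_mod_cast hb
  have hbΘ' : (b : ℝ) ≤ Θ := by
    refine le_trans ?_ hbΘ
    have h1 : b * 1 ≤ b ^ 2 * D ^ 2 :=
      Nat.mul_le_mul (Nat.le_self_pow (by norm_num) b) (Nat.one_le_pow _ _ hD1)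
    exact_mod_cast (by omega : b ≤ a)
  have hcnt : ((2 * hopCount b Θ γ + 1 : ℕ) : ℝ) ≤ Θ ^ (2 * b + 4) := by
    have hq : Θ ^ (b + 1) / hopMesh b Θ γ = 64 / γ * Θ ^ (2 * b + 2) := by
      unfold hopMesh
      field_simp
      ring
    have h1 : (⌈64 / γ * Θ ^ (2 * b + 2)⌉₊ : ℝ) < 64 / γ * Θ ^ (2 * b + 2) + 1 :=
      Nat.ceil_lt_add_one (by positivity)
    have h2 : 1 ≤ Θ ^ (2 * b + 2) := one_le_pow₀ hΘ1
    unfold hopCount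
    rw [hq]
    push_cast
    calc 2 * ((⌈64 / γ * Θ ^ (2 * b + 2)⌉₊ : ℝ) + 1) + 1
        ≤ 128 / γ * Θ ^ (2 * b + 2) + 5 * Θ ^ (2 * b + 2) := by
          have : 128 / γ * Θ ^ (2 * b + 2) = 2 * (64 / γ * Θ ^ (2 * b + 2)) := by ring
          linarith
      _ = (128 / γ + 5) * Θ ^ (2 * b + 2) := by ring
      _ ≤ Θ ^ 2 * Θ ^ (2 * b + 2) := by
          gcongr
          nlinarith
      _ = _ := by ring
  have hmain : b * ((2 * hopCount b Θ γ + 1 : ℕ) : ℝ) ^ (b + 2) ≤ Θ ^ (19 * b ^ 2) := by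
    calc b * ((2 * hopCount b Θ γ + 1 : ℕ) : ℝ) ^ (b + 2)
        ≤ Θ * (Θ ^ (2 * b + 4)) ^ (b + 2) := by gcongr
      _ = Θ ^ (1 + (2 * b + 4) * (b + 2)) := by rw [← pow_mul, pow_add, pow_one]
      _ ≤ Θ ^ (19 * b ^ 2) := pow_le_pow_right₀ hΘ1 (by nlinarith)
  have hlog : 0 ≤ Real.log Θ := Real.log_nonneg hΘ1
  have hpow : Θ ^ (19 * b ^ 2) = Real.exp ((19 * b ^ 2 : ℕ) * Real.log Θ) := by
    rw [Real.exp_nat_mul, Real.exp_log hΘ0]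
  calc _ ≤ Real.exp ((19 * b ^ 2 : ℕ) * Real.log Θ) * Real.exp (-(ρ * a / 16)) := by
        rw [← hpow]
        gcongr
    _ = Real.exp ((19 * b ^ 2 : ℕ) * Real.log Θ - ρ * a / 16) := by
        rw [← Real.exp_add]; ring_nf
    _ ≤ _ := by
        refine Real.exp_le_exp.mpr ?_
        have hab' : (b : ℝ) ^ 2 * D ^ 2 ≤ a := by exact_mod_cast hab
        have ha' : 32 * (D : ℝ) ^ 2 ≤ a := by exact_mod_cast ha
        have h1 : 608 * Real.log Θ ≤ ρ * D ^ 2 := by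
          rw [div_mul_eq_mul_div, div_le_iff₀ hρ] at hD
          linarith
        have h2 : (b : ℝ) ^ 2 * (608 * Real.log Θ) ≤ ρ * a := by
          calc (b : ℝ) ^ 2 * (608 * Real.log Θ) ≤ (b : ℝ) ^ 2 * (ρ * D ^ 2) := by gcongr
            _ = ρ * (b ^ 2 * D ^ 2) := by ring
            _ ≤ _ := by gcongr
        have h3 : ρ * (32 * (D : ℝ) ^ 2) ≤ ρ * a := by gcongr
        push_cast
        linarith

theorem mesh_bound {X w Θ γ q : ℝ} {b : ℕ} (hγ : 0 < γ) (hΘX : 512 * X ≤ Θ)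
    (hΘγ : 1 ≤ γ * Θ) (hΘ : 1 ≤ Θ) (hw : w = Real.exp (-q)) (hq : (2 * b + 4) * Real.log Θ ≤ q) :
    4 * X * (w * (2 * Θ ^ (b + 1))) ≤ hopMesh b Θ γ := by
  have hΘ0 : 0 < Θ := by linarith
  have hw' : w * Θ ^ (2 * b + 4) ≤ 1 := by
    rw [hw]
    have : Θ ^ (2 * b + 4) = Real.exp ((2 * b + 4 : ℕ) * Real.log Θ) := by
      rw [Real.exp_nat_mul, Real.exp_log hΘ0]
    rw [this, ← Real.exp_add, ← Real.exp_zero]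
    refine Real.exp_le_exp.mpr ?_
    push_cast
    linarith
  have hw0 : 0 < w := hw ▸ Real.exp_pos _
  unfold hopMesh
  rw [le_div_iff₀ (by positivity)]
  calc 4 * X * (w * (2 * Θ ^ (b + 1))) * (64 * Θ ^ (b + 1))
      = 512 * X * (w * Θ ^ (2 * b + 2)) := by ring
    _ ≤ Θ * (w * Θ ^ (2 * b + 2)) * (γ * Θ) := by
        calc 512 * X * (w * Θ ^ (2 * b + 2)) ≤ Θ * (w * Θ ^ (2 * b + 2)) := by gcongr
          _ ≤ _ := le_mul_of_one_le_right (by positivity) hΘγ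
    _ = γ * (w * Θ ^ (2 * b + 4)) := by ring
    _ ≤ γ * 1 := by gcongr
    _ = γ := mul_one _

theorem count_term_le {ρ N₀ X : ℝ} {D j J : ℕ} (hρ : 0 < ρ) (hN₀ : 0 ≤ N₀) (hD : 1 ≤ D)
    (hX : (2 : ℝ) ^ J = X) (hj : j ≤ J) :
    N₀ * (2 * (4 * 2 ^ j : ℕ) + 1) ^ 2 / badLim ρ D (2 ^ j)
      ≤ N₀ * (20736 * D ^ 4 + 10368 / ρ * D * √X) := by
  have hD0 : (1 : ℝ) ≤ D := by exact_mod_cast hD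
  set h : ℝ := (2 : ℝ) ^ j with hh
  have hh1 : 1 ≤ h := one_le_pow₀ (by norm_num)
  have hhX : h ≤ X := hX ▸ pow_le_pow_right₀ (by norm_num) hj
  have hsq : (2 * ((4 * 2 ^ j : ℕ) : ℝ) + 1) ^ 2 ≤ 81 * h ^ 2 := by
    push_cast
    rw [← hh]
    nlinarith
  unfold badLim
  rw [mul_div_assoc]
  refine mul_le_mul_of_nonneg_left ?_ hN₀
  split_ifs with hc
  · have hc' : h ≤ 16 * (D : ℝ) ^ 2 := by rw [hh]; exact_mod_cast hc.le
    have h1 : h ^ 2 ≤ (16 * (D : ℝ) ^ 2) ^ 2 := by gcongr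
    have h2 : 0 ≤ 10368 / ρ * D * √X := by positivity
    rw [div_one]
    nlinarith
  · push Not at hc
    set n := Nat.sqrt (2 ^ j) with hn
    have hnD : 4 * D ≤ n := by
      rw [hn, Nat.le_sqrt]
      nlinarith
    have hdiv : n < 2 * D * (n / (2 * D)) + 2 * D := by
      have := Nat.div_add_mod n (2 * D)
      have := Nat.mod_lt n (by omega : 0 < 2 * D)
      omega
    have hdiv1 : 1 ≤ n / (2 * D) := (Nat.le_div_iff_mul_le (by omega)).mpr (by omega)
    set k := n / (2 * D) with hk
    have hk1 : (1 : ℝ) ≤ k := by exact_mod_cast hdiv1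
    have hnk : n + 1 ≤ 4 * D * k := by nlinarith
    have hroot : √h ≤ 4 * D * k := by
      have h1 : 2 ^ j < (n + 1) * (n + 1) := Nat.lt_succ_sqrt _
      have h2 : 2 ^ j ≤ (4 * D * k) ^ 2 := by nlinarith
      rw [Real.sqrt_le_iff]
      exact ⟨by positivity, by rw [hh]; exact_mod_cast h2⟩
    have hhh : √h * √h = h := Real.mul_self_sqrt (by linarith)
    have hρh : 0 < k * (ρ * h / 16) := by positivity
    push_cast
    rw [← hh]
    push_cast at hsq
    rw [← hh] at hsq
    calc (2 * (4 * h) + 1) ^ 2 / (k * (ρ * h / 16)) ≤ 81 * h ^ 2 / (k * (ρ * h / 16)) := by gcongr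
      _ = 1296 / ρ * (h / k) := by field_simp; ring
      _ ≤ 1296 / ρ * (√h * (4 * D)) := by
          gcongr
          rw [div_le_iff₀ (by linarith)]
          calc h = √h * √h := hhh.symm
            _ ≤ √h * (4 * D * k) := by gcongr
            _ = _ := by ring
      _ ≤ 1296 / ρ * (√X * (4 * D)) := by gcongr
      _ = 5184 / ρ * D * √X := by ring
      _ ≤ 10368 / ρ * D * √X := by gcongr; norm_num
      _ ≤ _ := le_add_of_nonneg_left (by positivity)

theorem count_sum_lt {ρ N X η ε : ℝ} {D J : ℕ} (hρ : 0 < ρ) (hD : 1 ≤ D) (hN : 1 ≤ N)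
    (hε : 0 < ε) (hX : (2 : ℝ) ^ J = X) (hXN : X ≤ N)
    (hNX : N ^ (1 - 3 * ε) ≤ 16 * X) (hDN : (D : ℝ) ≤ 2 * N ^ (ε / 4)) (hη : η < 1 / 30000)
    (hB : 1024 * (331776 + 20736 / ρ) * Real.log (1 * N) ≤ N ^ ε) (hε1 : ε ≤ 1 / 100) :
    ∑ j ∈ Finset.Icc 1 J, N ^ (3 / 2 - 8 * ε) * (2 * (4 * 2 ^ j : ℕ) + 1) ^ 2 / badLim ρ D (2 ^ j)
      + 49 * (η * 2 ^ (2 * J + 8)) < (2 : ℝ) ^ (2 * J) := by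
  have hN0 : 0 < N := by linarith
  have hX0 : 0 < X := hX ▸ by positivity
  have h2J : (2 : ℝ) ^ (2 * J) = X ^ 2 := by rw [← hX, ← pow_mul, mul_comm]
  rw [pow_add, h2J]
  have hJ : (J : ℝ) ≤ 2 * Real.log N := by
    have h1 : (J : ℝ) * Real.log 2 ≤ Real.log N := by
      rw [← Real.log_pow, hX]
      exact Real.log_le_log hX0 hXN
    have h2 := Real.log_two_gt_d9
    nlinarith [(Nat.cast_nonneg J : (0 : ℝ) ≤ J)]
  have hlog : 0 ≤ Real.log N := Real.log_nonneg hN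
  have hD4 : (D : ℝ) ^ 4 ≤ 16 * N ^ ε := by
    calc (D : ℝ) ^ 4 ≤ (2 * N ^ (ε / 4)) ^ 4 := by gcongr
      _ = 16 * N ^ ε := by
        rw [mul_pow, ← Real.rpow_mul_natCast hN0.le]
        norm_num
  have hbr : 20736 * (D : ℝ) ^ 4 + 10368 / ρ * D * √X
      ≤ (331776 + 20736 / ρ) * N ^ (1 / 2 + ε) := by
    have h1 : N ^ ε ≤ N ^ (1 / 2 + ε) := Real.rpow_le_rpow_of_exponent_le hN (by linarith)
    have h2 : D * √X ≤ 2 * N ^ (1 / 2 + ε) := by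
      calc D * √X ≤ 2 * N ^ (ε / 4) * √N := by gcongr
        _ = 2 * N ^ (ε / 4 + 1 / 2) := by
            rw [Real.sqrt_eq_rpow, mul_assoc, ← Real.rpow_add hN0]
        _ ≤ _ := by
            gcongr ?_ * ?_
            exact Real.rpow_le_rpow_of_exponent_le hN (by linarith)
    calc 20736 * (D : ℝ) ^ 4 + 10368 / ρ * D * √X
        = 20736 * (D : ℝ) ^ 4 + 10368 / ρ * (D * √X) := by ring
      _ ≤ 20736 * (16 * N ^ (1 / 2 + ε)) + 10368 / ρ * (2 * N ^ (1 / 2 + ε)) := by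
          gcongr
          exact hD4.trans (by gcongr)
      _ = _ := by ring
  have hsum : ∑ j ∈ Finset.Icc 1 J,
      N ^ (3 / 2 - 8 * ε) * (2 * (4 * 2 ^ j : ℕ) + 1) ^ 2 / badLim ρ D (2 ^ j) ≤ X ^ 2 / 2 := by
    calc _ ≤ ∑ j ∈ Finset.Icc 1 J,
          N ^ (3 / 2 - 8 * ε) * ((331776 + 20736 / ρ) * N ^ (1 / 2 + ε)) :=
          Finset.sum_le_sum fun j hj =>
            (count_term_le hρ (by positivity) hD hX (Finset.mem_Icc.mp hj).2).trans (by gcongr)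
      _ = J * (N ^ (3 / 2 - 8 * ε) * ((331776 + 20736 / ρ) * N ^ (1 / 2 + ε))) := by
          rw [Finset.sum_const, Nat.card_Icc, Nat.add_sub_cancel, nsmul_eq_mul]
      _ ≤ 2 * Real.log N * (N ^ (3 / 2 - 8 * ε) * ((331776 + 20736 / ρ) * N ^ (1 / 2 + ε))) := by
          gcongr
      _ = 1 / 512 * (1024 * (331776 + 20736 / ρ) * Real.log (1 * N)) * N ^ (2 - 7 * ε) := by
          have : N ^ (2 - 7 * ε) = N ^ (3 / 2 - 8 * ε) * N ^ (1 / 2 + ε) := by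
            rw [← Real.rpow_add hN0]; ring_nf
          rw [this, one_mul]
          ring
      _ ≤ 1 / 512 * N ^ ε * N ^ (2 - 7 * ε) := by gcongr
      _ = 1 / 512 * (N ^ (1 - 3 * ε)) ^ 2 := by
          rw [← Real.rpow_mul_natCast hN0.le, mul_assoc, ← Real.rpow_add hN0]
          norm_num
          ring_nf
      _ ≤ 1 / 512 * (16 * X) ^ 2 := by gcongr
      _ = X ^ 2 / 2 := by ring
  nlinarith [sq_pos_of_pos hX0]

theorem failure_le {ρ N ε δ m P : ℝ} {D X : ℝ} (hρ : 0 < ρ) (hN : 1 ≤ N) (hε : 0 < ε)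
    (hδ : δ ≤ ε) (hXN : 4 * X + 1 ≤ N) (hX : 0 ≤ X) (hD : N ^ (ε / 2) ≤ D ^ 2)
    (hB : 5 / ρ * Real.log (200 * N) ≤ N ^ (ε / 2)) (hm : m ≤ 4 * N ^ δ) (hm0 : 0 ≤ m)
    (hP : P = Real.exp (-(ρ * D ^ 2))) (hB' : 128 / ρ ≤ N ^ ε) :
    4 * N ^ 2 * (4 * X + 1) ^ 2 * P + m * (4 * m * N / (ρ * N ^ (3 / 2 - 8 * ε)))
      ≤ N ^ (11 * ε - 1 / 2) := by
  have hN0 : 0 < N := by linarith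
  have h1 : 4 * N ^ 2 * (4 * X + 1) ^ 2 * P ≤ 1 / 2 * N ^ (11 * ε - 1 / 2) := by
    have hP' : P ≤ ((200 * N) ^ 5)⁻¹ := by
      have : (200 * N) ^ 5 = Real.exp ((5 : ℕ) * Real.log (200 * N)) := by
        rw [Real.exp_nat_mul, Real.exp_log (by positivity)]
      rw [this, ← Real.exp_neg, hP]
      refine Real.exp_le_exp.mpr (neg_le_neg ?_)
      rw [div_mul_eq_mul_div, div_le_iff₀ hρ] at hB
      push_cast
      nlinarith
    have hP0 : 0 ≤ P := hP ▸ (Real.exp_pos _).le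
    have h2 : N⁻¹ ≤ N ^ (11 * ε - 1 / 2) := by
      rw [← Real.rpow_neg_one]
      exact Real.rpow_le_rpow_of_exponent_le hN (by linarith)
    calc 4 * N ^ 2 * (4 * X + 1) ^ 2 * P ≤ 4 * N ^ 2 * N ^ 2 * ((200 * N) ^ 5)⁻¹ := by gcongr
      _ = 4 / 200 ^ 5 * N⁻¹ := by field_simp
      _ ≤ 1 / 2 * N⁻¹ := mul_le_mul_of_nonneg_right (by norm_num) (by positivity)
      _ ≤ _ := by gcongr
  have h3 : m * (4 * m * N / (ρ * N ^ (3 / 2 - 8 * ε))) ≤ 1 / 2 * N ^ (11 * ε - 1 / 2) := by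
    calc m * (4 * m * N / (ρ * N ^ (3 / 2 - 8 * ε)))
        = 4 / ρ * (m ^ 2 * (N / N ^ (3 / 2 - 8 * ε))) := by field_simp
      _ ≤ 4 / ρ * ((4 * N ^ ε) ^ 2 * (N / N ^ (3 / 2 - 8 * ε))) := by
          gcongr
          exact hm.trans (by gcongr)
      _ = 1 / 2 * (128 / ρ) * ((N ^ ε) ^ 2 * (N / N ^ (3 / 2 - 8 * ε))) := by ring
      _ ≤ 1 / 2 * N ^ ε * ((N ^ ε) ^ 2 * (N / N ^ (3 / 2 - 8 * ε))) := by gcongr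
      _ = 1 / 2 * N ^ (11 * ε - 1 / 2) := by
          have : N / N ^ (3 / 2 - 8 * ε) = N ^ (1 - (3 / 2 - 8 * ε)) := by
            rw [Real.rpow_sub hN0 1, Real.rpow_one]
          rw [this, ← Real.rpow_mul_natCast hN0.le, mul_assoc, ← Real.rpow_add hN0,
            ← Real.rpow_add hN0]
          norm_num
          ring_nf
  linarith

theorem scale_facts {M γ₀ ρ T ε δ B N L₁ L₂ L₃ L₄ L₅ : ℝ} {K : ℕ} (hδ : 0 < δ)
    (hδε : δ < ε) (hε1 : ε < 1 / 100) (h : LargeScale M γ₀ ρ T ε δ B K N)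
    (h54 : L₅ ≤ L₄) (h43 : L₄ ≤ L₃) (h32 : L₃ ≤ L₂) (h21 : L₂ ≤ L₁) (h10 : L₁ ≤ N)
    (h1 : N ^ (1 - ε) ≤ L₁) (h2 : L₂ ≤ L₁ ^ (1 - 2 * δ)) (h2' : L₁ ^ (1 - ε) ≤ L₂)
    (h3 : L₃ ≤ L₂ ^ (1 - 2 * δ)) (h3' : L₂ ^ (1 - ε) ≤ L₃) (h4 : L₃ ^ (1 - ε) ≤ L₄)
    (h5 : L₄ ^ (1 - ε) ≤ L₅) :
    N ^ (1 - 3 * ε) ≤ L₃ ∧ 32 ≤ L₅ ∧ N ^ (1 / 2 : ℝ) ≤ L₅ ∧ 8 * (K + 1) * L₃ ≤ N ∧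
    6 * √L₃ * Real.log (T * N) ≤ L₅ ∧ 48 * (K + 1) * L₃ * Real.log (T * N) ≤ L₂ ∧
    ∀ m, m ≤ 4 * N ^ δ → m * (2 * L₂ + 3) + 4 * L₂ ≤ L₁ := by
  obtain ⟨-, -, f3, f4, -, f6, -, -, -, -, f12, f11⟩ := h
  have hN : 1 ≤ N := by linarith
  have hN0 : 0 < N := by linarith
  have hε : 0 ≤ ε := by linarith
  have e1 : N ^ (1 - 1 * ε) ≤ L₁ := by rwa [one_mul]
  have e2 := rpow_scale_le hN hε (by linarith) (by norm_num) e1 h2'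
  have e3 := rpow_scale_le hN hε (by linarith) (by norm_num) e2 h3'
  have e4 := rpow_scale_le hN hε (by linarith) (by norm_num) e3 h4
  have e5 := rpow_scale_le hN hε (by linarith) (by norm_num) e4 h5
  have e59 : N ^ (9 / 10 : ℝ) ≤ L₅ :=
    (Real.rpow_le_rpow_of_exponent_le hN (by linarith)).trans e5
  have e55 : N ^ (1 / 2 : ℝ) ≤ L₅ :=
    (Real.rpow_le_rpow_of_exponent_le hN (by norm_num)).trans e59
  have h32N : (32 : ℝ) ≤ N ^ (1 / 2 : ℝ) := by
    rw [← Real.sqrt_eq_rpow]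
    exact Real.le_sqrt_of_sq_le (by linarith)
  have hL5 : 32 ≤ L₅ := h32N.trans e55
  have hL30 : 0 < L₃ := by linarith
  have hL20 : 0 < L₂ := by linarith
  have g1 : N ^ δ * L₃ ≤ L₂ := by
    have hL2 : 0 < L₂ := by linarith
    have hNL : N ≤ L₂ ^ (2 : ℝ) := by
      have h := Real.rpow_le_rpow (z := 2) (by positivity)
        (e55.trans (by linarith : L₅ ≤ L₂)) (by norm_num)
      rw [← Real.rpow_mul hN0.le] at h
      norm_num at h ⊢
      exact h
    calc N ^ δ * L₃ ≤ (L₂ ^ (2 : ℝ)) ^ δ * L₂ ^ (1 - 2 * δ) := by gcongr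
      _ = L₂ := by
          rw [← Real.rpow_mul hL2.le, ← Real.rpow_add hL2]
          norm_num
  have g2 : N ^ (3 / 2 * δ) * L₂ ≤ L₁ := by
    have hL1 : 0 < L₁ := by linarith
    have hNL : N ^ (3 / 2 * δ) ≤ L₁ ^ (2 * δ) := by
      have h := Real.rpow_le_rpow (z := 2 * δ) (by positivity) e1 (by linarith)
      rw [← Real.rpow_mul hN0.le] at h
      exact (Real.rpow_le_rpow_of_exponent_le hN (by nlinarith)).trans h
    calc N ^ (3 / 2 * δ) * L₂ ≤ L₁ ^ (2 * δ) * L₁ ^ (1 - 2 * δ) := by gcongr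
      _ = L₁ := by
          rw [← Real.rpow_add hL1]
          norm_num
  refine ⟨(Real.rpow_le_rpow_of_exponent_le hN (by linarith)).trans e3, hL5, e55, ?_, ?_, ?_, ?_⟩
  · calc 8 * (K + 1) * L₃ ≤ N ^ δ * L₃ := by gcongr
      _ ≤ L₂ := g1
      _ ≤ N := by linarith
  · calc 6 * √L₃ * Real.log (T * N) = √L₃ * (6 * Real.log (T * N)) := by ring
      _ ≤ √L₃ * N ^ (2 / 5 : ℝ) := by gcongr
      _ ≤ N ^ (1 / 2 : ℝ) * N ^ (2 / 5 : ℝ) := by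
          rw [← Real.sqrt_eq_rpow]
          gcongr
          linarith
      _ = N ^ (9 / 10 : ℝ) := by rw [← Real.rpow_add hN0]; norm_num
      _ ≤ L₅ := e59
  · calc 48 * (K + 1) * L₃ * Real.log (T * N)
        = 48 * (K + 1) * Real.log (T * N) * L₃ := by ring
      _ ≤ N ^ δ * L₃ := by gcongr
      _ ≤ L₂ := g1
  · intro m hm
    have hNδ : 1 ≤ N ^ δ := Real.one_le_rpow hN hδ.le
    have h23 : 2 * L₂ + 3 ≤ 3 * L₂ := by linarith
    calc m * (2 * L₂ + 3) + 4 * L₂ ≤ 4 * N ^ δ * (3 * L₂) + 4 * N ^ δ * L₂ := by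
          gcongr
          linarith
      _ = 16 * N ^ δ * L₂ := by ring
      _ ≤ N ^ (δ / 2) * N ^ δ * L₂ := by gcongr; linarith
      _ = N ^ (3 / 2 * δ) * L₂ := by rw [← Real.rpow_add hN0]; ring_nf
      _ ≤ L₁ := g2

/-- Geometric windows around the spectral parameter. -/
def windowScale (L₁ L₂ : ℝ) (l : ℕ) : ℝ := Real.exp (-L₁) * (9 * Real.exp (2 * L₂)) ^ l

theorem windowScale_le {L₁ L₂ : ℝ} {l m : ℕ} (hL₂ : 0 ≤ L₂) (hl : l ≤ m) :
    windowScale L₁ L₂ l ≤ Real.exp (m * (2 * L₂ + 3) - L₁) := by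
  have h9 : 9 * Real.exp (2 * L₂) ≤ Real.exp (2 * L₂ + 3) := by
    rw [add_comm, Real.exp_add]
    gcongr
    have h1 : Real.exp 3 = Real.exp 1 ^ 3 := by rw [← Real.exp_nat_mul]; norm_num
    rw [h1]
    have h2 := Real.exp_one_gt_d9
    calc (9 : ℝ) ≤ 2.7 ^ 3 := by norm_num
      _ ≤ _ := by gcongr; linarith
  calc windowScale L₁ L₂ l ≤ Real.exp (-L₁) * (Real.exp (2 * L₂ + 3)) ^ m := by
        unfold windowScale
        gcongr
        refine (pow_le_pow_left₀ (by positivity) h9 l).trans (pow_le_pow_right₀ ?_ hl)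
        exact Real.one_le_exp (by positivity)
    _ = _ := by
        rw [← Real.exp_nat_mul, ← Real.exp_add]
        ring_nf

theorem windowScale_succ (L₁ L₂ : ℝ) (l : ℕ) :
    9 * windowScale L₁ L₂ l = windowScale L₁ L₂ (l + 1) * Real.exp (-L₂) ^ 2 := by
  have h : Real.exp (2 * L₂) * Real.exp (-L₂) ^ 2 = 1 := by
    rw [← Real.exp_nat_mul, ← Real.exp_add, ← Real.exp_zero]
    congr 1
    push_cast
    ring
  unfold windowScale
  rw [pow_succ]
  linear_combination (-(9 * Real.exp (-L₁) * (9 * Real.exp (2 * L₂)) ^ l)) * h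

theorem window_add_lt {M N L₁ L₂ L₄ L₅ : ℝ} {l m : ℕ} (hM : 0 < M) (hL5 : 32 ≤ L₅)
    (h54 : L₅ ≤ L₄) (h52 : L₅ ≤ L₂) (hN : 1 ≤ N) (hmN : (m : ℝ) ≤ 4 * N)
    (hm : m * (2 * L₂ + 3) + 4 * L₂ ≤ L₁) (hlog : Real.log (32 * M * N) ≤ L₅) (hl : l ≤ m) :
    windowScale L₁ L₂ l + 2 * M * (m * Real.exp (-(2 * L₄))) < Real.exp (-L₅) := by
  have h1 : windowScale L₁ L₂ l ≤ Real.exp (-L₅) / 2 := by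
    refine (windowScale_le (by linarith) hl).trans ?_
    calc Real.exp (m * (2 * L₂ + 3) - L₁) ≤ Real.exp (-L₅ - 1) :=
          Real.exp_le_exp.mpr (by linarith)
      _ ≤ _ := by
        rw [Real.exp_sub]
        gcongr
        linarith [Real.exp_one_gt_d9]
  have h2 : 2 * M * (m * Real.exp (-(2 * L₄))) ≤ Real.exp (-L₅) / 4 := by
    have h3 : 32 * M * N ≤ Real.exp L₅ := by
      rwa [Real.log_le_iff_le_exp (by positivity)] at hlog
    calc 2 * M * (m * Real.exp (-(2 * L₄)))
        ≤ 2 * M * (4 * N * (Real.exp (-L₅) * Real.exp (-L₅))) := by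
          gcongr
          rw [← Real.exp_add]
          exact Real.exp_le_exp.mpr (by linarith)
      _ = (32 * M * N) * (Real.exp (-L₅) * Real.exp (-L₅)) / 4 := by ring
      _ ≤ Real.exp L₅ * (Real.exp (-L₅) * Real.exp (-L₅)) / 4 := by gcongr
      _ = Real.exp (-L₅) / 4 := by
          rw [← mul_assoc, ← Real.exp_add, add_neg_cancel, Real.exp_zero, one_mul]
  linarith [Real.exp_pos (-L₅)]

theorem window_lt_gap {γ₀ L₁ L₂ : ℝ} {l m : ℕ} (hγ : 0 < γ₀) (hL₂ : 0 < L₂)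
    (hm : m * (2 * L₂ + 3) + 4 * L₂ ≤ L₁) (hlog : Real.log (32 / γ₀) ≤ L₂) (hl : l ≤ m) :
    16 * windowScale L₁ L₂ l < γ₀ / 2 * Real.exp (-L₂) ^ 2 := by
  rw [Real.log_le_iff_le_exp (by positivity), div_le_iff₀ hγ] at hlog
  have h1 : windowScale L₁ L₂ l ≤ Real.exp (-(4 * L₂)) :=
    (windowScale_le hL₂.le hl).trans (Real.exp_le_exp.mpr (by linarith))
  have h2 : Real.exp L₂ * Real.exp (-(4 * L₂)) < Real.exp (-L₂) ^ 2 := by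
    rw [← Real.exp_add, ← Real.exp_nat_mul]
    refine Real.exp_lt_exp.mpr ?_
    push_cast
    linarith
  calc 16 * windowScale L₁ L₂ l ≤ 32 / 2 * Real.exp (-(4 * L₂)) := by linarith
    _ ≤ Real.exp L₂ * γ₀ / 2 * Real.exp (-(4 * L₂)) := by gcongr
    _ = γ₀ / 2 * (Real.exp L₂ * Real.exp (-(4 * L₂))) := by ring
    _ < _ := by gcongr

theorem amplitude_lt {N L₂ L₃ A Θ g : ℝ} {J K : ℕ} (hL₃ : 16 * (2 : ℝ) ^ J = L₃)
    (hg : g ≤ N) (hN : 1 ≤ N) (hA : 0 ≤ A + 3) (hAΘ : A + 3 ≤ Θ) (hΘ : 1 ≤ Θ)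
    (h : 48 * (K + 1) * L₃ * Real.log Θ ≤ L₂) (hlog : Real.log (8 * N) ≤ L₂) :
    g * (Real.exp (-L₂) * Θ ^ (48 * 2 ^ J) * (A + 3) ^ (17 * 2 ^ (J + 3) * (K + 1))) ^ 2
      < 1 / 4 := by
  rw [Real.log_le_iff_le_exp (by positivity)] at hlog
  have hΘ0 : 0 < Θ := by linarith
  have hexp : Θ ^ (48 * 2 ^ J) * (A + 3) ^ (17 * 2 ^ (J + 3) * (K + 1)) ≤ Real.exp (L₂ / 4) := by
    calc Θ ^ (48 * 2 ^ J) * (A + 3) ^ (17 * 2 ^ (J + 3) * (K + 1))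
        ≤ Θ ^ (48 * 2 ^ J) * Θ ^ (17 * 2 ^ (J + 3) * (K + 1)) := by gcongr
      _ = Θ ^ (48 * 2 ^ J + 17 * 2 ^ (J + 3) * (K + 1)) := (pow_add _ _ _).symm
      _ = Real.exp ((48 * 2 ^ J + 17 * 2 ^ (J + 3) * (K + 1) : ℕ) * Real.log Θ) := by
          rw [Real.exp_nat_mul, Real.exp_log hΘ0]
      _ ≤ _ := by
          refine Real.exp_le_exp.mpr ?_
          have h1 : ((48 * 2 ^ J + 17 * 2 ^ (J + 3) * (K + 1) : ℕ) : ℝ) ≤ 12 * (K + 1) * L₃ := by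
            rw [← hL₃]
            push_cast
            rw [pow_add]
            have : (0 : ℝ) ≤ 2 ^ J * K := by positivity
            have : (0 : ℝ) < 2 ^ J := by positivity
            nlinarith
          have h2 := mul_le_mul_of_nonneg_right h1 (Real.log_nonneg hΘ)
          linarith
  have hr : Real.exp (-L₂) * Θ ^ (48 * 2 ^ J) * (A + 3) ^ (17 * 2 ^ (J + 3) * (K + 1))
      ≤ Real.exp (-(3 / 4 * L₂)) := by
    rw [mul_assoc]
    calc _ ≤ Real.exp (-L₂) * Real.exp (L₂ / 4) := by gcongr
      _ = _ := by rw [← Real.exp_add]; ring_nf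
  calc _ ≤ N * Real.exp (-(3 / 4 * L₂)) ^ 2 := by gcongr
    _ ≤ N * Real.exp (-L₂) := by
        rw [← Real.exp_nat_mul]
        gcongr
        have h2 : 0 ≤ L₂ := by
          by_contra! hc
          have := Real.exp_lt_one_iff.mpr hc
          linarith
        push_cast
        linarith
    _ ≤ N * (8 * N)⁻¹ := by
        rw [Real.exp_neg]
        gcongr
    _ = 1 / 8 := by field_simp
    _ < 1 / 4 := by norm_num

theorem le_exp_of_sqrt_mul_le {x t : ℝ} (hx : 0 ≤ x) (h : Real.exp t * √x ≤ 1) :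
    x ≤ Real.exp (-(2 * t)) := by
  have h1 : √x ≤ Real.exp (-t) := by
    rw [Real.exp_neg, ← one_div, le_div_iff₀ (Real.exp_pos t)]
    linarith
  calc x = √x ^ 2 := (Real.sq_sqrt hx).symm
    _ ≤ Real.exp (-t) ^ 2 := by gcongr
    _ = _ := by
      rw [← Real.exp_nat_mul]
      congr 1
      push_cast
      ring

theorem quarter_le_of_sqrt {x : ℝ} (h : 1 ≤ 2 * √x) : 1 / 4 ≤ x :=
  le_trans (by norm_num) ((Real.le_sqrt' (by norm_num : (0 : ℝ) < 1 / 2)).mp (by linarith))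

set_option maxHeartbeats 2000000 in
/-- Wegner estimate. For independent site measures `μ n` supported in
`[0,M]` and uniformly anti-concentrated, there is `C > 0` such that for every `K ≥ 1`
there are a smallness threshold `τ > 0` and constants `Cc η ε δ` with the following
property: under the hypotheses (1)–(7) of the Wegner lemma, the probability that
`H_Λ − Ē` is invertible with operator norm `‖(H_Λ − Ē)⁻¹‖ ≤ e^{L₁}` is at least
`1 − L₀^{Cε−1/2}`. -/
theorem stmt_17 (M γ₀ ρ : ℝ) (hM : 0 < M) (hγ : 0 < γ₀) (hρ : 0 < ρ)
    (μ : ℤ × ℤ → Measure ℝ) [∀ n, IsProbabilityMeasure (μ n)]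
    (hsupp : ∀ n, μ n (Set.Icc 0 M) = 1)
    (hac : ∀ n, ∀ t ∈ Set.Icc (0:ℝ) M, ENNReal.ofReal ρ ≤ μ n {s | γ₀ / 2 < |s - t|}) :
    ∃ C > (0:ℝ), ∀ K : ℕ, 1 ≤ K →
    ∃ τ > (0:ℝ), ∃ Cc : ℝ → ℝ → ℝ → ℝ,
    ∀ (Ebar η ε δ : ℝ) (L₀ L₁ L₂ L₃ L₄ L₅ : ℕ) (a b : ℤ)
      (Λ' : Fin K → Finset (ℤ × ℤ)) (G : Finset (ℤ × ℤ)) (F : Set (ℤ × ℤ))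
      (v : ℤ × ℤ → ℝ),
      -- (1) smallness of the parameters
      0 < δ → δ < ε → ε < η → η < τ →
      -- (2) the scales are dyadic, decreasing, large, and compatible
      ((∃ m, L₀ = 2 ^ m) ∧ (∃ m, L₁ = 2 ^ m) ∧ (∃ m, L₂ = 2 ^ m) ∧ (∃ m, L₃ = 2 ^ m) ∧
        (∃ m, L₄ = 2 ^ m) ∧ (∃ m, L₅ = 2 ^ m)) →
      (L₅ ≤ L₄ ∧ L₄ ≤ L₃ ∧ L₃ ≤ L₂ ∧ L₂ ≤ L₁ ∧ L₁ ≤ L₀) →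
      Cc η ε δ ≤ (L₅ : ℝ) →
      ((L₁ : ℝ) ≤ (L₀ : ℝ) ^ (1 - 2 * δ) ∧ (L₀ : ℝ) ^ (1 - ε) ≤ (L₁ : ℝ) ∧
       (L₂ : ℝ) ≤ (L₁ : ℝ) ^ (1 - 2 * δ) ∧ (L₁ : ℝ) ^ (1 - ε) ≤ (L₂ : ℝ) ∧
       (L₃ : ℝ) ≤ (L₂ : ℝ) ^ (1 - 2 * δ) ∧ (L₂ : ℝ) ^ (1 - ε) ≤ (L₃ : ℝ) ∧
       (L₄ : ℝ) ≤ (L₃ : ℝ) ^ (1 - 2 * δ) ∧ (L₃ : ℝ) ^ (1 - ε) ≤ (L₄ : ℝ) ∧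
       (L₅ : ℝ) ≤ (L₄ : ℝ) ^ (1 - 2 * δ) ∧ (L₄ : ℝ) ^ (1 - ε) ≤ (L₅ : ℝ)) →
      -- (4) the defect squares: squares of side length L₃ inside Λ = sqZ a b L₀
      (∀ k, ∃ a' b' : ℤ, Λ' k = sqZ a' b' L₃ ∧ Λ' k ⊆ sqZ a b L₀) →
      -- (5) the localization set G
      (G : Set (ℤ × ℤ)) ⊆ (⋃ k, (Λ' k : Set (ℤ × ℤ))) →
      0 < G.card → (G.card : ℝ) ≤ (L₀ : ℝ) ^ (δ : ℝ) →
      -- (6) regularity of F away from the defect squares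
      (∀ a'' b'' : ℤ, (sqZ a'' b'' L₃ : Set (ℤ × ℤ)) ⊆
          (sqZ a b L₀ : Set (ℤ × ℤ)) \ (⋃ k, (Λ' k : Set (ℤ × ℤ))) →
        RegularIn η F (sqZ a'' b'' L₃ : Set (ℤ × ℤ))) →
      -- (7) quasi-localization for the frozen data v
      (∀ n ∈ F, v n ∈ Set.Icc (0:ℝ) M) →
      (∀ W : ℤ × ℤ → ℝ, (∀ n ∈ sqZ a b L₀, W n ∈ Set.Icc (0:ℝ) M) →
        (∀ n ∈ sqZ a b L₀, n ∈ F → W n = v n) →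
        ∀ E : ℝ, |E - Ebar| ≤ Real.exp (-(L₅ : ℝ)) →
        ∀ ψ : sqZ a b L₀ → ℝ, (Ham W (sqZ a b L₀)).mulVec ψ = E • ψ →
          Real.exp (L₄ : ℝ) * Real.sqrt (∑ z : sqZ a b L₀,
              (if (z : ℤ × ℤ) ∈ (⋃ k, (Λ' k : Set (ℤ × ℤ))) then 0 else ψ z ^ 2)) ≤
            Real.sqrt (∑ z : sqZ a b L₀, ψ z ^ 2) ∧
          Real.sqrt (∑ z : sqZ a b L₀, ψ z ^ 2) ≤
            (1 + (L₀ : ℝ) ^ (-(δ : ℝ))) * Real.sqrt (∑ z : sqZ a b L₀,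
              (if (z : ℤ × ℤ) ∈ G then ψ z ^ 2 else 0))) →
      -- conclusion: Wegner-type bound for the resolvent at Ē
      1 - ENNReal.ofReal ((L₀ : ℝ) ^ (C * ε - 1/2)) ≤
        Measure.pi (fun n : ((sqZ a b L₀).filter (· ∉ F) : Finset (ℤ × ℤ)) => μ n.1)
          {W | IsUnit (Ham (fun n => if n ∈ F then v n
                  else extV ((sqZ a b L₀).filter (· ∉ F)) W n) (sqZ a b L₀)
                - Ebar • (1 : Matrix (sqZ a b L₀) (sqZ a b L₀) ℝ)).det ∧
            ∀ ψ : sqZ a b L₀ → ℝ,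
              Real.sqrt (∑ z : sqZ a b L₀,
                (((Ham (fun n => if n ∈ F then v n
                      else extV ((sqZ a b L₀).filter (· ∉ F)) W n) (sqZ a b L₀)
                    - Ebar • (1 : Matrix (sqZ a b L₀) (sqZ a b L₀) ℝ))⁻¹.mulVec ψ) z) ^ 2) ≤
                Real.exp (L₁ : ℝ) * Real.sqrt (∑ z : sqZ a b L₀, ψ z ^ 2)} := by
  have hM0 : (0 : ℝ) ∈ Set.Icc 0 M := ⟨le_rfl, hM.le⟩
  have hρ1 : ρ ≤ 1 := by
    have h1 := (hac 0 0 hM0).trans prob_le_one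
    rwa [ENNReal.ofReal_le_one] at h1
  set γ := min γ₀ 1 with hγdef
  have hγ0 : 0 < γ := lt_min hγ one_pos
  set A : ℝ := 2 * M + 14 with hA
  set T : ℝ := 4 * (A + 2) + 128 / γ with hT
  have hT64 : 64 ≤ T := by
    have : 0 < 128 / γ := by positivity
    linarith
  have hTγ : 128 / γ ≤ T := by linarith
  have hTA : 4 * (A + 2) ≤ T := by
    have : 0 < 128 / γ := by positivity
    linarith
  refine ⟨11, by norm_num, fun K _ => ⟨min (1 / 30000) (ρ / 100), by positivity, ?_⟩⟩
  have hthr : ∀ ε δ : ℝ, ∃ N₁ : ℝ, 0 < ε → 0 < δ → ∀ N ≥ N₁,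
      LargeScale M γ₀ ρ T ε δ (1024 * (331776 + 20736 / ρ)) K N := by
    intro ε δ
    by_cases h : 0 < ε ∧ 0 < δ
    · obtain ⟨N₁, hN₁⟩ := Filter.eventually_atTop.mp
        (eventually_largeScale (T := T) γ₀ ρ (1024 * (331776 + 20736 / ρ)) K hM (by linarith) h.1 h.2)
      exact ⟨N₁, fun _ _ => hN₁⟩
    · exact ⟨0, fun h1 h2 => absurd ⟨h1, h2⟩ h⟩
  choose Cc hCc using hthr
  refine ⟨fun _ => Cc, ?_⟩
  intro Ebar η ε δ L₀ L₁ L₂ L₃ L₄ L₅ a b Λ' G F v hδ hδε hεη hητ hdy hord hL5 hrel hΛ' hG hG0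
    hGcard hreg hv hloc
  obtain ⟨-, -, -, ⟨n₃, hn₃⟩, -, -⟩ := hdy
  obtain ⟨h54, h43, h32, h21, h10⟩ := hord
  obtain ⟨-, r1, r2, r2', r3, r3', -, r4, -, r5⟩ := hrel
  have hε : 0 < ε := hδ.trans hδε
  have hη1 : η < 1 / 30000 := hητ.trans_le (min_le_left _ _)
  have hηρ : η < ρ / 100 := hητ.trans_le (min_le_right _ _)
  have h54' : (L₅ : ℝ) ≤ L₄ := by exact_mod_cast h54
  have h43' : (L₄ : ℝ) ≤ L₃ := by exact_mod_cast h43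
  have h32' : (L₃ : ℝ) ≤ L₂ := by exact_mod_cast h32
  have h21' : (L₂ : ℝ) ≤ L₁ := by exact_mod_cast h21
  have h10' : (L₁ : ℝ) ≤ L₀ := by exact_mod_cast h10
  set N : ℝ := (L₀ : ℝ) with hN
  have hlarge := hCc ε δ hε hδ N (hL5.trans (by linarith))
  obtain ⟨f30, f5, fL2, f8, fκ, fX, fm⟩ := scale_facts hδ hδε (by linarith) hlarge h54' h43' h32'
    h21' h10' r1 r2 r2' r3 r3' r4 r5
  obtain ⟨l1, l2, -, -, l5, -, l7, l8, l9, l10, -, l11⟩ := hlarge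
  rw [one_mul] at l5 l7
  have hN1 : 1 ≤ N := by linarith
  obtain ⟨J, rfl⟩ : ∃ J, n₃ = J + 5 := by
    have h0 : (32 : ℝ) ≤ L₃ := by linarith
    have h1 : 2 ^ 5 ≤ L₃ := by exact_mod_cast h0
    rw [hn₃] at h1
    exact ⟨n₃ - 5, by have := (Nat.pow_le_pow_iff_right one_lt_two).mp h1; omega⟩
  have hL₃ : 16 * (2 : ℝ) ^ (J + 1) = L₃ := by
    rw [hn₃]
    push_cast
    ring
  set X : ℝ := (2 : ℝ) ^ (J + 1) with hX
  have hX1 : 1 ≤ X := one_le_pow₀ (by norm_num)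
  set Θ : ℝ := T * L₃ with hΘ
  have hΘT : T ≤ Θ := le_mul_of_one_le_right (by linarith) (by linarith)
  have hΘ64 : 64 * L₃ ≤ Θ := mul_le_mul_of_nonneg_right hT64 (by positivity)
  have hlogΘ : Real.log Θ ≤ Real.log (T * N) := by
    refine Real.log_le_log (by linarith) ?_
    exact mul_le_mul_of_nonneg_left (by linarith) (by linarith)
  have hlogΘ0 : 0 ≤ Real.log Θ := Real.log_nonneg (by linarith)
  set D : ℕ := ⌈N ^ (ε / 4)⌉₊ with hD
  have hNε : 1 ≤ N ^ (ε / 4) := Real.one_le_rpow hN1 (by linarith)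
  have hDle : N ^ (ε / 4) ≤ D := Nat.le_ceil _
  have hD1 : 1 ≤ D := by exact_mod_cast hNε.trans hDle
  have hDN : (D : ℝ) ≤ 2 * N ^ (ε / 4) := by
    have := Nat.ceil_lt_add_one (by linarith : 0 ≤ N ^ (ε / 4))
    linarith
  have hD2 : N ^ (ε / 2) ≤ (D : ℝ) ^ 2 := by
    calc N ^ (ε / 2) = (N ^ (ε / 4)) ^ 2 := by
          rw [← Real.rpow_mul_natCast (by linarith)]
          congr 1
          push_cast
          ring
      _ ≤ _ := by gcongr
  have hDΘ : 608 / ρ * Real.log Θ ≤ (D : ℝ) ^ 2 :=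
    (mul_le_mul_of_nonneg_left hlogΘ (by positivity)).trans (l1.trans hD2)
  have hcard : (G.card : ℝ) ≤ N := hGcard.trans (by
    calc N ^ δ ≤ N ^ (1 : ℝ) := Real.rpow_le_rpow_of_exponent_le hN1 (by linarith)
      _ = N := Real.rpow_one N)
  have hm4 : ((4 * G.card : ℕ) : ℝ) ≤ 4 * N ^ δ := by push_cast; linarith
  have hmain := wegner_of_bounds (M := M) (γ₀ := γ₀) (γ := γ) (ρ := ρ) (Ebar := Ebar) (A := A)
    (Θ := Θ) (η := η) (c₀ := ρ / 100) (θ := Real.exp (-(2 * L₄))) (w := Real.exp (-L₅))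
    (r := Real.exp (-L₂)) (N₀ := N ^ (3 / 2 - 8 * ε)) (P := Real.exp (-(ρ * D ^ 2)))
    (D := D) (J := J + 1) (m := 4 * G.card) (s := windowScale L₁ L₂) (L₀ := L₀) (K := K)
    (Λ' := Λ') (G := G) (F := F) (v := v) (a := a) (b := b)
    hM hρ hρ1 (min_le_left _ _) hγ0 (min_le_right _ _) μ hsupp hac (by omega) hD1
    (fun k => by
      obtain ⟨a', b', h, -⟩ := hΛ' k
      exact ⟨a', b', by rw [h, hn₃]⟩)
    (by
      have h1 : 16 * (2 : ℝ) ^ (J + 1 + 3) * (K + 1) ≤ L₀ := by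
        calc 16 * (2 : ℝ) ^ (J + 1 + 3) * (K + 1) = 8 * (K + 1) * L₃ := by
              rw [← hL₃, hX, pow_add _ _ 3]
              ring
          _ ≤ L₀ := f8
      exact_mod_cast h1)
    (fun a'' b'' h => by
      rw [hn₃] at hreg
      exact hreg a'' b'' h)
    hv
    (fun V hV hVv E hE ψ hψ hψ1 => by
      obtain ⟨h1, h2⟩ := hloc V hV hVv E hE ψ hψ
      rw [hψ1, Real.sqrt_one] at h1 h2
      refine ⟨?_, ?_⟩
      · exact le_exp_of_sqrt_mul_le (Finset.sum_nonneg fun z _ => by split_ifs <;> positivity) h1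
      · have h3 : N ^ (-δ) ≤ 1 := Real.rpow_le_one_of_one_le_of_nonpos hN1 (by linarith)
        exact quarter_le_of_sqrt
          (h2.trans (mul_le_mul_of_nonneg_right (by linarith) (Real.sqrt_nonneg _))))
    le_rfl (Real.exp_le_one_iff.mpr (by linarith))
    (by
      calc 64 * (2 : ℝ) ^ (J + 1) * (A + 2) = 4 * (A + 2) * L₃ := by rw [← hL₃]; ring
        _ ≤ Θ := mul_le_mul_of_nonneg_right hTA (by positivity))
    (hTγ.trans hΘT)
    (fun b hb => by
      refine mesh_bound (q := L₅) hγ0 (by linarith) ?_ (by linarith) rfl ?_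
      · have := hTγ.trans hΘT
        rw [div_le_iff₀ hγ0] at this
        linarith
      · have h1 : (b : ℝ) ≤ √L₃ := by
          refine Real.le_sqrt_of_sq_le ?_
          have h2 : b * b ≤ 2 ^ (J + 1) := Nat.le_sqrt.mp hb
          have h3 : (b : ℝ) * b ≤ X := by rw [hX]; exact_mod_cast h2
          nlinarith
        have h2 : (1 : ℝ) ≤ √L₃ := Real.one_le_sqrt.mpr (by linarith)
        refine le_trans ?_ fκ
        refine mul_le_mul (by linarith) hlogΘ hlogΘ0 (by linarith))
    le_rfl (by linarith) hηρ.le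
    (count_sum_lt hρ hD1 hN1 hε hX.symm (by linarith) (by linarith) hDN hη1 l9 (by linarith))
    (fun a b ha haX hb hab => hop_failure_le hρ hγ0 (by linarith) (hTγ.trans hΘT) (by
      have h1 : (a : ℝ) ≤ 4 * 2 ^ (J + 1) := by exact_mod_cast haX
      linarith) hD1 hDΘ ha hb hab)
    rfl (Real.exp_pos _).le
    (fun l hl => window_add_lt hM (by linarith) h54' (by linarith) hN1
      (by push_cast; linarith) (fm _ hm4) (l7.trans fL2) hl)
    (fun l => by unfold windowScale; positivity) (Real.exp_pos _)
    (Real.exp_le_one_iff.mpr (by linarith))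
    (fun l hl => window_lt_gap hγ (by linarith) (fm _ hm4) (by linarith) hl.le)
    (fun l => (windowScale_succ _ _ l).le) (by positivity)
    (amplitude_lt hL₃ hcard hN1 (by linarith) (by linarith) (by linarith)
      ((mul_le_mul_of_nonneg_left hlogΘ (by positivity)).trans fX) (by linarith))
  have hs0 : (windowScale L₁ L₂ 0)⁻¹ = Real.exp L₁ := by
    rw [windowScale, pow_zero, mul_one, ← Real.exp_neg, neg_neg]
  rw [hs0] at hmain
  refine le_trans (tsub_le_tsub_left ?_ 1) hmain
  have hfail := failure_le (X := X) (m := (4 * G.card : ℕ)) hρ hN1 hε hδε.le (by linarith)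
    (by linarith) hD2 l2 hm4 (by positivity) rfl l10
  rw [← ENNReal.ofReal_natCast (4 * G.card), ← ENNReal.ofReal_mul (by positivity),
    ← ENNReal.ofReal_add (by positivity) (by positivity)]
  refine ENNReal.ofReal_le_ofReal (le_trans (le_of_eq ?_) hfail)
  push_cast
  ring
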